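/- Let k be an algebraically closed field of characteristic p > 0, G̃ a finite group, G a normal subgroup of G̃, B = kG·b a block of kG, B̃ = kG̃·b̃ a block of kG̃ covering B, and I := I_{G̃}(B). Assume: (i) every left finite brick in B-mod is I-stable; (ii) H²(I/G, k^×) is trivial; (iii) k[I/G] is basic, and let e be the number of isomorphism classes of simple k[I/G]-modules. For a left finite semibrick S ≅ ⊕_{i=1}^{n} S_i in B-mod (decomposition into bricks) with extending kI-modules S̃_i^{(1)}, …, S̃_i^{(e)} of each S_i, the kG̃-module b̃ · Ind_I^{G̃}(⊕_{i=1}^{n} ⊕_{j=1}^{e} S̃_i^{(j)}) is a left finite semibrick in B̃-mod; moreover, non-isomorphic left finite semibricks in B-mod yield non-isomorphic left finite semibricks in B̃-mod under this assignment. -/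

import Mathlib

open scoped TensorProduct

namespace Paper

/-! ### Torsion-theoretic notions over an arbitrary ring -/

section Torsion

variable (R : Type) [Ring R]

/-- `FacCl R C` : quotient modules of finite direct sums of modules in `C`. -/
def FacCl (C : ModuleCat.{0} R → Prop) (M : ModuleCat.{0} R) : Prop :=
  ∃ (n : ℕ) (N : Fin n → ModuleCat.{0} R), (∀ i, C (N i)) ∧
    ∃ f : ((i : Fin n) → N i) →ₗ[R] M, Function.Surjective f

/-- `SubCl R C` : submodules of finite direct sums of modules in `C`. -/
def SubCl (C : ModuleCat.{0} R → Prop) (M : ModuleCat.{0} R) : Prop :=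
  ∃ (n : ℕ) (N : Fin n → ModuleCat.{0} R), (∀ i, C (N i)) ∧
    ∃ f : M →ₗ[R] ((i : Fin n) → N i), Function.Injective f

/-- `AddCl R C` : direct summands of finite direct sums of modules in `C`. -/
def AddCl (C : ModuleCat.{0} R → Prop) (M : ModuleCat.{0} R) : Prop :=
  ∃ (n : ℕ) (N : Fin n → ModuleCat.{0} R), (∀ i, C (N i)) ∧
    ∃ (s : M →ₗ[R] ((i : Fin n) → N i)) (r : ((i : Fin n) → N i) →ₗ[R] M),
      ∀ m : M, r (s m) = m

/-- `FiltCl R C` : modules having a finite filtration with subquotients in `add C`. -/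
def FiltCl (C : ModuleCat.{0} R → Prop) (M : ModuleCat.{0} R) : Prop :=
  ∃ (l : ℕ) (F : Fin (l + 1) → Submodule R M),
    Monotone F ∧ F 0 = ⊥ ∧ F (Fin.last l) = ⊤ ∧
      ∀ i : Fin l, AddCl R C (ModuleCat.of R
        (↥(F i.succ) ⧸ Submodule.comap (F i.succ).subtype (F i.castSucc)))

/-- A torsion class inside the ambient class `Amb` of modules:  a subclass of `Amb`
closed under quotient modules, finite direct sums and extensions. -/
def IsTorsionClassIn (Amb T : ModuleCat.{0} R → Prop) : Prop :=
  (∀ M, T M → Amb M) ∧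
  (∀ (M N : ModuleCat.{0} R) (f : M →ₗ[R] N),
      Amb N → Function.Surjective f → T M → T N) ∧
  (∀ (n : ℕ) (N : Fin n → ModuleCat.{0} R), (∀ i, T (N i)) →
      Amb (ModuleCat.of R ((i : Fin n) → N i)) →
      T (ModuleCat.of R ((i : Fin n) → N i))) ∧
  (∀ (M : ModuleCat.{0} R) (A : Submodule R M), Amb M →
      T (ModuleCat.of R ↥A) → T (ModuleCat.of R (↥M ⧸ A)) → T M)

/-- A torsion-free class inside the ambient class `Amb` of modules. -/
def IsTorsionFreeClassIn (Amb F : ModuleCat.{0} R → Prop) : Prop :=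
  (∀ M, F M → Amb M) ∧
  (∀ (M N : ModuleCat.{0} R) (f : M →ₗ[R] N),
      Amb M → Function.Injective f → F N → F M) ∧
  (∀ (n : ℕ) (N : Fin n → ModuleCat.{0} R), (∀ i, F (N i)) →
      Amb (ModuleCat.of R ((i : Fin n) → N i)) →
      F (ModuleCat.of R ((i : Fin n) → N i))) ∧
  (∀ (M : ModuleCat.{0} R) (A : Submodule R M), Amb M →
      F (ModuleCat.of R ↥A) → F (ModuleCat.of R (↥M ⧸ A)) → F M)

/-- The smallest torsion class (inside `Amb`) containing the class `C`. -/
def TorsClIn (Amb C : ModuleCat.{0} R → Prop) (M : ModuleCat.{0} R) : Prop :=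
  ∀ T : ModuleCat.{0} R → Prop, IsTorsionClassIn R Amb T →
    (∀ X, Amb X → C X → T X) → T M

/-- The smallest torsion-free class (inside `Amb`) containing the class `C`. -/
def TorfClIn (Amb C : ModuleCat.{0} R → Prop) (M : ModuleCat.{0} R) : Prop :=
  ∀ F : ModuleCat.{0} R → Prop, IsTorsionFreeClassIn R Amb F →
    (∀ X, Amb X → C X → F X) → F M

/-- The ambient class of finitely generated modules. -/
def FGMod (M : ModuleCat.{0} R) : Prop := Module.Finite R M

def ContravariantlyFinite (Amb C : ModuleCat.{0} R → Prop) : Prop :=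
  ∀ M : ModuleCat.{0} R, Amb M →
    ∃ X : ModuleCat.{0} R, C X ∧ ∃ f : X →ₗ[R] M,
      ∀ Y : ModuleCat.{0} R, C Y → ∀ g : Y →ₗ[R] M,
        ∃ h : Y →ₗ[R] X, ∀ y : Y, f (h y) = g y

def CovariantlyFinite (Amb C : ModuleCat.{0} R → Prop) : Prop :=
  ∀ M : ModuleCat.{0} R, Amb M →
    ∃ X : ModuleCat.{0} R, C X ∧ ∃ f : M →ₗ[R] X,
      ∀ Y : ModuleCat.{0} R, C Y → ∀ g : M →ₗ[R] Y,
        ∃ h : X →ₗ[R] Y, ∀ m : M, h (f m) = g m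

def FunctoriallyFinite (Amb C : ModuleCat.{0} R → Prop) : Prop :=
  ContravariantlyFinite R Amb C ∧ CovariantlyFinite R Amb C

/-- `M` is (isomorphic to) a direct summand of `W`. -/
def IsSummandOf (X W : Type) [AddCommGroup X] [Module R X]
    [AddCommGroup W] [Module R W] : Prop :=
  ∃ (s : X →ₗ[R] W) (r : W →ₗ[R] X), ∀ x : X, r (s x) = x

/-- An indecomposable module: nonzero and not the direct sum of two nonzero submodules. -/
def IndecMod (M : Type) [AddCommGroup M] [Module R M] : Prop :=
  Nontrivial M ∧ ∀ A B : Submodule R M, IsCompl A B → A = ⊥ ∨ B = ⊥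

/-- A projective cover: a surjection from a projective module with superfluous kernel. -/
def IsProjCover {P V : Type} [AddCommGroup P] [Module R P]
    [AddCommGroup V] [Module R V] (π : P →ₗ[R] V) : Prop :=
  Module.Projective R P ∧ Function.Surjective π ∧
    ∀ L : Submodule R P, LinearMap.ker π ⊔ L = ⊤ → L = ⊤

/-- An injective envelope: an injection into an injective module with essential image. -/
def IsInjEnv {V I : Type} [AddCommGroup V] [Module R V]
    [AddCommGroup I] [Module R I] (ι : V →ₗ[R] I) : Prop :=
  Module.Injective R I ∧ Function.Injective ι ∧
    ∀ L : Submodule R I, L ≠ ⊥ → L ⊓ LinearMap.range ι ≠ ⊥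

/-- A central idempotent. -/
def IsCentralIdem (b : R) : Prop :=
  b * b = b ∧ ∀ a : R, a * b = b * a

/-- A block idempotent: a primitive idempotent of the center. -/
def IsBlockIdem (b : R) : Prop :=
  b ≠ 0 ∧ IsCentralIdem R b ∧
    ∀ c d : R, IsCentralIdem R c → IsCentralIdem R d →
      c * d = 0 → d * c = 0 → b = c + d → c = 0 ∨ d = 0

/-- The module `U` lies in the block determined by the central idempotent `b`. -/
def LiesIn (b : R) (U : Type) [AddCommGroup U] [Module R U] : Prop :=
  ∀ u : U, b • u = u

/-- The `b`-component `b·M` of a module `M`, for a central idempotent `b`. -/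
def blockComp (b : R) (hb : ∀ a : R, a * b = b * a)
    (M : Type) [AddCommGroup M] [Module R M] : Submodule R M where
  carrier := {m : M | b • m = m}
  add_mem' := by
    intro x y hx hy
    simp only [Set.mem_setOf_eq] at *
    rw [smul_add, hx, hy]
  zero_mem' := by simp
  smul_mem' := by
    intro c m hm
    simp only [Set.mem_setOf_eq] at *
    rw [smul_smul, ← hb c, mul_smul, hm]

/-- The ambient class of finitely generated modules lying in the block of `b`. -/
def BlockFG (b : R) : ModuleCat.{0} R → Prop :=
  fun M => Module.Finite R M ∧ LiesIn R b M

end Torsion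

/-! ### Bundled modules with a compatible `k`-structure -/

structure BModule (k R : Type) [CommSemiring k] [Ring R] [Algebra k R] : Type 1 where
  carrier : Type
  [isAddCommGroup : AddCommGroup carrier]
  [isModuleK : Module k carrier]
  [isModuleR : Module R carrier]
  [isTower : IsScalarTower k R carrier]

attribute [instance] BModule.isAddCommGroup BModule.isModuleK BModule.isModuleR
  BModule.isTower

instance (k R : Type) [CommSemiring k] [Ring R] [Algebra k R] :
    CoeSort (BModule k R) Type :=
  ⟨BModule.carrier⟩

section GroupAlg

variable (k : Type) [Field k]

/-- A brick over a `k`-algebra `R`: a nonzero module all of whose `R`-endomorphisms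
are given by scalars in `k`. -/
def IsBrickOver (R : Type) [Ring R] [Algebra k R]
    (U : Type) [AddCommGroup U] [Module R U] : Prop :=
  Nontrivial U ∧ ∀ f : U →ₗ[R] U, ∃ c : k, ∀ u : U, f u = algebraMap k R c • u

/-- A module which is a finite direct sum of bricks with no nonzero homomorphisms
between non-isomorphic summands. -/
def IsSemibrickModule (R : Type) [Ring R] [Algebra k R]
    (M : Type) [AddCommGroup M] [Module R M] : Prop :=
  ∃ (m : ℕ) (T : Fin m → BModule k R),
    Nonempty (M ≃ₗ[R] ((i : Fin m) → ↥(T i))) ∧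
    (∀ i, IsBrickOver k R ↥(T i)) ∧
    ∀ i j, IsEmpty (↥(T i) ≃ₗ[R] ↥(T j)) → ∀ f : ↥(T i) →ₗ[R] ↥(T j), f = 0

/-- `V` is one-dimensional over `k`. -/
def OneDimOver (V : Type) [AddCommGroup V] [Module k V] : Prop :=
  ∃ v : V, v ≠ 0 ∧ ∀ w : V, ∃ c : k, w = c • v

/-- Triviality of the second group cohomology `H²(Q, kˣ)` (trivial action):
every `2`-cocycle is a `2`-coboundary. -/
def H2Trivial (Q : Type) [Group Q] : Prop :=
  ∀ α : Q → Q → kˣ,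
    (∀ a b c : Q, α a b * α (a * b) c = α b c * α a (b * c)) →
    ∃ β : Q → kˣ, ∀ a b : Q, α a b = β a * β b * (β (a * b))⁻¹

/-- The `k`-algebra `R` is basic (for `k` algebraically closed this means that
every simple module is one-dimensional over `k`). -/
def BasicAlg (R : Type) [Ring R] [Algebra k R] : Prop :=
  ∀ V : BModule k R, IsSimpleModule R ↥V → OneDimOver k ↥V

/-- `P` has exactly `n` isomorphism classes of modules satisfying it. -/
def RepClasses (R : Type) [Ring R] [Algebra k R]
    (P : BModule k R → Prop) (n : ℕ) : Prop :=
  ∃ V : Fin n → BModule k R, (∀ i, P (V i)) ∧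
    (∀ i j, i ≠ j → IsEmpty (↥(V i) ≃ₗ[R] ↥(V j))) ∧
    ∀ W : BModule k R, P W → ∃ i, Nonempty (↥W ≃ₗ[R] ↥(V i))

/-- The ring homomorphism `k[A] → k[B]` induced by a group homomorphism `f : A → B`. -/
noncomputable def MapAlong {A B : Type} [Group A] [Group B] (f : A →* B) :
    MonoidAlgebra k A →+* MonoidAlgebra k B :=
  MonoidAlgebra.mapDomainRingHom k f

/-- The `k[B]`-module `W` restricted along `f : A → B` is isomorphic to the
`k[A]`-module `U`; i.e. `W` is an extending module of `U`. -/
def ExtendsAlong {A B : Type} [Group A] [Group B] (f : A →* B)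
    (U : Type) [AddCommGroup U] [Module (MonoidAlgebra k A) U]
    (W : Type) [AddCommGroup W] [Module (MonoidAlgebra k B) W] : Prop :=
  ∃ φ : U ≃+ W, ∀ (a : MonoidAlgebra k A) (u : U),
    φ (a • u) = MapAlong k f a • φ u

/-- `η : U →+ W` exhibits the `k[B]`-module `W` as the module induced along
`f : A → B` from the `k[A]`-module `U`: `η` is `k[A]`-linear into the restriction
of `W`, and has the universal (left-adjoint) property. -/
def IsInducedUnit {A B : Type} [Group A] [Group B] (f : A →* B)
    (U : Type) [AddCommGroup U] [Module (MonoidAlgebra k A) U]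
    (W : Type) [AddCommGroup W] [Module (MonoidAlgebra k B) W]
    (η : U →+ W) : Prop :=
  (∀ (a : MonoidAlgebra k A) (u : U), η (a • u) = MapAlong k f a • η u) ∧
  ∀ (X : BModule k (MonoidAlgebra k B)) (g : U →+ ↥X),
    (∀ (a : MonoidAlgebra k A) (u : U), g (a • u) = MapAlong k f a • g u) →
    ∃! F : W →ₗ[MonoidAlgebra k B] ↥X, ∀ u : U, F (η u) = g u

/-- `W` is (a realization of) the induced module `Ind` of `U` along `f`. -/
def IsInducedAlong {A B : Type} [Group A] [Group B] (f : A →* B)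
    (U : Type) [AddCommGroup U] [Module (MonoidAlgebra k A) U]
    (W : Type) [AddCommGroup W] [Module (MonoidAlgebra k B) W] : Prop :=
  ∃ η : U →+ W, IsInducedUnit k f U W η

variable (Gt : Type) [Group Gt] (G : Subgroup Gt) [G.Normal]

/-- Conjugation `g ↦ x⁻¹ g x` as a homomorphism of the normal subgroup `G`. -/
def conjHom (x : Gt) : ↥G →* ↥G where
  toFun g := ⟨x⁻¹ * ↑g * x, ‹G.Normal›.conj_mem' (↑g) g.2 x⟩
  map_one' := by
    apply Subtype.ext
    simp
  map_mul' g h := by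
    apply Subtype.ext
    push_cast
    group

/-- The `kG`-module `U` is stable under conjugation by `x`, i.e. `ˣU ≅ U`. -/
def IsStableAt (x : Gt) (U : Type) [AddCommGroup U]
    [Module (MonoidAlgebra k ↥G) U] : Prop :=
  ∃ ψ : U ≃+ U, ∀ (a : MonoidAlgebra k ↥G) (u : U),
    ψ (MapAlong k (conjHom Gt G x) a • u) = a • ψ u

/-- The `kG`-module `U` is `G̃`-stable. -/
def IsGtStable (U : Type) [AddCommGroup U]
    [Module (MonoidAlgebra k ↥G) U] : Prop :=
  ∀ x : Gt, IsStableAt k Gt G x U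

/-- The inertia group of an element `b ∈ kG` inside `G̃`:
all `x ∈ G̃` with `x b x⁻¹ = b`. -/
def inertia (b : MonoidAlgebra k ↥G) : Subgroup Gt where
  carrier := {x : Gt | Commute (MonoidAlgebra.of k Gt x) (MapAlong k G.subtype b)}
  one_mem' := by
    simp only [Set.mem_setOf_eq, map_one]
    exact Commute.one_left _
  mul_mem' := by
    intro a c ha hc
    simp only [Set.mem_setOf_eq, map_mul] at *
    exact ha.mul_left hc
  inv_mem' := by
    intro a ha
    simp only [Set.mem_setOf_eq] at *
    have h1 : MonoidAlgebra.of k Gt a⁻¹ * MonoidAlgebra.of k Gt a = 1 := by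
      rw [← map_mul, inv_mul_cancel, map_one]
    have h2 : MonoidAlgebra.of k Gt a * MonoidAlgebra.of k Gt a⁻¹ = 1 := by
      rw [← map_mul, mul_inv_cancel, map_one]
    show MonoidAlgebra.of k Gt a⁻¹ * MapAlong k G.subtype b
        = MapAlong k G.subtype b * MonoidAlgebra.of k Gt a⁻¹
    calc MonoidAlgebra.of k Gt a⁻¹ * MapAlong k G.subtype b
        = MonoidAlgebra.of k Gt a⁻¹ * MapAlong k G.subtype b *
            (MonoidAlgebra.of k Gt a * MonoidAlgebra.of k Gt a⁻¹) := by
          rw [h2, mul_one]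
      _ = MonoidAlgebra.of k Gt a⁻¹ * (MapAlong k G.subtype b * MonoidAlgebra.of k Gt a) *
            MonoidAlgebra.of k Gt a⁻¹ := by noncomm_ring
      _ = MonoidAlgebra.of k Gt a⁻¹ * (MonoidAlgebra.of k Gt a * MapAlong k G.subtype b) *
            MonoidAlgebra.of k Gt a⁻¹ := by rw [← ha.eq]
      _ = (MonoidAlgebra.of k Gt a⁻¹ * MonoidAlgebra.of k Gt a) *
            (MapAlong k G.subtype b * MonoidAlgebra.of k Gt a⁻¹) := by noncomm_ring
      _ = MapAlong k G.subtype b * MonoidAlgebra.of k Gt a⁻¹ := by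
          rw [h1, one_mul]

/-- Relative projectivity of a `k[A]`-module with respect to a subgroup `D ≤ A`:
any `k[A]`-linear surjection onto a quotient admitting a `k[D]`-linear splitting of
a lifting problem admits a `k[A]`-linear solution. -/
def RelProj (A : Type) [Group A] (D : Subgroup A)
    (U : Type) [AddCommGroup U] [Module (MonoidAlgebra k A) U] : Prop :=
  ∀ (M N : BModule k (MonoidAlgebra k A))
    (f : ↥M →ₗ[MonoidAlgebra k A] ↥N) (g : U →ₗ[MonoidAlgebra k A] ↥N),
    Function.Surjective f →
    (∃ h : U →+ ↥M,
        (∀ (c : k) (u : U),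
          h (algebraMap k (MonoidAlgebra k A) c • u)
            = algebraMap k (MonoidAlgebra k A) c • h u) ∧
        (∀ (d : ↥D) (u : U),
          h (MonoidAlgebra.of k A ↑d • u) = MonoidAlgebra.of k A ↑d • h u) ∧
        ∀ u : U, f (h u) = g u) →
    ∃ h' : U →ₗ[MonoidAlgebra k A] ↥M, ∀ u : U, f (h' u) = g u

/-- `D` is a defect group of the block of `b`: `D` is minimal with respect to
inclusion among subgroups such that every module in the block is relatively
`D`-projective. -/
def IsDefectGroup (A : Type) [Group A] (b : MonoidAlgebra k A)
    (D : Subgroup A) : Prop :=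
  (∀ U : BModule k (MonoidAlgebra k A),
      LiesIn (MonoidAlgebra k A) b ↥U → RelProj k A D ↥U) ∧
  ∀ D' : Subgroup A, D' ≤ D →
    (∀ U : BModule k (MonoidAlgebra k A),
        LiesIn (MonoidAlgebra k A) b ↥U → RelProj k A D' ↥U) →
    D' = D

/-- Left finiteness (inside the ambient class `Amb`) of a module `S`: the smallest
torsion class containing `S` is functorially finite. -/
def IsLeftFiniteIn (R : Type) [Ring R] (Amb : ModuleCat.{0} R → Prop)
    (S : Type) [AddCommGroup S] [Module R S] : Prop :=
  FunctoriallyFinite R Amb (TorsClIn R Amb (fun X => Nonempty (↥X ≃ₗ[R] S)))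

/-- `W₂` realizes the tensor product `W₁ ⊗ₖ V` with the diagonal `G̃`-action, where
`V` is a `k[G̃/G]`-module viewed as a `k[G̃]`-module via the projection. -/
def DiagTensorIso
    (W₁ : Type) [AddCommGroup W₁] [Module k W₁] [Module (MonoidAlgebra k Gt) W₁]
    [IsScalarTower k (MonoidAlgebra k Gt) W₁]
    (V : Type) [AddCommGroup V] [Module k V] [Module (MonoidAlgebra k (Gt ⧸ G)) V]
    [IsScalarTower k (MonoidAlgebra k (Gt ⧸ G)) V]
    (W₂ : Type) [AddCommGroup W₂] [Module k W₂] [Module (MonoidAlgebra k Gt) W₂]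
    [IsScalarTower k (MonoidAlgebra k Gt) W₂] : Prop :=
  ∃ θ : (W₁ ⊗[k] V) ≃ₗ[k] W₂,
    ∀ (x : Gt) (w : W₁) (v : V),
      θ ((MonoidAlgebra.of k Gt x • w) ⊗ₜ[k]
          (MonoidAlgebra.of k (Gt ⧸ G) (QuotientGroup.mk x) • v))
        = MonoidAlgebra.of k Gt x • θ (w ⊗ₜ[k] v)

end GroupAlg

section HomGen

variable {R : Type} [Ring R]

/-- Every nonzero quotient of `M` receives a nonzero map from `S`. -/
def HomGen (R S M : Type) [Ring R] [AddCommGroup S] [Module R S]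
    [AddCommGroup M] [Module R M] : Prop :=
  ∀ N : Submodule R M, N ≠ ⊤ → ∃ f : S →ₗ[R] M ⧸ N, f ≠ 0

variable {S M M' : Type} [AddCommGroup S] [Module R S]
  [AddCommGroup M] [Module R M] [AddCommGroup M'] [Module R M']

lemma HomGen.self : HomGen R S S := fun N hN => ⟨N.mkQ, fun h => hN (by
  rw [← Submodule.ker_mkQ N, h, LinearMap.ker_zero])⟩

/-- A family of maps into `M` from modules generated by `S`, whose images are not contained in
any common proper submodule. -/
lemma HomGen.of_family {ι : Type} {A : ι → Type} [∀ i, AddCommGroup (A i)] [∀ i, Module R (A i)]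
    (hA : ∀ i, HomGen R S (A i)) (g : ∀ i, A i →ₗ[R] M)
    (h : ∀ N : Submodule R M, (∀ i, LinearMap.range (g i) ≤ N) → N = ⊤) : HomGen R S M := by
  intro N hN
  by_contra! hc
  refine hN (h N fun i => ?_)
  by_contra hi
  have h1 : N.comap (g i) ≠ ⊤ := by
    intro h2
    apply hi
    rw [LinearMap.range_eq_map, Submodule.map_le_iff_le_comap, h2]
  obtain ⟨f, hf⟩ := hA i _ h1
  have h2 := hc ((Submodule.mapQ (N.comap (g i)) N (g i) le_rfl) ∘ₗ f)
  apply hf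
  have hinj : Function.Injective (Submodule.mapQ (N.comap (g i)) N (g i) le_rfl) := by
    rw [← LinearMap.ker_eq_bot, Submodule.mapQ, Submodule.ker_liftQ_eq_bot]
    rw [LinearMap.ker_comp, Submodule.ker_mkQ]
  ext s
  apply hinj
  rw [← LinearMap.comp_apply, h2]
  simp

lemma HomGen.of_surjective (hM : HomGen R S M) (g : M →ₗ[R] M') (hg : Function.Surjective g) :
    HomGen R S M' :=
  HomGen.of_family (ι := Unit) (A := fun _ => M) (fun _ => hM) (fun _ => g) fun N h => by
    have := h ()
    rwa [LinearMap.range_eq_top.mpr hg, top_le_iff] at this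

lemma HomGen.pi {n : ℕ} {A : Fin n → Type} [∀ i, AddCommGroup (A i)] [∀ i, Module R (A i)]
    (hA : ∀ i, HomGen R S (A i)) : HomGen R S ((i : Fin n) → A i) := by
  refine HomGen.of_family hA (fun i => LinearMap.single R A i) fun N h => ?_
  rw [eq_top_iff, ← LinearMap.iSup_range_single R A]
  exact iSup_le h

lemma HomGen.sSup_mem (P : Set (Submodule R M)) (hP : ∀ N ∈ P, HomGen R S N) :
    HomGen R S ↥(sSup P) := by
  refine HomGen.of_family (ι := P) (A := fun N => N.1) (fun N => hP N.1 N.2)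
    (fun N => Submodule.inclusion (le_sSup N.2)) fun N h => ?_
  have : sSup P ≤ N.map (sSup P).subtype := by
    refine sSup_le fun A hA x hx => ?_
    have h1 := h ⟨A, hA⟩ ⟨⟨x, hx⟩, rfl⟩
    exact ⟨_, h1, rfl⟩
  rw [eq_top_iff]
  rintro ⟨x, hx⟩ -
  obtain ⟨y, hy, rfl⟩ := this hx
  exact hy

lemma HomGen.extension (A : Submodule R M) (h₁ : HomGen R S A) (h₂ : HomGen R S (M ⧸ A)) :
    HomGen R S M := by
  intro N hN
  by_cases hA : A ≤ N
  · have h3 : N.map A.mkQ ≠ ⊤ := by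
      intro h
      apply hN
      have := congrArg (Submodule.comap A.mkQ) h
      rw [Submodule.comap_map_mkQ, Submodule.comap_top] at this
      rwa [sup_eq_right.mpr hA] at this
    obtain ⟨f, hf⟩ := h₂ _ h3
    let e := Submodule.quotientQuotientEquivQuotient A N hA
    refine ⟨e.toLinearMap ∘ₗ f, fun h => hf ?_⟩
    ext s
    apply e.injective
    simpa using LinearMap.congr_fun h s
  · have h3 : N.comap A.subtype ≠ ⊤ := by
      intro h
      apply hA
      rw [Submodule.comap_subtype_eq_top] at h
      exact h
    obtain ⟨f, hf⟩ := h₁ _ h3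
    have hinj : Function.Injective (Submodule.mapQ (N.comap A.subtype) N A.subtype le_rfl) := by
      rw [← LinearMap.ker_eq_bot, Submodule.mapQ, Submodule.ker_liftQ_eq_bot]
      rw [LinearMap.ker_comp, Submodule.ker_mkQ]
    refine ⟨(Submodule.mapQ (N.comap A.subtype) N A.subtype le_rfl) ∘ₗ f, fun h => hf ?_⟩
    ext s
    apply hinj
    simpa using LinearMap.congr_fun h s

lemma LiesIn.submodule {b : R} (h : LiesIn R b M) (N : Submodule R M) : LiesIn R b N :=
  fun u => Subtype.ext (h u)

lemma LiesIn.of_surjective {b : R} (h : LiesIn R b M) (g : M →ₗ[R] M')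
    (hg : Function.Surjective g) : LiesIn R b M' := fun u => by
  obtain ⟨v, rfl⟩ := hg u
  rw [← map_smul, h]

variable [IsNoetherianRing R]

lemma BlockFG.submodule {b : R} [hf : Module.Finite R M] (h : LiesIn R b M) (N : Submodule R M) :
    BlockFG R b (ModuleCat.of R N) :=
  ⟨inferInstanceAs (Module.Finite R N), h.submodule N⟩

/-- The torsion class generated by `S` consists of the modules all of whose nonzero quotients
receive a nonzero map from `S`. -/
lemma torsClIn_iff {b : R} (hS : BlockFG R b (ModuleCat.of R S)) (M : ModuleCat.{0} R) :
    TorsClIn R (BlockFG R b) (fun X => Nonempty (↥X ≃ₗ[R] S)) M ↔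
      BlockFG R b M ∧ HomGen R S M := by
  constructor
  · intro h
    refine h (fun M => BlockFG R b M ∧ HomGen R S M) ⟨fun M h => h.1, ?_, ?_, ?_⟩ ?_
    · exact fun M N f hN hf hM => ⟨hN, hM.2.of_surjective f hf⟩
    · exact fun n N hN hA => ⟨hA, HomGen.pi fun i => (hN i).2⟩
    · exact fun M A hM h₁ h₂ => ⟨hM, HomGen.extension A h₁.2 h₂.2⟩
    · rintro X hX ⟨e⟩
      exact ⟨hX, HomGen.self.of_surjective e.symm.toLinearMap e.symm.surjective⟩
  · rintro ⟨⟨hfin, hb⟩, hgen⟩ T ⟨hT1, hT2, hT3, hT4⟩ hTS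
    have hTS' : T (ModuleCat.of R S) := hTS _ hS ⟨LinearEquiv.refl R S⟩
    have hbot : T (ModuleCat.of R (⊥ : Submodule R M)) := by
      refine hT2 (ModuleCat.of R S) _ (0 : S →ₗ[R] (⊥ : Submodule R M))
        (BlockFG.submodule hb _) ?_ hTS'
      intro x
      exact ⟨0, Subsingleton.elim _ _⟩
    obtain ⟨N, hN, hmax⟩ := set_has_maximal_iff_noetherian.mpr (inferInstanceAs (IsNoetherian R M))
      {N : Submodule R M | T (ModuleCat.of R N)} ⟨⊥, hbot⟩
    have hNtop : N = ⊤ := by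
      by_contra hne
      obtain ⟨f, hf⟩ := hgen N hne
      have hrange : T (ModuleCat.of R (LinearMap.range f)) :=
        hT2 (ModuleCat.of R S) _ f.rangeRestrict
          ⟨inferInstanceAs (Module.Finite R (LinearMap.range f)),
            (hb.of_surjective N.mkQ N.mkQ_surjective).submodule _⟩
          f.surjective_rangeRestrict hTS'
      set N' := (LinearMap.range f).comap N.mkQ with hN'
      have hle : N ≤ N' := by
        intro x hx
        rw [hN', Submodule.mem_comap, Submodule.mkQ_apply, (Submodule.Quotient.mk_eq_zero N).mpr hx]
        exact zero_mem _
      have hlt : N < N' := by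
        refine lt_of_le_of_ne hle fun heq => hf ?_
        ext s
        obtain ⟨m, hm⟩ := N.mkQ_surjective (f s)
        have : m ∈ N' := by
          rw [hN', Submodule.mem_comap, hm]
          exact ⟨s, rfl⟩
        rw [← heq] at this
        rw [← hm, Submodule.mkQ_apply, (Submodule.Quotient.mk_eq_zero N).mpr this]
        rfl
      refine hmax N' ?_ hlt
      refine hT4 (ModuleCat.of R N') (N.comap N'.subtype) (BlockFG.submodule hb _) ?_ ?_
      · refine hT2 (ModuleCat.of R N) _ (Submodule.comapSubtypeEquivOfLe hle).symm.toLinearMap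
          (BlockFG.submodule (hb.submodule _) _) (LinearEquiv.surjective _) hN
      · let g : N' →ₗ[R] LinearMap.range f := (N.mkQ ∘ₗ N'.subtype).codRestrict _ fun x => x.2
        have hg : Function.Surjective g := by
          rintro ⟨y, hy⟩
          obtain ⟨m, rfl⟩ := N.mkQ_surjective y
          exact ⟨⟨m, hy⟩, rfl⟩
        have hk : LinearMap.ker g = N.comap N'.subtype := by
          ext x
          rw [LinearMap.mem_ker, ← Subtype.val_inj, Submodule.mem_comap]
          exact Submodule.Quotient.mk_eq_zero N
        let e := (Submodule.quotEquivOfEq _ _ hk.symm).trans (g.quotKerEquivOfSurjective hg)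
        refine hT2 (ModuleCat.of R (LinearMap.range f)) _ e.symm.toLinearMap
          ⟨Module.Finite.equiv e.symm, ?_⟩ e.symm.surjective hrange
        exact (hb.submodule N').of_surjective _ (Submodule.mkQ_surjective _)
    have hNT : T (ModuleCat.of R N) := hN
    exact hT2 (ModuleCat.of R N) M N.subtype ⟨hfin, hb⟩
      (by rw [hNtop]; exact fun x => ⟨⟨x, trivial⟩, rfl⟩) hNT

lemma contravariantlyFinite_torsClIn {b : R} (hS : BlockFG R b (ModuleCat.of R S)) :
    ContravariantlyFinite R (BlockFG R b)
      (TorsClIn R (BlockFG R b) (fun X => Nonempty (↥X ≃ₗ[R] S))) := by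
  rintro M ⟨hfin, hb⟩
  let t : Submodule R M := sSup {N | HomGen R S N}
  refine ⟨ModuleCat.of R t, (torsClIn_iff hS _).mpr
    ⟨BlockFG.submodule hb _, HomGen.sSup_mem _ fun N h => h⟩, t.subtype, fun Y hY g => ?_⟩
  have hY' := ((torsClIn_iff hS _).mp hY).2
  have hle : LinearMap.range g ≤ t :=
    le_sSup (hY'.of_surjective g.rangeRestrict g.surjective_rangeRestrict)
  exact ⟨g.codRestrict t fun y => hle ⟨y, rfl⟩, fun y => rfl⟩

end HomGen

section GroupAlgebraBasics

variable {k : Type} [Field k]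

instance finite_monoidAlgebra {A : Type} [Group A] [Finite A] :
    Module.Finite k (MonoidAlgebra k A) :=
  Module.Finite.equiv (MonoidAlgebra.coeffLinearEquiv k).symm

instance isNoetherianRing_monoidAlgebra {A : Type} [Group A] [Finite A] :
    IsNoetherianRing (MonoidAlgebra k A) :=
  isNoetherian_of_tower k inferInstance

instance isArtinianRing_monoidAlgebra {A : Type} [Group A] [Finite A] :
    IsArtinianRing (MonoidAlgebra k A) :=
  isArtinian_of_tower k inferInstance

variable {A B C : Type} [Group A] [Group B] [Group C]

lemma mapAlong_of (f : A →* B) (a : A) :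
    MapAlong k f (MonoidAlgebra.of k A a) = MonoidAlgebra.of k B (f a) := by
  simp [MapAlong]

lemma mapAlong_algebraMap (f : A →* B) (c : k) :
    MapAlong k f (algebraMap k _ c) = algebraMap k _ c := by
  simp [MapAlong, MonoidAlgebra.coe_algebraMap]

lemma of_mul_of_inv (x : A) :
    MonoidAlgebra.of k A x * MonoidAlgebra.of k A x⁻¹ = 1 := by
  rw [← map_mul, mul_inv_cancel, map_one]

lemma of_inv_mul_of (x : A) :
    MonoidAlgebra.of k A x⁻¹ * MonoidAlgebra.of k A x = 1 := by
  rw [← map_mul, inv_mul_cancel, map_one]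

/-- An induction principle for group algebras. -/
lemma monoidAlgebra_induction {P : MonoidAlgebra k A → Prop} (a : MonoidAlgebra k A)
    (hof : ∀ x, P (MonoidAlgebra.of k A x)) (hadd : ∀ a b, P a → P b → P (a + b))
    (hsmul : ∀ (c : k) a, P a → P (algebraMap k _ c * a)) : P a := by
  induction a using MonoidAlgebra.induction_on with
  | of x => exact hof x
  | add a b ha hb => exact hadd a b ha hb
  | smul c a ha => rw [Algebra.smul_def]; exact hsmul c a ha

lemma mapAlong_mapAlong (g : B →* C) (f : A →* B) (a : MonoidAlgebra k A) :
    MapAlong k g (MapAlong k f a) = MapAlong k (g.comp f) a := by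
  induction a using monoidAlgebra_induction with
  | hof x => rw [mapAlong_of, mapAlong_of, mapAlong_of]; rfl
  | hadd a b ha hb => simp only [map_add, ha, hb]
  | hsmul c a ha => simp only [map_mul, ha, mapAlong_algebraMap]

lemma mapAlong_injective (f : A →* B) (hf : Function.Injective f) :
    Function.Injective (MapAlong k f) := by
  intro a b h
  exact MonoidAlgebra.mapDomain_injective hf h

/-- A map compatible with scalars and group elements is compatible with the group algebra. -/
lemma equivariant_of {U W : Type} [AddCommGroup U] [AddCommGroup W] [Module (MonoidAlgebra k A) U]
    [Module (MonoidAlgebra k B) W] (f : A →* B) (φ : U →+ W)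
    (h₁ : ∀ (c : k) u, φ (algebraMap k (MonoidAlgebra k A) c • u)
      = algebraMap k (MonoidAlgebra k B) c • φ u)
    (h₂ : ∀ x u, φ (MonoidAlgebra.of k A x • u) = MonoidAlgebra.of k B (f x) • φ u)
    (a : MonoidAlgebra k A) (u : U) : φ (a • u) = MapAlong k f a • φ u := by
  induction a using monoidAlgebra_induction generalizing u with
  | hof x => rw [mapAlong_of, h₂]
  | hadd a b ha hb => simp only [map_add, add_smul, ha, hb]
  | hsmul c a ha => simp only [map_mul, mul_smul, ha, mapAlong_algebraMap, h₁]

end GroupAlgebraBasics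

section Blocks

variable {k : Type} [Field k] {Gt : Type} [Group Gt] {G : Subgroup Gt} [G.Normal]

lemma mapAlong_conjHom (x : Gt) (a : MonoidAlgebra k G) :
    MapAlong k G.subtype (MapAlong k (conjHom Gt G x) a) =
      MonoidAlgebra.of k Gt x⁻¹ * MapAlong k G.subtype a * MonoidAlgebra.of k Gt x := by
  induction a using monoidAlgebra_induction with
  | hof y => simp only [mapAlong_of, ← map_mul]; rfl
  | hadd a b ha hb => simp only [map_add, mul_add, add_mul, ha, hb]
  | hsmul c a ha =>
    simp only [map_mul, ha, mapAlong_algebraMap]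
    rw [← mul_assoc, ← mul_assoc, ← mul_assoc, Algebra.commutes c (MonoidAlgebra.of k Gt x⁻¹)]

lemma of_mul_mapAlong_conjHom (x : Gt) (a : MonoidAlgebra k G) :
    MonoidAlgebra.of k Gt x * MapAlong k G.subtype (MapAlong k (conjHom Gt G x) a) =
      MapAlong k G.subtype a * MonoidAlgebra.of k Gt x := by
  rw [mapAlong_conjHom, ← mul_assoc, ← mul_assoc, of_mul_of_inv, one_mul]

lemma conjHom_inv_conjHom (x : Gt) (a : MonoidAlgebra k G) :
    MapAlong k (conjHom Gt G x) (MapAlong k (conjHom Gt G x⁻¹) a) = a := by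
  apply mapAlong_injective G.subtype Subtype.val_injective
  rw [mapAlong_conjHom, mapAlong_conjHom, inv_inv, mul_assoc, mul_assoc, of_inv_mul_of, mul_one,
    ← mul_assoc, of_inv_mul_of, one_mul]

lemma isCentralIdem_conj {b : MonoidAlgebra k G} (hb : IsCentralIdem _ b) (x : Gt) :
    IsCentralIdem _ (MapAlong k (conjHom Gt G x) b) := by
  refine ⟨by rw [← map_mul, hb.1], fun a => ?_⟩
  rw [← conjHom_inv_conjHom x a, ← map_mul, ← map_mul, hb.2]

lemma IsBlockIdem.mul_eq_zero_or {R : Type} [Ring R] {b c : R} (hb : IsBlockIdem R b)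
    (hc : IsCentralIdem R c) : b * c = 0 ∨ b * c = b := by
  obtain ⟨h0, ⟨hbb, hbc⟩, hprim⟩ := hb
  have h1 : IsCentralIdem R (b * c) := by
    refine ⟨?_, fun a => ?_⟩
    · rw [mul_assoc, ← mul_assoc c b c, hbc c, mul_assoc b c c, hc.1, ← mul_assoc, hbb]
    · rw [← mul_assoc, hbc, mul_assoc, hc.2, ← mul_assoc]
  have h3 : b * (b * c) = b * c := by rw [← mul_assoc, hbb]
  have h4 : b * c * b = b * c := by rw [hbc, h3]
  have h2 : IsCentralIdem R (b - b * c) := by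
    refine ⟨?_, fun a => ?_⟩
    · rw [sub_mul, mul_sub, mul_sub, hbb, h3, h1.1, h4]; abel
    · rw [mul_sub, sub_mul, hbc, h1.2]
  rcases hprim (b * c) (b - b * c) h1 h2 (by rw [mul_sub, h4, h1.1, sub_self])
    (by rw [sub_mul, h3, h1.1, sub_self]) (by abel) with h | h
  · exact Or.inl h
  · exact Or.inr (sub_eq_zero.mp h).symm

lemma mul_of_mul_eq_zero {b : MonoidAlgebra k G} (hb : IsBlockIdem _ b) {x : Gt}
    (hx : x ∉ inertia k Gt G b) :
    MapAlong k G.subtype b * MonoidAlgebra.of k Gt x * MapAlong k G.subtype b = 0 := by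
  set β := MapAlong k G.subtype b with hβ
  have key : ∀ y : Gt, β * MonoidAlgebra.of k Gt y⁻¹ * β * MonoidAlgebra.of k Gt y = 0 ∨
      β * MonoidAlgebra.of k Gt y⁻¹ * β * MonoidAlgebra.of k Gt y = β := by
    intro y
    rcases hb.mul_eq_zero_or (isCentralIdem_conj hb.2.1 y) with h | h
    · left
      have := congrArg (MapAlong k G.subtype) h
      rw [map_mul, mapAlong_conjHom, map_zero] at this
      simpa only [mul_assoc] using this
    · right
      have := congrArg (MapAlong k G.subtype) h
      rw [map_mul, mapAlong_conjHom] at this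
      simpa only [mul_assoc] using this
  have hβ0 : β ≠ 0 := fun h => hb.1 (mapAlong_injective G.subtype Subtype.val_injective
    (by rw [← hβ, h, map_zero]))
  have hcomm : β * (MonoidAlgebra.of k Gt x * β * MonoidAlgebra.of k Gt x⁻¹) =
      (MonoidAlgebra.of k Gt x * β * MonoidAlgebra.of k Gt x⁻¹) * β := by
    have := congrArg (MapAlong k G.subtype) (hb.2.1.2 (MapAlong k (conjHom Gt G x⁻¹) b))
    rw [map_mul, map_mul, mapAlong_conjHom, inv_inv] at this
    exact this.symm
  have hcancel : ∀ u v : MonoidAlgebra k Gt, u * MonoidAlgebra.of k Gt x⁻¹ = v →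
      u = v * MonoidAlgebra.of k Gt x := by
    rintro u v rfl
    rw [mul_assoc, of_inv_mul_of, mul_one]
  have hkx := key x⁻¹
  rw [inv_inv] at hkx
  rcases hkx with h | h
  · rw [hcancel _ _ h, zero_mul]
  · exfalso
    rcases key x with h' | h'
    · apply hβ0
      have h2 : MonoidAlgebra.of k Gt x * β * MonoidAlgebra.of k Gt x⁻¹ * β = 0 := by
        have := congrArg (fun z => MonoidAlgebra.of k Gt x * z * MonoidAlgebra.of k Gt x⁻¹) h'
        simp only [mul_zero, zero_mul] at this
        rw [← this]
        simp only [mul_assoc, of_mul_of_inv, mul_one]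
      rw [← hcomm] at h2
      rw [← h, ← h2]
      simp only [mul_assoc]
    · apply hx
      change MonoidAlgebra.of k Gt x * β = β * MonoidAlgebra.of k Gt x
      apply hcancel
      have h4 := congrArg (fun z => MonoidAlgebra.of k Gt x * z * MonoidAlgebra.of k Gt x⁻¹) h'
      have h5 : MonoidAlgebra.of k Gt x *
          (β * MonoidAlgebra.of k Gt x⁻¹ * β * MonoidAlgebra.of k Gt x) *
            MonoidAlgebra.of k Gt x⁻¹ =
          (MonoidAlgebra.of k Gt x * β * MonoidAlgebra.of k Gt x⁻¹) * β := by
        simp only [mul_assoc, of_mul_of_inv, mul_one]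
      exact (h4.symm.trans (h5.trans hcomm.symm)).trans (by simpa only [mul_assoc] using h)

open Classical in
/-- A central idempotent of `kG̃` lying in the ideal generated by a block idempotent of `kG`. -/
lemma exists_central_sum_conj [Finite Gt] {b : MonoidAlgebra k G} (hb : IsBlockIdem _ b) :
    ∃ F : Finset (MonoidAlgebra k Gt), (∀ e ∈ F, ∃ x,
        MonoidAlgebra.of k Gt x * MapAlong k G.subtype b * MonoidAlgebra.of k Gt x⁻¹ = e) ∧
      IsCentralIdem (MonoidAlgebra k Gt) (∑ e ∈ F, e) ∧
      (∑ e ∈ F, e) * MapAlong k G.subtype b = MapAlong k G.subtype b := by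
  set β := MapAlong k G.subtype b with hβ
  have hββ : β * β = β := by rw [hβ, ← map_mul, hb.2.1.1]
  let E : Gt → MonoidAlgebra k Gt := fun x => MonoidAlgebra.of k Gt x * β * MonoidAlgebra.of k Gt x⁻¹
  have hE : ∀ x y, E x * E y = if E x = E y then E x else 0 := by
    intro x y
    have h1 : E x * E y = MonoidAlgebra.of k Gt x * (β * MonoidAlgebra.of k Gt (x⁻¹ * y) * β) *
        MonoidAlgebra.of k Gt y⁻¹ := by
      simp only [E, map_mul, mul_assoc]
    by_cases hz : x⁻¹ * y ∈ inertia k Gt G b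
    · have hz' : MonoidAlgebra.of k Gt (x⁻¹ * y) * β = β * MonoidAlgebra.of k Gt (x⁻¹ * y) := hz
      have h2 : E x = E y := by
        have : E y = MonoidAlgebra.of k Gt x * (MonoidAlgebra.of k Gt (x⁻¹ * y) * β) *
            MonoidAlgebra.of k Gt y⁻¹ := by
          rw [← mul_assoc, ← map_mul, mul_inv_cancel_left]
        rw [this, hz', map_mul]
        simp only [E, mul_assoc, of_mul_of_inv, mul_one]
      rw [if_pos h2, ← h2]
      calc E x * E x = MonoidAlgebra.of k Gt x * (β * β) * MonoidAlgebra.of k Gt x⁻¹ := by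
            simp only [E]
            rw [mul_assoc, ← mul_assoc (MonoidAlgebra.of k Gt x⁻¹),
              ← mul_assoc (MonoidAlgebra.of k Gt x⁻¹), of_inv_mul_of, one_mul]
            simp only [mul_assoc]
        _ = E x := by rw [hββ]
    · have h0 := mul_of_mul_eq_zero hb hz
      rw [← hβ] at h0
      have hxy : E x * E y = 0 := by rw [h1, h0, mul_zero, zero_mul]
      by_cases h2 : E x = E y
      · have h3 : E y = 0 := by
          by_contra hne
          have hx1 : x⁻¹ * y ∈ inertia k Gt G b := by
            change MonoidAlgebra.of k Gt (x⁻¹ * y) * β = β * MonoidAlgebra.of k Gt (x⁻¹ * y)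
            have h4 : MonoidAlgebra.of k Gt x⁻¹ * E x * MonoidAlgebra.of k Gt y =
                MonoidAlgebra.of k Gt x⁻¹ * E y * MonoidAlgebra.of k Gt y := by rw [h2]
            simp only [E] at h4
            rw [← mul_assoc, ← mul_assoc, of_inv_mul_of, one_mul] at h4
            simp only [mul_assoc, of_inv_mul_of, mul_one] at h4
            rw [map_mul, mul_assoc, h4]
          exact hz hx1
        rw [if_pos h2, hxy, h2, h3]
      · rw [if_neg h2, hxy]
  let := Fintype.ofFinite Gt
  let F : Finset (MonoidAlgebra k Gt) := Finset.univ.image E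
  have hFE : ∀ x, (∑ e ∈ F, e) * E x = E x := by
    intro x
    rw [Finset.sum_mul, Finset.sum_eq_single (E x)]
    · rw [hE, if_pos rfl]
    · intro e he hne
      obtain ⟨y, -, rfl⟩ := Finset.mem_image.mp he
      rw [hE, if_neg hne]
    · intro h
      exact absurd (Finset.mem_image_of_mem E (Finset.mem_univ x)) h
  have hE1 : E 1 = β := by simp only [E, inv_one, map_one, one_mul, mul_one]
  refine ⟨F, fun e he => ?_, ⟨?_, fun a => ?_⟩, ?_⟩
  · obtain ⟨x, -, rfl⟩ := Finset.mem_image.mp he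
    exact ⟨x, rfl⟩
  · conv_lhs => rw [Finset.mul_sum]
    refine Finset.sum_congr rfl fun e he => ?_
    obtain ⟨x, -, rfl⟩ := Finset.mem_image.mp he
    rw [hFE]
  · induction a using monoidAlgebra_induction with
    | hof y =>
      have hconj : ∀ x, MonoidAlgebra.of k Gt y * E x * MonoidAlgebra.of k Gt y⁻¹ = E (y * x) := by
        intro x
        simp only [E, map_mul, mul_inv_rev, mul_assoc]
      have h1 : MonoidAlgebra.of k Gt y * (∑ e ∈ F, e) * MonoidAlgebra.of k Gt y⁻¹ =
          ∑ e ∈ F, e := by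
        rw [Finset.mul_sum, Finset.sum_mul]
        refine Finset.sum_bij
          (fun e _ => MonoidAlgebra.of k Gt y * e * MonoidAlgebra.of k Gt y⁻¹) ?_ ?_ ?_ ?_
        · intro e he
          obtain ⟨x, -, rfl⟩ := Finset.mem_image.mp he
          rw [hconj]
          exact Finset.mem_image_of_mem E (Finset.mem_univ _)
        · intro e _ e' _ h
          have := congrArg (fun z => MonoidAlgebra.of k Gt y⁻¹ * z * MonoidAlgebra.of k Gt y) h
          rw [← mul_assoc, ← mul_assoc, ← mul_assoc, ← mul_assoc, of_inv_mul_of, one_mul,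
            one_mul] at this
          simpa only [mul_assoc, of_inv_mul_of, mul_one] using this
        · intro e he
          obtain ⟨x, -, rfl⟩ := Finset.mem_image.mp he
          exact ⟨E (y⁻¹ * x), Finset.mem_image_of_mem E (Finset.mem_univ _), by
            rw [hconj, mul_inv_cancel_left]⟩
        · intro e _
          rfl
      have := congrArg (fun z => z * MonoidAlgebra.of k Gt y) h1
      rwa [mul_assoc, of_inv_mul_of, mul_one] at this
    | hadd a a' ha ha' => rw [add_mul, mul_add, ha, ha']
    | hsmul c a ha => rw [mul_assoc, ha, ← mul_assoc, Algebra.commutes, mul_assoc]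
  · nth_rw 1 [← hE1]
    rw [hFE, hE1]

/-- A proper submodule of a module in a block covering `b` does not contain `b`-multiples of
all elements. -/
lemma exists_smul_notMem [Finite Gt] {b : MonoidAlgebra k G} (hb : IsBlockIdem _ b)
    {bt : MonoidAlgebra k Gt} (hbt : IsBlockIdem _ bt) (hcover : MapAlong k G.subtype b * bt ≠ 0)
    {X : Type} [AddCommGroup X] [Module (MonoidAlgebra k Gt) X]
    (hX : LiesIn (MonoidAlgebra k Gt) bt X) (N : Submodule (MonoidAlgebra k Gt) X) (hN : N ≠ ⊤) :
    ∃ u : X, MapAlong k G.subtype b • u ∉ N := by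
  by_contra! h
  apply hN
  obtain ⟨F, hF, hF1, hF2⟩ := exists_central_sum_conj hb
  rcases hbt.mul_eq_zero_or hF1 with h0 | h1
  · refine absurd ?_ hcover
    rw [hbt.2.1.2, ← hF2, ← mul_assoc, h0, zero_mul]
  · rw [eq_top_iff]
    intro u _
    rw [← hX u, ← h1, ← hbt.2.1.2, mul_smul, hX u, Finset.sum_smul]
    refine N.sum_mem fun e he => ?_
    obtain ⟨x, rfl⟩ := hF e he
    rw [mul_smul, mul_smul]
    exact N.smul_mem _ (h _)

end Blocks

section Eigenvectors

variable {k : Type} [Field k] {Q : Type} [Group Q]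

/-- A group acting on a nonzero space has a common eigenvector if all simple modules
are one-dimensional. -/
lemma exists_eigenvector [Finite Q] (hbasic : BasicAlg k (MonoidAlgebra k Q)) {V : Type}
    [AddCommGroup V] [Module k V] (ρ : Representation k Q V) {v : V} (hv : v ≠ 0) :
    ∃ w : V, w ≠ 0 ∧ ∃ χ : Q →* k, ∀ q, ρ q w = χ q • w := by
  let v' : ρ.asModule := ρ.asModuleEquiv.symm v
  let C := Submodule.span (MonoidAlgebra k Q) {v'}
  have hC : Module.Finite (MonoidAlgebra k Q) C :=
    Module.Finite.iff_fg.mpr (Submodule.fg_span_singleton v')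
  have : IsArtinian (MonoidAlgebra k Q) C := isArtinian_of_fg_of_artinian'
  have hat : IsAtomic (Submodule (MonoidAlgebra k Q) C) :=
    isAtomic_of_orderBot_wellFounded_lt IsWellFounded.wf
  have hCne : (⊤ : Submodule (MonoidAlgebra k Q) C) ≠ ⊥ := by
    intro h
    have h1 : (⟨v', Submodule.mem_span_singleton_self v'⟩ : C) ∈
      (⊤ : Submodule (MonoidAlgebra k Q) C) := trivial
    rw [h, Submodule.mem_bot] at h1
    exact hv (congrArg Subtype.val h1)
  obtain ⟨A, hA, -⟩ := (hat.eq_bot_or_exists_atom_le ⊤).resolve_left hCne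
  have hs : IsSimpleModule (MonoidAlgebra k Q) A := isSimpleModule_iff_isAtom.mpr hA
  obtain ⟨w, hw, hw'⟩ := hbasic ⟨A⟩ hs
  let w' : A := w
  have hex : ∀ q, ∃ c : k, MonoidAlgebra.of k Q q • w' = c • w' := fun q => hw' _
  choose χ hχ using hex
  have hwne : w' ≠ 0 := hw
  have hact : ∀ q, ρ q (ρ.asModuleEquiv w'.1.1) = χ q • ρ.asModuleEquiv w'.1.1 := by
    intro q
    have h1 := congrArg (fun z : A => ρ.asModuleEquiv z.1.1) (hχ q)
    have h2 : ρ.asModuleEquiv (MonoidAlgebra.of k Q q • w'.1.1) =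
        ρ.asModuleEquiv (χ q • w'.1.1) := h1
    rw [Representation.asModuleEquiv_map_smul, Representation.asAlgebraHom_of, map_smul] at h2
    exact h2
  set u : V := ρ.asModuleEquiv w'.1.1 with hu
  have hu0 : u ≠ 0 := fun h => hwne (Subtype.ext (Subtype.ext h))
  have hinj : ∀ c c' : k, c • u = c' • u → c = c' := fun c c' h => by
    by_contra hne
    have h1 : (c - c') • u = 0 := by rw [sub_smul, h, sub_self]
    exact (smul_ne_zero (sub_ne_zero.mpr hne) hu0) h1
  refine ⟨u, hu0, ⟨⟨χ, ?_⟩, ?_⟩, hact⟩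
  · apply hinj
    rw [← hact, map_one, one_smul, Module.End.one_apply]
  · intro q q'
    apply hinj
    dsimp only
    rw [← hact, map_mul, Module.End.mul_apply, hact, map_smul, hact, smul_smul, mul_comm]

/-- There are at most as many characters as simple modules. -/
lemma exists_injective_characters {e : ℕ} (he : RepClasses k (MonoidAlgebra k Q)
      (fun V => IsSimpleModule (MonoidAlgebra k Q) V) e) :
    ∃ f : (Q →* k) → Fin e, Function.Injective f := by
  obtain ⟨V, -, -, hV⟩ := he
  let ρ : (Q →* k) → Representation k Q k := fun χ =>
    { toFun := fun q => LinearMap.lsmul k k (χ q)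
      map_one' := by ext; simp
      map_mul' := by intro a b; ext; simp }
  have hact : ∀ χ q (m : (ρ χ).asModule), MonoidAlgebra.of k Q q • m = χ q • m := fun χ q m => by
    rw [MonoidAlgebra.of_apply, Representation.single_smul, one_smul]
    rfl
  have hsimple : ∀ χ, IsSimpleModule (MonoidAlgebra k Q) (ρ χ).asModule := by
    intro χ
    have : Nontrivial (ρ χ).asModule := inferInstanceAs (Nontrivial k)
    rw [isSimpleModule_iff_toSpanSingleton_surjective]
    refine ⟨this, fun m hm y => ?_⟩
    let m' : k := m
    let y' : k := y
    refine ⟨algebraMap k _ (y' / m'), ?_⟩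
    rw [LinearMap.toSpanSingleton_apply, algebraMap_smul]
    exact div_mul_cancel₀ y' hm
  choose f hf using fun χ => hV ⟨(ρ χ).asModule⟩ (hsimple χ)
  refine ⟨f, fun χ χ' h => ?_⟩
  obtain ⟨φ₁⟩ := hf χ
  obtain ⟨φ₂⟩ := hf χ'
  rw [← h] at φ₂
  let φ : (ρ χ).asModule ≃ₗ[MonoidAlgebra k Q] (ρ χ').asModule := φ₁.trans φ₂.symm
  ext q
  let m : (ρ χ).asModule := (1 : k)
  have hm : m ≠ 0 := one_ne_zero (α := k)
  have h1 : φ m ≠ 0 := fun h => hm (φ.map_eq_zero_iff.mp h)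
  have h2 : φ (MonoidAlgebra.of k Q q • m) = MonoidAlgebra.of k Q q • φ m := map_smul φ _ _
  rw [hact, hact, ← algebraMap_smul (MonoidAlgebra k Q) (χ q) m, map_smul, algebraMap_smul] at h2
  by_contra hne
  have h3 : (χ q - χ' q) • φ m = 0 := by rw [sub_smul, h2, sub_self]
  exact (smul_ne_zero (sub_ne_zero.mpr hne) h1) h3

end Eigenvectors

section Extensions

open MonoidAlgebra (of)

variable {k : Type} [Field k] {G I : Type} [Group G] [Group I]

lemma equivariant_smul {f : G →* I} {S X : Type} [AddCommGroup S] [Module (MonoidAlgebra k G) S]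
    [AddCommGroup X] [Module (MonoidAlgebra k I) X] {φ : S →+ X}
    (hφ : ∀ (a : MonoidAlgebra k G) u, φ (a • u) = MapAlong k f a • φ u) (c : k) (u : S) :
    φ (algebraMap k (MonoidAlgebra k G) c • u) = algebraMap k (MonoidAlgebra k I) c • φ u := by
  rw [hφ, mapAlong_algebraMap]

lemma IsBrickOver.exists_scalar_of_extends {f : G →* I} {S E : Type} [AddCommGroup S]
    [Module (MonoidAlgebra k G) S] [AddCommGroup E] [Module (MonoidAlgebra k I) E]
    (hS : IsBrickOver k (MonoidAlgebra k G) S) (hE : ExtendsAlong k f S E) (φ : E →+ E)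
    (hφ : ∀ (a : MonoidAlgebra k G) u, φ (MapAlong k f a • u) = MapAlong k f a • φ u) :
    ∃ c : k, ∀ u, φ u = algebraMap k (MonoidAlgebra k I) c • u := by
  obtain ⟨θ, hθ⟩ := hE
  have hθ' : ∀ (a : MonoidAlgebra k G) u, θ.symm (MapAlong k f a • u) = a • θ.symm u := by
    intro a u
    rw [AddEquiv.symm_apply_eq, hθ, AddEquiv.apply_symm_apply]
  obtain ⟨c, hc⟩ := hS.2
    { toFun := fun u => θ.symm (φ (θ u))
      map_add' := fun u v => by simp
      map_smul' := fun a u => by rw [hθ, hφ, hθ', RingHom.id_apply] }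
  refine ⟨c, fun u => ?_⟩
  have h1 : θ.symm (φ (θ (θ.symm u))) = algebraMap k (MonoidAlgebra k G) c • θ.symm u :=
    hc (θ.symm u)
  rw [AddEquiv.apply_symm_apply, AddEquiv.symm_apply_eq, hθ, mapAlong_algebraMap,
    AddEquiv.apply_symm_apply] at h1
  exact h1

/-- Conjugates of equivariant maps are equivariant. -/
lemma equivariant_conj {f : G →* I} {N : Subgroup I} [N.Normal] (hN : ∀ x, x ∈ N ↔ ∃ g, f g = x)
    {E X : Type} [AddCommGroup E] [Module (MonoidAlgebra k I) E]
    [AddCommGroup X] [Module (MonoidAlgebra k I) X] (φ : E →+ X)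
    (hφ : ∀ (a : MonoidAlgebra k G) u, φ (MapAlong k f a • u) = MapAlong k f a • φ u) (x : I)
    (a : MonoidAlgebra k G) (u : E) :
    of k I x • φ (of k I x⁻¹ • MapAlong k f a • u) =
      MapAlong k f a • of k I x • φ (of k I x⁻¹ • u) := by
  have hsc : ∀ (c : k) u, φ (algebraMap k (MonoidAlgebra k I) c • u) =
      algebraMap k (MonoidAlgebra k I) c • φ u := fun c u => by
    have := hφ (algebraMap k _ c) u
    rwa [mapAlong_algebraMap] at this
  induction a using monoidAlgebra_induction generalizing u with
  | hof g =>
    have h1 : x⁻¹ * f g * x ∈ N := by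
      have := ‹N.Normal›.conj_mem _ ((hN _).2 ⟨g, rfl⟩) x⁻¹
      rwa [inv_inv] at this
    obtain ⟨g', hg'⟩ := (hN _).1 h1
    have h2 : x⁻¹ * f g = f g' * x⁻¹ := by rw [hg']; group
    have h3 : x * f g' = f g * x := by rw [hg']; group
    rw [mapAlong_of, ← mul_smul, ← map_mul, h2, map_mul, mul_smul, ← mapAlong_of, hφ, mapAlong_of,
      ← mul_smul, ← map_mul, h3, map_mul, mul_smul]
  | hadd a b ha hb => simp only [map_add, add_smul, smul_add, ha, hb]
  | hsmul c a ha =>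
    simp only [map_mul, mapAlong_algebraMap, mul_smul]
    rw [← mul_smul (of k I x⁻¹), ← Algebra.commutes, mul_smul, hsc, ← mul_smul (of k I x),
      ← Algebra.commutes, mul_smul, ha]

/-- Two extensions of a brick differ by a linear character of the quotient group. -/
lemma exists_character {f : G →* I} {N : Subgroup I} [N.Normal] (hN : ∀ x, x ∈ N ↔ ∃ g, f g = x)
    {S : Type} [AddCommGroup S] [Module (MonoidAlgebra k G) S]
    (hS : IsBrickOver k (MonoidAlgebra k G) S) {E E' : BModule k (MonoidAlgebra k I)}
    (hE : ExtendsAlong k f S E) (hE' : ExtendsAlong k f S E') :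
    ∃ ψ : E ≃+ E', (∀ (a : MonoidAlgebra k G) u, ψ (MapAlong k f a • u) = MapAlong k f a • ψ u) ∧
      ∃ χ : I ⧸ N →* k, ∀ (x : I) u, of k I x • ψ u =
        algebraMap k (MonoidAlgebra k I) (χ x) • ψ (of k I x • u) := by
  have hE0 := hE
  obtain ⟨θ, hθ⟩ := hE
  obtain ⟨θ', hθ'⟩ := hE'
  let ψ : E ≃+ E' := θ.symm.trans θ'
  have hψ : ∀ (a : MonoidAlgebra k G) u, ψ (MapAlong k f a • u) = MapAlong k f a • ψ u := by
    intro a u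
    obtain ⟨v, rfl⟩ := θ.surjective u
    simp only [ψ, AddEquiv.trans_apply]
    rw [← hθ, AddEquiv.symm_apply_apply, AddEquiv.symm_apply_apply, hθ']
  have hψ' : ∀ (a : MonoidAlgebra k G) u,
      ψ.symm (MapAlong k f a • u) = MapAlong k f a • ψ.symm u := by
    intro a u
    rw [AddEquiv.symm_apply_eq, hψ, AddEquiv.apply_symm_apply]
  have hsc : ∀ (c : k) u, ψ (algebraMap k (MonoidAlgebra k I) c • u) =
      algebraMap k (MonoidAlgebra k I) c • ψ u := fun c u => by
    have := hψ (algebraMap k _ c) u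
    rwa [mapAlong_algebraMap] at this
  have hex : ∀ x : I, ∃ c : k, ∀ u, of k I x • ψ u =
      algebraMap k (MonoidAlgebra k I) c • ψ (of k I x • u) := by
    intro x
    obtain ⟨c, hc⟩ := hS.exists_scalar_of_extends hE0
      (ψ.symm.toAddMonoidHom.comp ((DistribSMul.toAddMonoidHom E' (of k I x)).comp
        (ψ.toAddMonoidHom.comp (DistribSMul.toAddMonoidHom E (of k I x⁻¹))))) (by
        intro a u
        have := equivariant_conj hN ψ.toAddMonoidHom hψ x a u
        have h2 := congrArg ψ.symm this
        rw [hψ'] at h2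
        exact h2)
    refine ⟨c, fun u => ?_⟩
    have h1 : ψ.symm (of k I x • ψ (of k I x⁻¹ • of k I x • u)) =
      algebraMap k (MonoidAlgebra k I) c • of k I x • u := hc (of k I x • u)
    rw [← mul_smul (of k I x⁻¹), of_inv_mul_of, one_smul, AddEquiv.symm_apply_eq, hsc] at h1
    exact h1
  choose c hc using hex
  obtain ⟨v, hv⟩ : ∃ v : E, v ≠ 0 := by
    have := hS.1
    obtain ⟨s, hs⟩ := exists_ne (0 : S)
    exact ⟨θ s, fun h => hs (by simpa using h)⟩
  have hinj : ∀ (c c' : k) (u : E'), u ≠ 0 → algebraMap k (MonoidAlgebra k I) c • u =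
      algebraMap k (MonoidAlgebra k I) c' • u → c = c' := by
    intro c c' u hu h
    rw [algebraMap_smul, algebraMap_smul] at h
    by_contra hne
    have h1 : (c - c') • u = 0 := by rw [sub_smul, h, sub_self]
    exact (smul_ne_zero (sub_ne_zero.mpr hne) hu) h1
  have hne : ∀ x, ψ (of k I x • v) ≠ 0 := by
    intro x h
    rw [AddEquiv.map_eq_zero_iff] at h
    apply hv
    rw [← one_smul (MonoidAlgebra k I) v, ← of_inv_mul_of x, mul_smul, h, smul_zero]
  have hN1 : ∀ x ∈ N, c x = 1 := by
    intro x hx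
    obtain ⟨g, rfl⟩ := (hN x).1 hx
    apply hinj _ _ _ (hne (f g))
    rw [← hc, map_one, one_smul, ← mapAlong_of, hψ]
  let χ : I →* k :=
    { toFun := c
      map_one' := hN1 1 N.one_mem
      map_mul' := by
        intro x y
        apply hinj _ _ _ (hne (x * y))
        rw [← hc, map_mul, mul_smul, hc y, ← mul_smul (of k I x), ← Algebra.commutes, mul_smul, hc x,
          ← mul_smul, ← map_mul, mul_comm (c y), mul_smul (of k I x)] }
  exact ⟨ψ, hψ, QuotientGroup.lift N χ fun x hx => hN1 x hx, fun x u => hc x u⟩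

/-- A nonzero homomorphism from a brick extends to one of a complete set of extensions. -/
lemma exists_extension_hom [Finite I] {f : G →* I} {N : Subgroup I} [N.Normal]
    (hN : ∀ x, x ∈ N ↔ ∃ g, f g = x)
    (hbasic : BasicAlg k (MonoidAlgebra k (I ⧸ N))) {e : ℕ}
    (he : RepClasses k (MonoidAlgebra k (I ⧸ N))
      (fun V => IsSimpleModule (MonoidAlgebra k (I ⧸ N)) V) e)
    {S : Type} [AddCommGroup S] [Module (MonoidAlgebra k G) S]
    (hS : IsBrickOver k (MonoidAlgebra k G) S) {E : Fin e → BModule k (MonoidAlgebra k I)}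
    (hE : ∀ j, ExtendsAlong k f S (E j))
    (hdist : ∀ j j', j ≠ j' → IsEmpty (E j ≃ₗ[MonoidAlgebra k I] E j'))
    (X : BModule k (MonoidAlgebra k I)) (φ : S →+ X)
    (hφ : ∀ (a : MonoidAlgebra k G) u, φ (a • u) = MapAlong k f a • φ u) (hφ0 : φ ≠ 0) :
    ∃ j, ∃ g : E j →ₗ[MonoidAlgebra k I] X, g ≠ 0 := by
  obtain ⟨F, hF⟩ := exists_injective_characters he
  let j₀ : Fin e := F 1
  choose ψ hψ χ hχ using fun j => exists_character hN hS (hE j₀) (hE j)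
  have hsc : ∀ j (c : k) u, ψ j (algebraMap k (MonoidAlgebra k I) c • u) =
      algebraMap k (MonoidAlgebra k I) c • ψ j u := fun j c u => by
    have := hψ j (algebraMap k _ c) u
    rwa [mapAlong_algebraMap] at this
  have hχinj : Function.Injective χ := by
    intro j j' h
    by_contra hne
    refine (hdist j j' hne).false
      { ((ψ j).symm.trans (ψ j')) with map_smul' := fun a u => ?_ }
    have key := equivariant_of (k := k) (MonoidHom.id I) ((ψ j).symm.trans (ψ j')).toAddMonoidHom
      ?_ ?_ a u
    · have hid : MapAlong k (MonoidHom.id I) a = a := by simp [MapAlong]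
      rw [hid] at key
      exact key
    · intro c u
      obtain ⟨v, rfl⟩ := (ψ j).surjective u
      change ψ j' ((ψ j).symm _) = _ • ψ j' ((ψ j).symm _)
      rw [← hsc, AddEquiv.symm_apply_apply, AddEquiv.symm_apply_apply, hsc]
    · intro x u
      obtain ⟨v, rfl⟩ := (ψ j).surjective u
      change ψ j' ((ψ j).symm _) = of k I x • ψ j' ((ψ j).symm _)
      rw [hχ, ← hsc, AddEquiv.symm_apply_apply, AddEquiv.symm_apply_apply, hχ, ← h, hsc]
  have hχsurj : Function.Surjective χ := by
    have h1 : Function.Surjective (F ∘ χ) := Finite.injective_iff_surjective.mp (hF.comp hχinj)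
    intro τ
    obtain ⟨j, hj⟩ := h1 (F τ)
    exact ⟨j, hF hj⟩
  let ρ := Representation.linHom (Representation.ofModule' (k := k) (G := I) (E j₀))
    (Representation.ofModule' (k := k) (G := I) X)
  have hofE : ∀ x u, Representation.ofModule' (k := k) (G := I) (E j₀) x u = of k I x • u :=
    fun x u => rfl
  have hofX : ∀ x u, Representation.ofModule' (k := k) (G := I) X x u = of k I x • u :=
    fun x u => rfl
  obtain ⟨θ, hθ⟩ := hE j₀
  let φ' : E j₀ →ₗ[k] X :=
    { toFun := fun u => φ (θ.symm u)
      map_add' := fun u v => by simp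
      map_smul' := fun c u => by
        obtain ⟨v, rfl⟩ := θ.surjective u
        rw [AddEquiv.symm_apply_apply, ← algebraMap_smul (MonoidAlgebra k I),
          ← mapAlong_algebraMap f, ← hθ, AddEquiv.symm_apply_apply, hφ, mapAlong_algebraMap,
          algebraMap_smul, RingHom.id_apply] }
  have hφ' : ∀ (a : MonoidAlgebra k G) u, φ' (MapAlong k f a • u) = MapAlong k f a • φ' u := by
    intro a u
    obtain ⟨v, rfl⟩ := θ.surjective u
    change φ (θ.symm _) = _ • φ (θ.symm _)
    rw [← hθ, AddEquiv.symm_apply_apply, AddEquiv.symm_apply_apply, hφ]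
  have hφ'mem : φ' ∈ Representation.invariants (ρ.comp N.subtype) := by
    rintro ⟨x, hx⟩
    obtain ⟨g, rfl⟩ := (hN x).1 hx
    ext u
    change of k I (f g) • φ' (of k I (f g)⁻¹ • u) = φ' u
    rw [← mapAlong_of, ← hφ', mapAlong_of, ← mul_smul, of_mul_of_inv, one_smul]
  have hφ'0 : (⟨φ', hφ'mem⟩ : Representation.invariants (ρ.comp N.subtype)) ≠ 0 := by
    intro h
    apply hφ0
    ext s
    have := LinearMap.congr_fun (congrArg Subtype.val h) (θ s)
    change φ (θ.symm (θ s)) = 0 at this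
    rwa [AddEquiv.symm_apply_apply] at this
  obtain ⟨w, hw0, τ, hw⟩ := exists_eigenvector hbasic (ρ.quotientToInvariants N) hφ'0
  obtain ⟨j, rfl⟩ := hχsurj τ
  have hw' : ∀ x u, of k I x • w.1 (of k I x⁻¹ • u) = χ j x • w.1 u := by
    intro x u
    exact LinearMap.congr_fun (congrArg Subtype.val (hw x)) u
  let g : E j →+ X := w.1.toAddMonoidHom.comp (ψ j).symm.toAddMonoidHom
  have hwsc : ∀ (c : k) u, w.1 (algebraMap k (MonoidAlgebra k I) c • u) =
      algebraMap k (MonoidAlgebra k I) c • w.1 u := by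
    intro c u
    rw [algebraMap_smul, map_smul, algebraMap_smul]
  refine ⟨j, { g with map_smul' := fun a u => ?_ }, fun h => hw0 ?_⟩
  · have key := equivariant_of (k := k) (MonoidHom.id I) g ?_ ?_ a u
    · have hid : MapAlong k (MonoidHom.id I) a = a := by simp [MapAlong]
      rw [hid] at key
      exact key
    · intro c u
      obtain ⟨v, rfl⟩ := (ψ j).surjective u
      change w.1 ((ψ j).symm _) = _ • w.1 ((ψ j).symm _)
      rw [← hsc, AddEquiv.symm_apply_apply, AddEquiv.symm_apply_apply, hwsc]
    · intro x u
      obtain ⟨v, rfl⟩ := (ψ j).surjective u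
      change w.1 ((ψ j).symm _) = of k I x • w.1 ((ψ j).symm _)
      rw [hχ, ← hsc, AddEquiv.symm_apply_apply, AddEquiv.symm_apply_apply, hwsc, algebraMap_smul,
        ← hw', ← mul_smul (of k I x⁻¹), of_inv_mul_of, one_smul]
  · ext u
    have := LinearMap.congr_fun h (ψ j u)
    change w.1 ((ψ j).symm (ψ j u)) = 0 at this
    rwa [AddEquiv.symm_apply_apply] at this

end Extensions

/-- Restriction of scalars along a ring homomorphism, as a type synonym. -/
def Res {R R' : Type} [Ring R] [Ring R'] (_ : R →+* R') (X : Type) : Type := X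

section Res

variable {R R' : Type} [Ring R] [Ring R'] (f : R →+* R') (X : Type) [AddCommGroup X] [Module R' X]

instance : AddCommGroup (Res f X) := inferInstanceAs (AddCommGroup X)

instance : Module R (Res f X) := Module.compHom X f

/-- The identity map from a module to its restriction. -/
def toRes : X ≃+ Res f X := AddEquiv.refl X

variable {X}

lemma smul_toRes (r : R) (x : X) : r • toRes f X x = toRes f X (f r • x) := rfl

lemma toRes_symm_smul (r : R) (x : Res f X) :
    (toRes f X).symm (r • x) = f r • (toRes f X).symm x := rfl

/-- A submodule viewed as a submodule of the restriction. -/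
def resSubmodule (N : Submodule R' X) : Submodule R (Res f X) where
  carrier := {u | (toRes f X).symm u ∈ N}
  add_mem' h h' := N.add_mem h h'
  zero_mem' := N.zero_mem
  smul_mem' r _ h := N.smul_mem (f r) h

/-- The map into the restriction given by an equivariant map. -/
def homRes {Y : Type} [AddCommGroup Y] [Module R Y] (g : Y →+ X)
    (hg : ∀ (r : R) y, g (r • y) = f r • g y) : Y →ₗ[R] Res f X where
  toFun y := toRes f X (g y)
  map_add' y y' := by simp
  map_smul' r y := by rw [hg, RingHom.id_apply, smul_toRes]

end Res

/-- A module over a `k`-algebra with the induced `k`-structure. -/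
def BModule.ofModule (k R : Type) [CommSemiring k] [Ring R] [Algebra k R] (X : Type)
    [AddCommGroup X] [Module R X] : BModule k R :=
  let : Module k X := Module.compHom X (algebraMap k R)
  have : IsScalarTower k R X := ⟨fun c r x => by
    rw [Algebra.smul_def, mul_smul]
    rfl⟩
  { carrier := X }

section Restriction

open MonoidAlgebra (of)

variable {k : Type} [Field k] {Gt : Type} [Group Gt] {G : Subgroup Gt}

/-- The restriction of a `kG̃`-module to the block of `b`. -/
noncomputable abbrev ResBlock {b : MonoidAlgebra k G} (hb : IsCentralIdem (MonoidAlgebra k G) b)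
    (X : Type) [AddCommGroup X] [Module (MonoidAlgebra k Gt) X] :
    Submodule (MonoidAlgebra k G) (Res (MapAlong k G.subtype) X) :=
  blockComp (MonoidAlgebra k G) b hb.2 (Res (MapAlong k G.subtype) X)

variable {b : MonoidAlgebra k G} (hb : IsCentralIdem (MonoidAlgebra k G) b)
  {X : Type} [AddCommGroup X] [Module (MonoidAlgebra k Gt) X]

lemma smul_mem_resBlock (u : X) :
    toRes (MapAlong k G.subtype) X (MapAlong k G.subtype b • u) ∈ ResBlock hb X := by
  change b • _ = _
  rw [smul_toRes, ← mul_smul, ← map_mul, hb.1]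

/-- The projection to the restriction to the block of `b`. -/
noncomputable def projResBlock : Res (MapAlong k G.subtype) X →ₗ[MonoidAlgebra k G] ResBlock hb X where
  toFun u := ⟨_, smul_mem_resBlock hb ((toRes (MapAlong k G.subtype) X).symm u)⟩
  map_add' u v := Subtype.ext (by simp)
  map_smul' a u := Subtype.ext (by
    change MapAlong k G.subtype b • MapAlong k G.subtype a • (toRes (MapAlong k G.subtype) X).symm u
      = MapAlong k G.subtype a • MapAlong k G.subtype b • (toRes (MapAlong k G.subtype) X).symm u
    rw [← mul_smul, ← mul_smul, ← map_mul, ← map_mul, hb.2])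

lemma projResBlock_coe (u : ResBlock hb X) : projResBlock hb u.1 = u := Subtype.ext u.2

end Restriction

section Induction

variable {k : Type} [Field k] {A B : Type} [Group A] [Group B] {f : A →* B}
  {U : Type} [AddCommGroup U] [Module (MonoidAlgebra k A) U]
  {W : Type} [AddCommGroup W] [Module (MonoidAlgebra k B) W] {η : U →+ W}

lemma IsInducedUnit.hom_ext (h : IsInducedUnit k f U W η) {X : Type} [AddCommGroup X]
    [Module (MonoidAlgebra k B) X] {F F' : W →ₗ[MonoidAlgebra k B] X}
    (hF : ∀ u, F (η u) = F' (η u)) : F = F' := by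
  obtain ⟨F₀, -, h₀⟩ := h.2 (BModule.ofModule k (MonoidAlgebra k B) X) (F.toAddMonoidHom.comp η)
    (fun a u => by
      change F (η (a • u)) = MapAlong k f a • F (η u)
      rw [h.1, map_smul])
  exact (h₀ F fun u => rfl).trans (h₀ F' fun u => (hF u).symm).symm

lemma IsInducedUnit.exists_hom (h : IsInducedUnit k f U W η) {X : Type} [AddCommGroup X]
    [Module (MonoidAlgebra k B) X] (g : U →+ X)
    (hg : ∀ (a : MonoidAlgebra k A) (u : U), g (a • u) = MapAlong k f a • g u) :
    ∃ F : W →ₗ[MonoidAlgebra k B] X, ∀ u : U, F (η u) = g u :=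
  (h.2 (BModule.ofModule k (MonoidAlgebra k B) X) g hg).exists

end Induction

section RestrictionTorsion

open MonoidAlgebra (of)

variable {k : Type} [Field k] {Gt : Type} [Group Gt] [Finite Gt] {G : Subgroup Gt} [G.Normal]
  {b : MonoidAlgebra k G} (hb : IsBlockIdem (MonoidAlgebra k G) b)
  {bt : MonoidAlgebra k Gt} (hbt : IsBlockIdem (MonoidAlgebra k Gt) bt)
  (hcover : MapAlong k G.subtype b * bt ≠ 0)
  {hGI : G ≤ inertia k Gt G b}
  {n e : ℕ} {S : Fin n → BModule k (MonoidAlgebra k G)}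
  {St : Fin n → Fin e → BModule k (MonoidAlgebra k (inertia k Gt G b))}
  (hSt : ∀ i j, ExtendsAlong k (Subgroup.inclusion hGI) (S i) (St i j))
  {W : Type} [AddCommGroup W] [Module (MonoidAlgebra k Gt) W]
  {η : ((i : Fin n) → (j : Fin e) → St i j) →+ W}
  (hη : IsInducedUnit k (inertia k Gt G b).subtype
    ((i : Fin n) → (j : Fin e) → St i j) W η)
  {X : Type} [AddCommGroup X] [Module (MonoidAlgebra k Gt) X]
  (hX : LiesIn (MonoidAlgebra k Gt) bt X)

include hb hbt hcover hSt hη hX in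
/-- Generation of the restricted block component implies generation by the induced module. -/
lemma homGen_of_resBlock
    (hbasic : BasicAlg k
      (MonoidAlgebra k (inertia k Gt G b ⧸ G.subgroupOf (inertia k Gt G b))))
    (he : RepClasses k
        (MonoidAlgebra k (inertia k Gt G b ⧸ G.subgroupOf (inertia k Gt G b)))
        (fun V => IsSimpleModule
          (MonoidAlgebra k (inertia k Gt G b ⧸ G.subgroupOf (inertia k Gt G b))) V) e)
    (hbricks : ∀ i, IsBrickOver k (MonoidAlgebra k G) (S i))
    (hStdist : ∀ i j j', j ≠ j' →
        IsEmpty (St i j ≃ₗ[MonoidAlgebra k (inertia k Gt G b)] St i j'))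
    (h : HomGen (MonoidAlgebra k G) ((i : Fin n) → S i) (ResBlock hb.2.1 X)) :
    HomGen (MonoidAlgebra k Gt) (blockComp (MonoidAlgebra k Gt) bt hbt.2.1.2 W) X := by
  intro N hN
  let N' : Submodule (MonoidAlgebra k G) (ResBlock hb.2.1 X) :=
    (resSubmodule (MapAlong k G.subtype) N).comap (ResBlock hb.2.1 X).subtype
  have hN' : N' ≠ ⊤ := by
    obtain ⟨u, hu⟩ := exists_smul_notMem hb hbt hcover hX N hN
    intro h
    have h1 : (⟨_, smul_mem_resBlock hb.2.1 u⟩ : ResBlock hb.2.1 X) ∈ N' := by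
      rw [h]; trivial
    exact hu h1
  obtain ⟨φ, hφ⟩ := h N' hN'
  obtain ⟨i, hi⟩ : ∃ i, φ ∘ₗ LinearMap.single _ _ i ≠ 0 := by
    by_contra! h0
    exact hφ (LinearMap.pi_ext' fun i => by rw [h0 i, LinearMap.zero_comp])
  let incl : (ResBlock hb.2.1 X ⧸ N') →ₗ[MonoidAlgebra k G]
      Res (MapAlong k G.subtype) (X ⧸ N) :=
    N'.liftQ (homRes (MapAlong k G.subtype)
      (N.mkQ.toAddMonoidHom.comp ((toRes (MapAlong k G.subtype) X).symm.toAddMonoidHom.comp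
        (ResBlock hb.2.1 X).subtype.toAddMonoidHom)) (fun a y => by
          change N.mkQ (MapAlong k G.subtype a • (toRes (MapAlong k G.subtype) X).symm y.1) = _
          rw [map_smul]
          rfl)) (by
      intro y hy
      change N.mkQ ((toRes (MapAlong k G.subtype) X).symm y.1) = 0
      rw [Submodule.mkQ_apply, Submodule.Quotient.mk_eq_zero]
      exact hy)
  have hincl : ∀ q, incl q = 0 → q = 0 := by
    intro q hq
    obtain ⟨y, rfl⟩ := N'.mkQ_surjective q
    change N.mkQ ((toRes (MapAlong k G.subtype) X).symm y.1) = 0 at hq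
    rw [Submodule.mkQ_apply, Submodule.Quotient.mk_eq_zero] at hq
    rw [Submodule.mkQ_apply, Submodule.Quotient.mk_eq_zero]
    exact hq
  let Z := BModule.ofModule k (MonoidAlgebra k (inertia k Gt G b))
    (Res (MapAlong k (inertia k Gt G b).subtype) (X ⧸ N))
  let φ' : S i →+ Z := (toRes (MapAlong k (inertia k Gt G b).subtype) (X ⧸ N)).toAddMonoidHom.comp
    ((toRes (MapAlong k G.subtype) (X ⧸ N)).symm.toAddMonoidHom.comp
      (incl ∘ₗ φ ∘ₗ LinearMap.single _ _ i).toAddMonoidHom)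
  obtain ⟨j, g, hg⟩ := exists_extension_hom (f := Subgroup.inclusion hGI)
    (N := G.subgroupOf (inertia k Gt G b))
    (fun x => ⟨fun hx => ⟨⟨x, hx⟩, rfl⟩, fun ⟨g, hg⟩ => by rw [← hg]; exact g.2⟩)
    hbasic he (hbricks i) (hSt i) (hStdist i) Z φ' (by
      intro a u
      change incl (φ (Pi.single i (a • u))) = MapAlong k (inertia k Gt G b).subtype
        (MapAlong k (Subgroup.inclusion hGI) a) • (_ : X ⧸ N)
      rw [mapAlong_mapAlong, Pi.single_smul, map_smul, map_smul]
      rfl) (by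
      intro h0
      apply hi
      ext u
      exact hincl _ (DFunLike.congr_fun h0 u))
  obtain ⟨F, hF⟩ := hη.exists_hom (X := X ⧸ N)
    ((toRes (MapAlong k (inertia k Gt G b).subtype) (X ⧸ N)).symm.toAddMonoidHom.comp
      (g ∘ₗ LinearMap.proj j ∘ₗ LinearMap.proj i).toAddMonoidHom) (by
      intro a u
      change g (a • u i j) = _
      rw [map_smul]
      rfl)
  refine ⟨F ∘ₗ (blockComp (MonoidAlgebra k Gt) bt hbt.2.1.2 W).subtype, fun h0 => hg ?_⟩
  ext u
  let u' : (i : Fin n) → (j : Fin e) → St i j := Pi.single i (Pi.single j u)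
  have h1 : F (η u') = g u := by
    rw [hF]
    change g (u' i j) = g u
    simp [u']
  have h2 : F (bt • η u') = 0 := LinearMap.congr_fun h0
    (⟨bt • η u', by change bt • bt • _ = _; rw [← mul_smul, hbt.2.1.1]⟩ :
      blockComp (MonoidAlgebra k Gt) bt hbt.2.1.2 W)
  rw [map_smul, LiesIn.of_surjective hX N.mkQ N.mkQ_surjective, h1] at h2
  exact h2

omit [Finite Gt] [G.Normal] in
include hη in
/-- A nonzero map out of the block component of an induced module is nonzero on a summand. -/
lemma exists_ne_zero_of_blockComp_hom {Y : Type} [AddCommGroup Y] [Module (MonoidAlgebra k Gt) Y]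
    {f : blockComp (MonoidAlgebra k Gt) bt hbt.2.1.2 W →ₗ[MonoidAlgebra k Gt] Y} (hf : f ≠ 0) :
    ∃ F : W →ₗ[MonoidAlgebra k Gt] Y, ∃ i j, ∃ s : St i j,
      F (η (Pi.single i (Pi.single j s))) ≠ 0 := by
  have hmem : ∀ w : W, bt • w ∈ blockComp (MonoidAlgebra k Gt) bt hbt.2.1.2 W := fun w => by
    change bt • bt • _ = _
    rw [← mul_smul, hbt.2.1.1]
  let P : W →ₗ[MonoidAlgebra k Gt] blockComp (MonoidAlgebra k Gt) bt hbt.2.1.2 W :=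
    { toFun := fun w => ⟨bt • w, hmem w⟩
      map_add' := fun w w' => Subtype.ext (smul_add _ _ _)
      map_smul' := fun a w => Subtype.ext (by
        change bt • a • w = a • bt • w
        rw [← mul_smul, ← mul_smul, hbt.2.1.2]) }
  refine ⟨f ∘ₗ P, ?_⟩
  by_contra! h0
  have h1 : ((f ∘ₗ P).toAddMonoidHom.comp η) = 0 := by
    refine AddMonoidHom.functions_ext _ _ _ fun i s => ?_
    have : s = ∑ j, Pi.single j (s j) := (Finset.univ_sum_single s).symm
    rw [this]
    have h2 := map_sum ((f ∘ₗ P).toAddMonoidHom.comp (η.comp (AddMonoidHom.single _ i)))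
      (fun j => Pi.single j (s j)) Finset.univ
    refine h2.trans (Finset.sum_eq_zero fun j _ => h0 i j (s j))
  have h2 : f ∘ₗ P = 0 := hη.hom_ext fun u => DFunLike.congr_fun h1 u
  apply hf
  ext w
  have h3 := LinearMap.congr_fun h2 w.1
  change f ⟨bt • w.1, hmem w.1⟩ = 0 at h3
  have h4 : (⟨bt • w.1, hmem w.1⟩ : blockComp (MonoidAlgebra k Gt) bt hbt.2.1.2 W) = w :=
    Subtype.ext w.2
  rw [h4] at h3
  exact h3

omit [Finite Gt] in
include hb hbt hSt hη in
/-- Generation by the induced module implies generation of the restricted block component. -/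
lemma resBlock_homGen (hblock : ∀ i, LiesIn (MonoidAlgebra k G) b (S i))
    (h : HomGen (MonoidAlgebra k Gt) (blockComp (MonoidAlgebra k Gt) bt hbt.2.1.2 W) X) :
    HomGen (MonoidAlgebra k G) ((i : Fin n) → S i) (ResBlock hb.2.1 X) := by
  intro N' hN'
  let pr : X →+ ResBlock hb.2.1 X :=
    (projResBlock hb.2.1).toAddMonoidHom.comp (toRes (MapAlong k G.subtype) X).toAddMonoidHom
  have hpr : ∀ (a : MonoidAlgebra k G) u, pr (MapAlong k G.subtype a • u) = a • pr u :=
    fun a u => map_smul (projResBlock hb.2.1) a (toRes _ X u)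
  let N : Submodule (MonoidAlgebra k Gt) X :=
    { carrier := {u | ∀ a : MonoidAlgebra k Gt, pr (a • u) ∈ N'}
      add_mem' := fun hu hv a => by rw [smul_add, map_add]; exact N'.add_mem (hu a) (hv a)
      zero_mem' := fun a => by rw [smul_zero, map_zero]; exact N'.zero_mem
      smul_mem' := fun c u hu a => by rw [← mul_smul]; exact hu _ }
  have hN : N ≠ ⊤ := by
    intro hN
    apply hN'
    rw [eq_top_iff]
    intro y _
    have h1 : (toRes _ X).symm y.1 ∈ N := by rw [hN]; trivial
    have h2 := h1 1
    rw [one_smul] at h2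
    have h3 : pr ((toRes _ X).symm y.1) = y := projResBlock_coe hb.2.1 y
    rwa [h3] at h2
  obtain ⟨f, hf⟩ := h N hN
  obtain ⟨F, i, j, s, hs⟩ := exists_ne_zero_of_blockComp_hom hbt hη hf
  obtain ⟨θ, hθ⟩ := hSt i j
  let D : X ⧸ N → ResBlock hb.2.1 X ⧸ N' := fun q => N'.mkQ (pr (Function.surjInv N.mkQ_surjective q))
  have hD : ∀ v, D (N.mkQ v) = N'.mkQ (pr v) := by
    intro v
    have h1 : Function.surjInv N.mkQ_surjective (N.mkQ v) - v ∈ N := by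
      rw [← Submodule.Quotient.mk_eq_zero, ← Submodule.mkQ_apply, map_sub,
        Function.surjInv_eq N.mkQ_surjective, sub_self]
    have h2 := h1 1
    rw [one_smul, map_sub] at h2
    rw [← sub_eq_zero, ← map_sub, Submodule.mkQ_apply, Submodule.Quotient.mk_eq_zero]
    exact h2
  have hDadd : ∀ q q', D (q + q') = D q + D q' := by
    intro q q'
    obtain ⟨v, rfl⟩ := N.mkQ_surjective q
    obtain ⟨v', rfl⟩ := N.mkQ_surjective q'
    rw [← map_add, hD, hD, hD, map_add, map_add]
  have hDsmul : ∀ (a : MonoidAlgebra k G) q, D (MapAlong k G.subtype a • q) = a • D q := by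
    intro a q
    obtain ⟨v, rfl⟩ := N.mkQ_surjective q
    rw [← map_smul, hD, hD, hpr, map_smul]
  let single : St i j →+ ((i : Fin n) → (j : Fin e) → St i j) :=
    (AddMonoidHom.single _ i).comp (AddMonoidHom.single (fun j => (St i j).carrier) j)
  have hsingle : ∀ (a : MonoidAlgebra k (inertia k Gt G b)) (s : St i j),
      single (a • s) = a • single s := by
    intro a s
    change Pi.single (M := fun i => (j : Fin e) → St i j) i
      (Pi.single (M := fun j => (St i j).carrier) j (a • s)) =
      a • Pi.single (M := fun i => (j : Fin e) → St i j) i (Pi.single j s)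
    rw [Pi.single_smul, Pi.single_smul]
  have hFs : ∀ (a : MonoidAlgebra k (inertia k Gt G b)) t, F (η (single (a • t))) =
      MapAlong k (inertia k Gt G b).subtype a • F (η (single t)) := by
    intro a t
    rw [hsingle, hη.1, map_smul]
  have hFs' : ∀ (a : MonoidAlgebra k G) t, F (η (single (θ (a • t)))) =
      MapAlong k G.subtype a • F (η (single (θ t))) := by
    intro a t
    rw [hθ, hFs, mapAlong_mapAlong]
    rfl
  let ψ : S i →ₗ[MonoidAlgebra k G] ResBlock hb.2.1 X ⧸ N' :=
    { toFun := fun t => D (F (η (single (θ t))))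
      map_add' := fun t t' => by rw [map_add, map_add, map_add, map_add, hDadd]
      map_smul' := fun a t => by rw [hFs', hDsmul, RingHom.id_apply] }
  obtain ⟨t, rfl⟩ := θ.surjective s
  obtain ⟨v, hv⟩ := N.mkQ_surjective (F (η (single (θ t))))
  have hvβ : N.mkQ (MapAlong k G.subtype b • v) = F (η (single (θ t))) := by
    rw [map_smul, hv, ← hFs', hblock]
  have hvN : MapAlong k G.subtype b • v ∉ N := by
    intro hmem
    apply hs
    rw [← Submodule.Quotient.mk_eq_zero, ← Submodule.mkQ_apply, hvβ] at hmem
    exact hmem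
  obtain ⟨x, hx⟩ : ∃ x : Gt, pr (of k Gt x • MapAlong k G.subtype b • v) ∉ N' := by
    by_contra! h0
    apply hvN
    intro a
    induction a using monoidAlgebra_induction with
    | hof x => exact h0 x
    | hadd a a' ha ha' => rw [add_smul, map_add]; exact N'.add_mem ha ha'
    | hsmul c a ha =>
      rw [mul_smul, ← mapAlong_algebraMap G.subtype, hpr]
      exact N'.smul_mem _ ha
  have hxI : x ∈ inertia k Gt G b := by
    by_contra hxI
    apply hx
    have h0 : pr (of k Gt x • MapAlong k G.subtype b • v) = 0 := by
      apply Subtype.ext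
      change MapAlong k G.subtype b • of k Gt x • MapAlong k G.subtype b • v = 0
      rw [← mul_smul, ← mul_smul, mul_of_mul_eq_zero hb hxI, zero_smul]
    rw [h0]
    exact N'.zero_mem
  have hψ : ψ ≠ 0 := by
    intro h0
    obtain ⟨t', ht'⟩ := θ.surjective (of k (inertia k Gt G b) ⟨x, hxI⟩ • θ t)
    have h1 : D (F (η (single (θ t')))) = 0 := LinearMap.congr_fun h0 t'
    rw [ht', hFs, mapAlong_of, ← hvβ, ← map_smul, hD, Submodule.mkQ_apply,
      Submodule.Quotient.mk_eq_zero] at h1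
    exact hx h1
  refine ⟨ψ ∘ₗ LinearMap.proj i, fun h0 => hψ ?_⟩
  ext t
  have h1 := LinearMap.congr_fun h0 (Pi.single i t)
  simpa using h1

end RestrictionTorsion

section Amalgam

variable {R R' : Type} [Ring R] [Ring R'] (φ : R →+* R') {bt : R'}
  (hbt : IsCentralIdem R' bt)
  {X : Type} [AddCommGroup X] [Module R' X]
  (Y : Submodule R (Res φ X)) {M : Type} [AddCommGroup M] [Module R M] (f : Y →ₗ[R] M)

/-- The relations defining the amalgam. -/
def amalgamRel : Set (X × (M →₀ R')) :=
  {z | (∃ m m' : M, z = (0, Finsupp.single (m + m') 1 - Finsupp.single m 1 - Finsupp.single m' 1)) ∨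
    (∃ (a : R) (m : M), z = (0, Finsupp.single (a • m) 1 - φ a • Finsupp.single m 1)) ∨
    (∃ m : M, z = (0, bt • Finsupp.single m 1 - Finsupp.single m 1)) ∨
    ∃ y : Y, z = ((toRes φ X).symm y.1, - Finsupp.single (f y) 1)}

include hbt in
/-- The pushout of a module and a module induced to a block, along a map from a submodule of the
restriction. -/
lemma exists_amalgam [Module.Finite R' X] [Module.Finite R M] (hX : LiesIn R' bt X) :
    ∃ (A : ModuleCat.{0} R') (γ : X →ₗ[R'] A) (μ : M →ₗ[R] Res φ A),
      BlockFG R' bt A ∧ (∀ y : Y, toRes φ A (γ ((toRes φ X).symm y.1)) = μ (f y)) ∧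
      (∀ N : Submodule R' A, (∀ x, γ x ∈ N) → (∀ m, (toRes φ A).symm (μ m) ∈ N) → N = ⊤) ∧
      ∀ (X' : Type) [AddCommGroup X'] [Module R' X'], LiesIn R' bt X' →
        ∀ (g : X →ₗ[R'] X') (h : M →ₗ[R] Res φ X'),
          (∀ y : Y, toRes φ X' (g ((toRes φ X).symm y.1)) = h (f y)) →
          ∃ F : A →ₗ[R'] X', ∀ x, F (γ x) = g x := by
  let P : Submodule R' (X × (M →₀ R')) := Submodule.span R' (amalgamRel φ (bt := bt) Y f)
  have hP : ∀ z ∈ amalgamRel φ (bt := bt) Y f, z ∈ P := fun z hz => Submodule.subset_span hz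
  let q : (X × (M →₀ R')) →ₗ[R'] (X × (M →₀ R')) ⧸ P := P.mkQ
  have hq : ∀ z w, z - w ∈ P → q z = q w := fun z w h => by
    rw [← sub_eq_zero, ← map_sub]
    exact (Submodule.Quotient.mk_eq_zero P).2 h
  let γ : X →ₗ[R'] (X × (M →₀ R')) ⧸ P := q ∘ₗ LinearMap.inl _ _ _
  let μ : M →ₗ[R] Res φ ((X × (M →₀ R')) ⧸ P) :=
    { toFun := fun m => toRes φ _ (q (0, Finsupp.single m 1))
      map_add' := fun m m' => by
        rw [← map_add, ← map_add]
        refine congrArg _ (hq _ _ (hP _ (Or.inl ⟨m, m', ?_⟩)))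
        ext <;> simp [sub_sub]
      map_smul' := fun a m => by
        rw [RingHom.id_apply, smul_toRes, ← map_smul]
        refine congrArg _ (hq _ _ (hP _ (Or.inr (Or.inl ⟨a, m, ?_⟩))))
        ext <;> simp }
  have hgen : ∀ N : Submodule R' ((X × (M →₀ R')) ⧸ P), (∀ x, γ x ∈ N) →
      (∀ m, (toRes φ _).symm (μ m) ∈ N) → N = ⊤ := by
    intro N h1 h2
    rw [eq_top_iff]
    intro z _
    obtain ⟨⟨x, c⟩, rfl⟩ := P.mkQ_surjective z
    have h3 : (x, c) = LinearMap.inl R' _ _ x + LinearMap.inr R' X (M →₀ R') c := by simp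
    rw [h3, map_add]
    refine N.add_mem (h1 x) ?_
    clear h3
    induction c using Finsupp.induction_linear with
    | zero => rw [map_zero, map_zero]; exact N.zero_mem
    | add c c' hc hc' =>
      rw [map_add, map_add]
      exact N.add_mem (hc trivial) (hc' trivial)
    | single m a =>
      have h4 : Finsupp.single m a = a • Finsupp.single m (1 : R') := by simp
      rw [h4, map_smul, map_smul]
      exact N.smul_mem _ (h2 m)
  refine ⟨ModuleCat.of R' ((X × (M →₀ R')) ⧸ P), γ, μ, ⟨?_, ?_⟩, ?_, hgen, ?_⟩
  · obtain ⟨n, s, hs⟩ := Module.Finite.exists_fin (R := R) (M := M)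
    let T : Submodule R' ((X × (M →₀ R')) ⧸ P) := LinearMap.range γ ⊔
      Submodule.span R' (Set.range fun i => (toRes φ _).symm (μ (s i)))
    have hT : T = ⊤ := by
      refine hgen T (fun x => Submodule.mem_sup_left ⟨x, rfl⟩) ?_
      have h1 : (⊤ : Submodule R M) ≤ (resSubmodule φ T).comap μ := by
        rw [← hs, Submodule.span_le]
        rintro _ ⟨i, rfl⟩
        exact Submodule.mem_sup_right (Submodule.subset_span ⟨i, rfl⟩)
      exact fun m => h1 (Submodule.mem_top (x := m))
    refine ⟨?_⟩
    rw [← hT]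
    refine Submodule.FG.sup ?_ (Submodule.fg_span (Set.finite_range _))
    rw [LinearMap.range_eq_map]
    exact Submodule.FG.map _ Module.Finite.fg_top
  · have h1 : blockComp R' bt hbt.2 ((X × (M →₀ R')) ⧸ P) = ⊤ := by
      refine hgen _ (fun x => ?_) fun m => ?_
      · change bt • γ x = γ x
        rw [← map_smul, hX]
      · refine hq _ _ (hP _ (Or.inr (Or.inr (Or.inl ⟨m, ?_⟩))))
        ext <;> simp
    intro u
    have h2 : u ∈ blockComp R' bt hbt.2 ((X × (M →₀ R')) ⧸ P) := by rw [h1]; trivial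
    exact h2
  · intro y
    refine congrArg _ (hq _ _ (hP _ (Or.inr (Or.inr (Or.inr ⟨y, ?_⟩)))))
    ext <;> simp
  · intro X' _ _ hX' g h hgh
    let F : (X × (M →₀ R')) →ₗ[R'] X' :=
      LinearMap.coprod g (Finsupp.lsum ℕ fun m => LinearMap.toSpanSingleton R' X'
        ((toRes φ X').symm (h m)))
    have hF : ∀ (x : X) (c : R') (m : M), F (x, c • Finsupp.single m 1) = g x + c • (toRes φ X').symm (h m) := by
      intro x c m
      simp [F]
    have hF1 : ∀ x m, F (x, Finsupp.single m 1) = g x + (toRes φ X').symm (h m) := by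
      intro x m
      have := hF x 1 m
      rwa [one_smul, one_smul] at this
    have hF0 : ∀ m, F (0, Finsupp.single m 1) = (toRes φ X').symm (h m) := by
      intro m
      rw [hF1, map_zero, zero_add]
    have hFP : P ≤ LinearMap.ker F := by
      refine Submodule.span_le.2 ?_
      rintro z (⟨m, m', rfl⟩ | ⟨a, m, rfl⟩ | ⟨m, rfl⟩ | ⟨y, rfl⟩)
      · have h1 : ((0, Finsupp.single (m + m') 1 - Finsupp.single m 1 - Finsupp.single m' 1) :
          X × (M →₀ R')) = (0, Finsupp.single (m + m') 1) - (0, Finsupp.single m 1) -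
            (0, Finsupp.single m' 1) := by simp
        change F _ = 0
        rw [h1, map_sub, map_sub, hF0, hF0, hF0, map_add, map_add]
        abel
      · have h1 : ((0, Finsupp.single (a • m) 1 - φ a • Finsupp.single m 1) :
          X × (M →₀ R')) = (0, Finsupp.single (a • m) 1) - (0, φ a • Finsupp.single m 1) := by simp
        change F _ = 0
        rw [h1, map_sub, hF0, hF, map_zero, zero_add, map_smul, toRes_symm_smul, sub_self]
      · have h1 : ((0, bt • Finsupp.single m 1 - Finsupp.single m 1) :
          X × (M →₀ R')) = (0, bt • Finsupp.single m 1) - (0, Finsupp.single m 1) := by simp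
        change F _ = 0
        rw [h1, map_sub, hF0, hF, map_zero, zero_add, hX', sub_self]
      · have h1 : (((toRes φ X).symm y.1, - Finsupp.single (f y) 1) : X × (M →₀ R')) =
          ((toRes φ X).symm y.1, 0) - (0, Finsupp.single (f y) 1) := by simp
        change F _ = 0
        rw [h1, map_sub, hF0, ← hgh, AddEquiv.symm_apply_apply]
        simp [F]
    refine ⟨P.liftQ F hFP, fun x => ?_⟩
    change F (x, 0) = g x
    simp [F]

end Amalgam

/-- A nonzero map into a quotient can be transported along a semilinear map of the targets,
provided that the source carries a matching semilinear surjection. -/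
lemma exists_ne_zero_of_twist {R : Type} [Ring R] {σ : R →+* R} {M V T : Type} [AddCommGroup M]
    [Module R M] [AddCommGroup V] [Module R V] [AddCommGroup T] [Module R T] (p : M →+ V)
    (hp : ∀ a m, p (σ a • m) = a • p m) {N : Submodule R V} {K : Submodule R M}
    (hK : ∀ m, m ∈ K ↔ p m ∈ N) {g : T →ₗ[R] M ⧸ K} (hg : g ≠ 0) (tw : T →+ T)
    (htw : ∀ a t, tw (a • t) = σ a • tw t) (hsurj : Function.Surjective tw) :
    ∃ ψ : T →ₗ[R] V ⧸ N, ψ ≠ 0 := by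
  let D : M ⧸ K →+ V ⧸ N := QuotientAddGroup.lift K.toAddSubgroup
    (N.mkQ.toAddMonoidHom.comp p) fun m hm => by
      change N.mkQ (p m) = 0
      rw [Submodule.mkQ_apply, Submodule.Quotient.mk_eq_zero]
      exact (hK m).1 hm
  have hD : ∀ m, D (K.mkQ m) = N.mkQ (p m) := fun m => rfl
  refine ⟨{ toFun := fun t => D (g (tw t))
            map_add' := fun t t' => by rw [map_add, map_add, map_add]
            map_smul' := fun a t => ?_ }, fun h0 => hg ?_⟩
  · obtain ⟨m, hm⟩ := K.mkQ_surjective (g (tw t))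
    rw [RingHom.id_apply, htw, map_smul, ← hm, ← map_smul, hD, hD, hp, map_smul]
  · ext t
    obtain ⟨t, rfl⟩ := hsurj t
    have h1 : D (g (tw t)) = 0 := LinearMap.congr_fun h0 t
    obtain ⟨m, hm⟩ := K.mkQ_surjective (g (tw t))
    rw [← hm, hD, Submodule.mkQ_apply, Submodule.Quotient.mk_eq_zero, ← hK] at h1
    rw [← hm, LinearMap.zero_apply, Submodule.mkQ_apply, Submodule.Quotient.mk_eq_zero]
    exact h1

section Covariant

open MonoidAlgebra (of)

variable {k : Type} [Field k] {Gt : Type} [Group Gt] {G : Subgroup Gt} [G.Normal]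
  {b : MonoidAlgebra k G} (hb : IsBlockIdem (MonoidAlgebra k G) b)
  {hGI : G ≤ inertia k Gt G b} {n : ℕ} {S : Fin n → BModule k (MonoidAlgebra k G)}

include hb in
/-- A module generated by a torsion module in the block of `b` has torsion restricted block
component. -/
lemma resBlock_homGen_of_generated {A : Type} [AddCommGroup A] [Module (MonoidAlgebra k Gt) A]
    {M : Type} [AddCommGroup M] [Module (MonoidAlgebra k G) M]
    (hM : LiesIn (MonoidAlgebra k G) b M)
    (hS : HomGen (MonoidAlgebra k G) ((i : Fin n) → S i) M)
    {E : Fin n → BModule k (MonoidAlgebra k (inertia k Gt G b))}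
    (hE : ∀ i, ExtendsAlong k (Subgroup.inclusion hGI) (S i) (E i))
    (μ : M →ₗ[MonoidAlgebra k G] Res (MapAlong k G.subtype) A)
    (hμ : ∀ N : Submodule (MonoidAlgebra k Gt) A, (∀ m, (toRes _ A).symm (μ m) ∈ N) → N = ⊤) :
    HomGen (MonoidAlgebra k G) ((i : Fin n) → S i) (ResBlock hb.2.1 A) := by
  intro N' hN'
  let pr : A →+ ResBlock hb.2.1 A :=
    (projResBlock hb.2.1).toAddMonoidHom.comp (toRes (MapAlong k G.subtype) A).toAddMonoidHom
  have hpr : ∀ (a : MonoidAlgebra k G) u, pr (MapAlong k G.subtype a • u) = a • pr u :=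
    fun a u => map_smul (projResBlock hb.2.1) a (toRes _ A u)
  let N : Submodule (MonoidAlgebra k Gt) A :=
    { carrier := {u | ∀ a : MonoidAlgebra k Gt, pr (a • u) ∈ N'}
      add_mem' := fun hu hv a => by rw [smul_add, map_add]; exact N'.add_mem (hu a) (hv a)
      zero_mem' := fun a => by rw [smul_zero, map_zero]; exact N'.zero_mem
      smul_mem' := fun c u hu a => by rw [← mul_smul]; exact hu _ }
  have hN : N ≠ ⊤ := by
    intro hN
    apply hN'
    rw [eq_top_iff]
    intro y _
    have h1 : (toRes _ A).symm y.1 ∈ N := by rw [hN]; trivial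
    have h2 := h1 1
    rw [one_smul] at h2
    have h3 : pr ((toRes _ A).symm y.1) = y := projResBlock_coe hb.2.1 y
    rwa [h3] at h2
  let ν : M →+ A := (toRes _ A).symm.toAddMonoidHom.comp μ.toAddMonoidHom
  have hν : ∀ (a : MonoidAlgebra k G) m, ν (a • m) = MapAlong k G.subtype a • ν m := by
    intro a m
    change (toRes _ A).symm (μ (a • m)) = _
    rw [map_smul]
    rfl
  obtain ⟨m₀, hm₀⟩ : ∃ m, ν m ∉ N := by
    by_contra! h0
    exact hN (hμ N h0)
  obtain ⟨x, hx⟩ : ∃ x : Gt, pr (of k Gt x • ν m₀) ∉ N' := by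
    by_contra! h0
    apply hm₀
    intro a
    induction a using monoidAlgebra_induction with
    | hof x => exact h0 x
    | hadd a a' ha ha' => rw [add_smul, map_add]; exact N'.add_mem ha ha'
    | hsmul c a ha =>
      rw [mul_smul, ← mapAlong_algebraMap G.subtype, hpr]
      exact N'.smul_mem _ ha
  have hxI : x ∈ inertia k Gt G b := by
    by_contra hxI
    apply hx
    have h0 : pr (of k Gt x • ν m₀) = 0 := by
      rw [← hM m₀, hν]
      apply Subtype.ext
      change MapAlong k G.subtype b • of k Gt x • MapAlong k G.subtype b • ν m₀ = 0
      rw [← mul_smul, ← mul_smul, mul_of_mul_eq_zero hb hxI, zero_smul]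
    rw [h0]
    exact N'.zero_mem
  have htw : ∀ (a : MonoidAlgebra k G) m, pr (of k Gt x • ν (MapAlong k (conjHom Gt G x) a • m)) =
      a • pr (of k Gt x • ν m) := by
    intro a m
    rw [hν, ← mul_smul, of_mul_mapAlong_conjHom, mul_smul, hpr]
  let K : Submodule (MonoidAlgebra k G) M :=
    { carrier := {m | pr (of k Gt x • ν m) ∈ N'}
      add_mem' := fun {m m'} hm hm' => by
        change pr (of k Gt x • ν (m + m')) ∈ N'
        rw [map_add, smul_add, map_add]
        exact N'.add_mem hm hm'
      zero_mem' := by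
        change pr (of k Gt x • ν 0) ∈ N'
        rw [map_zero, smul_zero, map_zero]
        exact N'.zero_mem
      smul_mem' := fun a m hm => by
        obtain ⟨a', rfl⟩ : ∃ a', MapAlong k (conjHom Gt G x) a' = a :=
          ⟨_, conjHom_inv_conjHom x a⟩
        change pr (of k Gt x • ν (_ • m)) ∈ N'
        rw [htw]
        exact N'.smul_mem _ hm }
  obtain ⟨f, hf⟩ := hS K (fun h => hx (h ▸ Submodule.mem_top : m₀ ∈ K))
  obtain ⟨i, g, hg⟩ : ∃ i, ∃ g : S i →ₗ[MonoidAlgebra k G] M ⧸ K, g ≠ 0 := by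
    by_contra! h0
    exact hf (LinearMap.pi_ext' fun i => (h0 i _).trans (LinearMap.zero_comp _).symm)
  clear hf
  obtain ⟨θ, hθ⟩ := hE i
  let tw : S i →+ S i := θ.symm.toAddMonoidHom.comp
    ((DistribSMul.toAddMonoidHom (E i) (of k (inertia k Gt G b) ⟨x, hxI⟩⁻¹)).comp
      θ.toAddMonoidHom)
  have htwdef : ∀ s, tw s = θ.symm (of k (inertia k Gt G b) ⟨x, hxI⟩⁻¹ • θ s) := fun s => rfl
  have htw' : ∀ (a : MonoidAlgebra k G) s, tw (a • s) = MapAlong k (conjHom Gt G x) a • tw s := by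
    intro a s
    apply θ.injective
    rw [hθ, htwdef, htwdef, AddEquiv.apply_symm_apply, AddEquiv.apply_symm_apply, hθ, ← mul_smul,
      ← mul_smul]
    congr 1
    apply mapAlong_injective (inertia k Gt G b).subtype Subtype.val_injective
    rw [map_mul, map_mul, mapAlong_mapAlong, mapAlong_mapAlong, mapAlong_of]
    change of k Gt x⁻¹ * MapAlong k G.subtype a =
      MapAlong k G.subtype (MapAlong k (conjHom Gt G x) a) * of k Gt x⁻¹
    rw [mapAlong_conjHom, mul_assoc, of_mul_of_inv, mul_one]
  have hsurj : Function.Surjective tw := fun s =>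
    ⟨θ.symm (of k (inertia k Gt G b) ⟨x, hxI⟩ • θ s), by
      rw [htwdef, AddEquiv.apply_symm_apply, ← mul_smul, ← map_mul, inv_mul_cancel, map_one,
        one_smul, AddEquiv.symm_apply_apply]⟩
  obtain ⟨ψ, hψ⟩ := exists_ne_zero_of_twist
    (pr.comp ((DistribSMul.toAddMonoidHom A (of k Gt x)).comp ν)) htw
    (fun m => Iff.rfl : ∀ m, m ∈ K ↔ _) hg tw htw' hsurj
  refine ⟨ψ ∘ₗ LinearMap.proj i, fun h0 => hψ ?_⟩
  ext t
  have h1 := LinearMap.congr_fun h0 (Pi.single i t)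
  simpa using h1

variable [Finite Gt]
  {bt : MonoidAlgebra k Gt} (hbt : IsBlockIdem (MonoidAlgebra k Gt) bt)
  (hcover : MapAlong k G.subtype b * bt ≠ 0) {e : ℕ}
  {St : Fin n → Fin e → BModule k (MonoidAlgebra k (inertia k Gt G b))}
  (hSt : ∀ i j, ExtendsAlong k (Subgroup.inclusion hGI) (S i) (St i j))
  {W : Type} [AddCommGroup W] [Module (MonoidAlgebra k Gt) W]
  {η : ((i : Fin n) → (j : Fin e) → St i j) →+ W}
  (hη : IsInducedUnit k (inertia k Gt G b).subtype
    ((i : Fin n) → (j : Fin e) → St i j) W η)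

omit [G.Normal] in
/-- The restriction of a finitely generated module to a finite index subgroup algebra is finitely
generated. -/
lemma finite_res (X : Type) [AddCommGroup X] [Module (MonoidAlgebra k Gt) X]
    [Module.Finite (MonoidAlgebra k Gt) X] :
    Module.Finite (MonoidAlgebra k G) (Res (MapAlong k G.subtype) X) := by
  let : Module k X := Module.compHom X (algebraMap k (MonoidAlgebra k Gt))
  have : IsScalarTower k (MonoidAlgebra k Gt) X := ⟨fun c r x => by
    rw [Algebra.smul_def, mul_smul]
    rfl⟩
  have hk : Module.Finite k X := Module.Finite.trans (MonoidAlgebra k Gt) X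
  obtain ⟨s, hs⟩ := hk
  let s' : Set (Res (MapAlong k G.subtype) X) := (toRes (MapAlong k G.subtype) X) '' (s : Set X)
  have hs' : s'.Finite := s.finite_toSet.image _
  refine ⟨Submodule.fg_def.2 ⟨s', hs', ?_⟩⟩
  rw [eq_top_iff]
  have h2 : ∀ u : X, u ∈ Submodule.span k (s : Set X) →
      toRes (MapAlong k G.subtype) X u ∈ Submodule.span (MonoidAlgebra k G) s' := by
    intro u hu
    induction hu using Submodule.span_induction with
    | mem x hx => exact Submodule.subset_span ⟨x, hx, rfl⟩
    | zero => exact Submodule.zero_mem _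
    | add x y _ _ hx hy => exact Submodule.add_mem _ hx hy
    | smul c x _ hx =>
      have h3 : toRes (MapAlong k G.subtype) X (c • x) =
          algebraMap k (MonoidAlgebra k G) c • toRes (MapAlong k G.subtype) X x := by
        rw [smul_toRes, mapAlong_algebraMap]
        rfl
      rw [h3]
      exact Submodule.smul_mem _ _ hx
  intro u _
  exact h2 u (by rw [hs]; trivial)

include hb hcover hSt hη in
/-- Covariant finiteness passes from the torsion class of a semibrick to that of the block
component of the induced module. -/
lemma covariantlyFinite_blockComp
    (hbasic : BasicAlg k
      (MonoidAlgebra k (inertia k Gt G b ⧸ G.subgroupOf (inertia k Gt G b))))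
    (he : RepClasses k
        (MonoidAlgebra k (inertia k Gt G b ⧸ G.subgroupOf (inertia k Gt G b)))
        (fun V => IsSimpleModule
          (MonoidAlgebra k (inertia k Gt G b ⧸ G.subgroupOf (inertia k Gt G b))) V) e)
    (hfg : ∀ i, Module.Finite (MonoidAlgebra k G) (S i))
    (hblock : ∀ i, LiesIn (MonoidAlgebra k G) b (S i))
    (hbricks : ∀ i, IsBrickOver k (MonoidAlgebra k G) (S i))
    (hStdist : ∀ i j j', j ≠ j' →
        IsEmpty (St i j ≃ₗ[MonoidAlgebra k (inertia k Gt G b)] St i j'))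
    (hWfg : Module.Finite (MonoidAlgebra k Gt) (blockComp (MonoidAlgebra k Gt) bt hbt.2.1.2 W))
    (hcov : CovariantlyFinite (MonoidAlgebra k G) (BlockFG (MonoidAlgebra k G) b)
      (TorsClIn (MonoidAlgebra k G) (BlockFG (MonoidAlgebra k G) b)
        fun X => Nonempty (X ≃ₗ[MonoidAlgebra k G] ((i : Fin n) → S i)))) :
    CovariantlyFinite (MonoidAlgebra k Gt) (BlockFG (MonoidAlgebra k Gt) bt)
      (TorsClIn (MonoidAlgebra k Gt) (BlockFG (MonoidAlgebra k Gt) bt)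
        fun X => Nonempty (X ≃ₗ[MonoidAlgebra k Gt]
          blockComp (MonoidAlgebra k Gt) bt hbt.2.1.2 W)) := by
  have hSb : BlockFG (MonoidAlgebra k G) b
      (ModuleCat.of (MonoidAlgebra k G) ((i : Fin n) → S i)) :=
    ⟨Module.Finite.pi, fun u => funext fun i => hblock i (u i)⟩
  have hWb : BlockFG (MonoidAlgebra k Gt) bt (ModuleCat.of (MonoidAlgebra k Gt)
      (blockComp (MonoidAlgebra k Gt) bt hbt.2.1.2 W)) := ⟨hWfg, fun u => Subtype.ext u.2⟩
  have hRes : ∀ X : ModuleCat.{0} (MonoidAlgebra k Gt), BlockFG (MonoidAlgebra k Gt) bt X →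
      BlockFG (MonoidAlgebra k G) b (ModuleCat.of _ (ResBlock hb.2.1 X)) := by
    intro X hX
    have := hX.1
    have := finite_res (k := k) (G := G) X
    exact ⟨inferInstanceAs (Module.Finite (MonoidAlgebra k G) (ResBlock hb.2.1 X)),
      fun u => Subtype.ext u.2⟩
  intro X hX
  obtain ⟨M, hM, f, hf⟩ := hcov (ModuleCat.of _ (ResBlock hb.2.1 X)) (hRes X hX)
  rw [torsClIn_iff hSb] at hM
  have := hX.1
  have := hM.1.1
  obtain ⟨A, γ, μ, hA, hγμ, hgen, huniv⟩ := exists_amalgam (MapAlong k G.subtype) hbt.2.1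
    (ResBlock hb.2.1 X) f hX.2
  have hμ : ∀ N : Submodule (MonoidAlgebra k Gt) A,
      (∀ m, (toRes _ A).symm (μ m) ∈ N) → N = ⊤ := by
    intro N hN
    refine hgen N ?_ hN
    by_contra h0
    have h1 : N.comap γ ≠ ⊤ := fun h1 => h0 fun x => by
      have : x ∈ N.comap γ := by rw [h1]; trivial
      exact this
    obtain ⟨u, hu⟩ := exists_smul_notMem hb hbt hcover hX.2 _ h1
    apply hu
    have h2 := hN (f ⟨_, smul_mem_resBlock hb.2.1 u⟩)
    rw [← hγμ] at h2
    exact h2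
  obtain ⟨χ, -⟩ := exists_injective_characters he
  refine ⟨A, (torsClIn_iff hWb A).2 ⟨hA, homGen_of_resBlock hb hbt hcover hSt hη hA.2 hbasic he
    hbricks hStdist (resBlock_homGen_of_generated hb hM.1.2 hM.2 (fun i => hSt i (χ 1)) μ hμ)⟩,
    γ, ?_⟩
  intro X' hX' g
  rw [torsClIn_iff hWb] at hX'
  have h1 := resBlock_homGen hb hbt hSt hη hblock hX'.2
  let g' : ResBlock hb.2.1 X →ₗ[MonoidAlgebra k G] ResBlock hb.2.1 X' :=
    { toFun := fun y => ⟨toRes _ X' (g ((toRes _ X).symm y.1)), by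
        change b • toRes _ X' _ = toRes _ X' _
        rw [smul_toRes, ← map_smul, ← toRes_symm_smul, y.2]⟩
      map_add' := fun y y' => Subtype.ext (map_add g _ _)
      map_smul' := fun a y => Subtype.ext (map_smul g _ _) }
  obtain ⟨h, hh⟩ := hf (ModuleCat.of _ (ResBlock hb.2.1 X'))
    ((torsClIn_iff hSb _).2 ⟨hRes X' hX'.1, h1⟩) g'
  exact huniv X' hX'.1.2 g ((ResBlock hb.2.1 X').subtype ∘ₗ h)
    (fun y => congrArg Subtype.val (hh y).symm)

end Covariant

section InducedModules

open MonoidAlgebra (of)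

variable {k : Type} [Field k] {Gt : Type} [Group Gt] {H : Subgroup Gt}
  {U : Type} [AddCommGroup U] [Module (MonoidAlgebra k H) U]
  {W : Type} [AddCommGroup W] [Module (MonoidAlgebra k Gt) W] {η : U →+ W}

lemma IsInducedUnit.injective (h : IsInducedUnit k H.subtype U W η) : Function.Injective η := by
  classical
  let : Module k U := Module.compHom U (algebraMap k (MonoidAlgebra k H))
  have hk : ∀ (c : k) (u : U), c • u = algebraMap k (MonoidAlgebra k H) c • u := fun c u => rfl
  have : IsScalarTower k (MonoidAlgebra k H) U := ⟨fun c r x => by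
    rw [Algebra.smul_def, mul_smul, hk]⟩
  let ρ : Representation k Gt (Gt → U) :=
    { toFun := fun x => LinearMap.funLeft k U (· * x)
      map_one' := by ext; simp [LinearMap.funLeft_apply]
      map_mul' := fun x y => by ext; simp [LinearMap.funLeft_apply, mul_assoc] }
  let g₀ : U → Gt → U := fun u x => if hx : x ∈ H then of k H ⟨x, hx⟩ • u else 0
  let g : U →+ ρ.asModule :=
    { toFun := fun u => ρ.asModuleEquiv.symm (g₀ u)
      map_zero' := by
        rw [← map_zero ρ.asModuleEquiv.symm]
        congr 1
        ext x
        simp [g₀]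
      map_add' := fun u v => by
        rw [← map_add ρ.asModuleEquiv.symm]
        congr 1
        ext x
        by_cases hx : x ∈ H <;> simp [g₀, hx] }
  have hg : ∀ (a : MonoidAlgebra k H) (u : U), g (a • u) = MapAlong k H.subtype a • g u := by
    refine equivariant_of _ _ ?_ ?_
    · intro c u
      change ρ.asModuleEquiv.symm _ = _ • ρ.asModuleEquiv.symm _
      rw [← Representation.asModuleEquiv_symm_map_smul]
      congr 1
      ext x
      by_cases hx : x ∈ H
      · simp only [g₀, hx, dite_true, Pi.smul_apply]
        rw [hk, ← mul_smul, ← mul_smul, Algebra.commutes]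
      · simp [g₀, hx]
    · intro y u
      change ρ.asModuleEquiv.symm _ = _ • ρ.asModuleEquiv.symm _
      rw [← Representation.asModuleEquiv_symm_map_rho]
      congr 1
      ext x
      change g₀ (of k H y • u) x = g₀ u (x * y)
      by_cases hx : x ∈ H
      · have hxy : x * y ∈ H := H.mul_mem hx y.2
        simp only [g₀, hx, hxy, dite_true]
        rw [← mul_smul, ← map_mul]
        rfl
      · have hxy : x * y ∉ H := fun h => hx ((H.mul_mem_cancel_right y.2).1 h)
        simp only [g₀, hx, hxy, dite_false]
  obtain ⟨F, hF⟩ := h.exists_hom g hg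
  intro u v huv
  have h1 : ρ.asModuleEquiv (g u) 1 = ρ.asModuleEquiv (g v) 1 := by rw [← hF, ← hF, huv]
  have h2 : ∀ u, ρ.asModuleEquiv (g u) 1 = u := by
    intro u
    change ρ.asModuleEquiv (ρ.asModuleEquiv.symm (g₀ u)) 1 = u
    rw [LinearEquiv.apply_symm_apply]
    have h3 : (⟨1, H.one_mem⟩ : H) = 1 := rfl
    simp only [g₀, H.one_mem, dite_true]
    rw [h3, map_one, one_smul]
  rwa [h2, h2] at h1

lemma IsInducedUnit.span_range {A B : Type} [Group A] [Group B] {f : A →* B}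
    {U : Type} [AddCommGroup U] [Module (MonoidAlgebra k A) U]
    {W : Type} [AddCommGroup W] [Module (MonoidAlgebra k B) W] {η : U →+ W}
    (h : IsInducedUnit k f U W η) : Submodule.span (MonoidAlgebra k B) (Set.range η) = ⊤ := by
  rw [← Submodule.ker_mkQ (Submodule.span _ _), LinearMap.ker_eq_top]
  refine h.hom_ext fun u => ?_
  rw [LinearMap.zero_apply, Submodule.mkQ_apply, Submodule.Quotient.mk_eq_zero]
  exact Submodule.subset_span ⟨u, rfl⟩

lemma IsInducedUnit.finite {A B : Type} [Group A] [Group B] {f : A →* B}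
    {U : Type} [AddCommGroup U] [Module (MonoidAlgebra k A) U]
    {W : Type} [AddCommGroup W] [Module (MonoidAlgebra k B) W] {η : U →+ W}
    (h : IsInducedUnit k f U W η) [Module.Finite (MonoidAlgebra k A) U] :
    Module.Finite (MonoidAlgebra k B) W := by
  obtain ⟨n, s, hs⟩ := Module.Finite.exists_fin (R := MonoidAlgebra k A) (M := U)
  refine ⟨Submodule.fg_def.2 ⟨_, Set.finite_range (η ∘ s), ?_⟩⟩
  rw [eq_top_iff, ← h.span_range, Submodule.span_le]
  rintro _ ⟨u, rfl⟩
  have hu : u ∈ Submodule.span (MonoidAlgebra k A) (Set.range s) := by rw [hs]; trivial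
  induction hu using Submodule.span_induction with
  | mem x hx =>
    obtain ⟨i, rfl⟩ := hx
    exact Submodule.subset_span ⟨i, rfl⟩
  | zero => rw [map_zero]; exact Submodule.zero_mem _
  | add x y _ _ hx hy => rw [map_add]; exact Submodule.add_mem _ hx hy
  | smul c x _ hx => rw [h.1]; exact Submodule.smul_mem _ _ hx

variable {G : Subgroup Gt} [G.Normal] {b : MonoidAlgebra k G}
  (hb : IsBlockIdem (MonoidAlgebra k G) b) {hGI : G ≤ inertia k Gt G b}

omit [G.Normal] in
lemma mapAlong_inclusion (hGI : G ≤ inertia k Gt G b) (a : MonoidAlgebra k G) :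
    MapAlong k (inertia k Gt G b).subtype (MapAlong k (Subgroup.inclusion hGI) a) =
      MapAlong k G.subtype a := mapAlong_mapAlong _ _ _

include hb in
lemma IsInducedUnit.exists_eq_of_smul {U : Type} [AddCommGroup U]
    [Module (MonoidAlgebra k (inertia k Gt G b)) U] {η : U →+ W}
    (h : IsInducedUnit k (inertia k Gt G b).subtype U W η)
    (hU : ∀ u : U, MapAlong k (Subgroup.inclusion hGI) b • u = u) {w : W}
    (hw : MapAlong k G.subtype b • w = w) : ∃ u, η u = w := by
  have hβ : ∀ u, MapAlong k G.subtype b • η u = η u := fun u => by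
    rw [← mapAlong_inclusion hGI, ← h.1, hU]
  have h1 : ∀ (a : MonoidAlgebra k Gt) (u : U), ∃ u', η u' = MapAlong k G.subtype b • a • η u := by
    intro a u
    induction a using monoidAlgebra_induction with
    | hof x =>
      by_cases hx : x ∈ inertia k Gt G b
      · refine ⟨MapAlong k (Subgroup.inclusion hGI) b • of k (inertia k Gt G b) ⟨x, hx⟩ • u, ?_⟩
        rw [h.1, h.1, mapAlong_inclusion, mapAlong_of]
        rfl
      · refine ⟨0, ?_⟩
        rw [← hβ u, ← mul_smul, ← mul_smul, mul_of_mul_eq_zero hb hx, zero_smul, map_zero]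
    | hadd a a' ha ha' =>
      obtain ⟨v, hv⟩ := ha
      obtain ⟨v', hv'⟩ := ha'
      exact ⟨v + v', by rw [map_add, hv, hv', add_smul, smul_add]⟩
    | hsmul c a ha =>
      obtain ⟨v, hv⟩ := ha
      refine ⟨algebraMap k (MonoidAlgebra k (inertia k Gt G b)) c • v, ?_⟩
      rw [h.1, mapAlong_algebraMap, hv, ← mul_smul, ← mul_smul, ← mul_smul, ← mul_assoc,
        Algebra.commutes]
  have h2 : ∀ w ∈ Submodule.span (MonoidAlgebra k Gt) (Set.range η),
      ∀ a : MonoidAlgebra k Gt, ∃ u', η u' = MapAlong k G.subtype b • a • w := by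
    intro w hw
    induction hw using Submodule.span_induction with
    | mem x hx =>
      obtain ⟨u, rfl⟩ := hx
      exact fun a => h1 a u
    | zero => exact fun a => ⟨0, by rw [smul_zero, smul_zero, map_zero]⟩
    | add x y _ _ hx hy =>
      intro a
      obtain ⟨v, hv⟩ := hx a
      obtain ⟨v', hv'⟩ := hy a
      exact ⟨v + v', by rw [map_add, hv, hv', smul_add, smul_add]⟩
    | smul c x _ hx =>
      intro a
      rw [← mul_smul a c x]
      exact hx _
  obtain ⟨u, hu⟩ := h2 w (by rw [h.span_range]; trivial) 1
  exact ⟨u, by rw [hu, one_smul, hw]⟩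

/-- Maps between induced modules in the block come from maps between the inducing modules. -/
lemma IsInducedUnit.exists_descend {U U' W' : Type} [AddCommGroup U]
    [Module (MonoidAlgebra k (inertia k Gt G b)) U] [AddCommGroup U']
    [Module (MonoidAlgebra k (inertia k Gt G b)) U'] [AddCommGroup W']
    [Module (MonoidAlgebra k Gt) W'] {η : U →+ W} {η' : U' →+ W'}
    (hb : IsBlockIdem (MonoidAlgebra k G) b)
    (h : IsInducedUnit k (inertia k Gt G b).subtype U W η)
    (h' : IsInducedUnit k (inertia k Gt G b).subtype U' W' η')
    (hU : ∀ u : U, MapAlong k (Subgroup.inclusion hGI) b • u = u)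
    (hU' : ∀ u : U', MapAlong k (Subgroup.inclusion hGI) b • u = u)
    (f : W →ₗ[MonoidAlgebra k Gt] W') :
    ∃ f' : U →ₗ[MonoidAlgebra k (inertia k Gt G b)] U', ∀ u, f (η u) = η' (f' u) := by
  have h1 : ∀ u, ∃ u', η' u' = f (η u) := fun u =>
    h'.exists_eq_of_smul hb hU' (by rw [← map_smul, ← mapAlong_inclusion hGI, ← h.1, hU])
  choose f' hf' using h1
  refine ⟨{ toFun := f'
            map_add' := fun u v => h'.injective ?_
            map_smul' := fun a u => h'.injective ?_ }, fun u => (hf' u).symm⟩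
  · rw [map_add, hf', hf', hf', map_add, map_add]
  · rw [RingHom.id_apply, h'.1, hf', hf', h.1, map_smul]

/-- A map between induced modules is bijective if the underlying map is. -/
lemma IsInducedUnit.nonempty_equiv {A B : Type} [Group A] [Group B] {f : A →* B}
    {U U' W' : Type} [AddCommGroup U] [Module (MonoidAlgebra k A) U]
    {W : Type} [AddCommGroup W] [Module (MonoidAlgebra k B) W] [AddCommGroup U']
    [Module (MonoidAlgebra k A) U'] [AddCommGroup W']
    [Module (MonoidAlgebra k B) W'] {η : U →+ W} {η' : U' →+ W'}
    (h : IsInducedUnit k f U W η) (h' : IsInducedUnit k f U' W' η')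
    (g : U ≃ₗ[MonoidAlgebra k A] U') : Nonempty (W ≃ₗ[MonoidAlgebra k B] W') := by
  obtain ⟨F, hF⟩ := h.exists_hom (η'.comp g.toLinearMap.toAddMonoidHom) fun a u => by
    change η' (g (a • u)) = _ • η' (g u)
    rw [map_smul, h'.1]
  obtain ⟨F', hF'⟩ := h'.exists_hom (η.comp g.symm.toLinearMap.toAddMonoidHom) fun a u => by
    change η (g.symm (a • u)) = _ • η (g.symm u)
    rw [map_smul, h.1]
  have hF₁ : ∀ u, F (η u) = η' (g u) := hF
  have hF₂ : ∀ u, F' (η' u) = η (g.symm u) := hF'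
  refine ⟨LinearEquiv.ofLinearMap F F' (h'.hom_ext fun u => ?_) (h.hom_ext fun u => ?_)⟩
  · rw [LinearMap.comp_apply, hF₂, hF₁, LinearEquiv.apply_symm_apply, LinearMap.id_apply]
  · rw [LinearMap.comp_apply, hF₁, hF₂, LinearEquiv.symm_apply_apply, LinearMap.id_apply]

omit [G.Normal] in
lemma mul_mapAlong_inertia (a : MonoidAlgebra k (inertia k Gt G b)) :
    MapAlong k (inertia k Gt G b).subtype a * MapAlong k G.subtype b =
      MapAlong k G.subtype b * MapAlong k (inertia k Gt G b).subtype a := by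
  induction a using monoidAlgebra_induction with
  | hof x => rw [mapAlong_of]; exact x.2
  | hadd a a' ha ha' => rw [map_add, add_mul, mul_add, ha, ha']
  | hsmul c a ha =>
    rw [map_mul, mapAlong_algebraMap, mul_assoc, ha, ← mul_assoc, ← mul_assoc, Algebra.commutes]

/-- The Brauer correspondent of a covering block in the inertia group. -/
lemma exists_inertia_idem (hb : IsBlockIdem (MonoidAlgebra k G) b) {bt : MonoidAlgebra k Gt}
    (hbt : IsBlockIdem (MonoidAlgebra k Gt) bt)
    (hcover : MapAlong k G.subtype b * bt ≠ 0) (hGI : G ≤ inertia k Gt G b) :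
    ∃ c : MonoidAlgebra k (inertia k Gt G b),
      MapAlong k (inertia k Gt G b).subtype c = MapAlong k G.subtype b * bt ∧ c ≠ 0 ∧ c * c = c ∧
      (∀ a, a * c = c * a) ∧ c * MapAlong k (Subgroup.inclusion hGI) b = c := by
  set β := MapAlong k G.subtype b with hβdef
  have hβ : β * β = β := by rw [hβdef, ← map_mul, hb.2.1.1]
  have h1 : ∀ a : MonoidAlgebra k Gt, ∃ c : MonoidAlgebra k (inertia k Gt G b),
      MapAlong k (inertia k Gt G b).subtype c = β * a * β := by
    intro a
    induction a using monoidAlgebra_induction with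
    | hof x =>
      by_cases hx : x ∈ inertia k Gt G b
      · refine ⟨MapAlong k (Subgroup.inclusion hGI) b * of k (inertia k Gt G b) ⟨x, hx⟩ *
          MapAlong k (Subgroup.inclusion hGI) b, ?_⟩
        rw [map_mul, map_mul, mapAlong_inclusion, mapAlong_of]
        rfl
      · exact ⟨0, by rw [mul_of_mul_eq_zero hb hx, map_zero]⟩
    | hadd a a' ha ha' =>
      obtain ⟨v, hv⟩ := ha
      obtain ⟨v', hv'⟩ := ha'
      exact ⟨v + v', by rw [map_add, hv, hv', mul_add, add_mul]⟩
    | hsmul c a ha =>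
      obtain ⟨v, hv⟩ := ha
      refine ⟨algebraMap k (MonoidAlgebra k (inertia k Gt G b)) c * v, ?_⟩
      rw [map_mul, mapAlong_algebraMap, hv, ← mul_assoc, ← mul_assoc, ← mul_assoc,
        Algebra.commutes]
  obtain ⟨c, hc⟩ := h1 bt
  have hc' : MapAlong k (inertia k Gt G b).subtype c = β * bt := by
    rw [hc, mul_assoc, ← hbt.2.1.2, ← mul_assoc, hβ]
  have hinj := mapAlong_injective (k := k) (inertia k Gt G b).subtype Subtype.val_injective
  have hcomm := hbt.2.1.2
  refine ⟨c, hc', ?_, hinj ?_, fun a => hinj ?_, hinj ?_⟩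
  · rintro rfl
    exact hcover (by rw [← hc', map_zero])
  · rw [map_mul, hc', mul_assoc, ← mul_assoc bt, ← hcomm β, mul_assoc, hbt.2.1.1, ← mul_assoc, hβ]
  · rw [map_mul, map_mul, hc', ← mul_assoc, mul_mapAlong_inertia, mul_assoc, mul_assoc, hcomm]
  · rw [map_mul, mapAlong_inclusion, hc', mul_assoc, ← hcomm, ← mul_assoc, hβ]

end InducedModules

section Grading

open MonoidAlgebra (of)

variable (k : Type) [Field k] {I : Type} [Group I] (N : Subgroup I) [N.Normal]

/-- The span of the group elements in a given coset. -/
noncomputable def grade (q : I ⧸ N) : Submodule k (MonoidAlgebra k I) :=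
  Submodule.span k (of k I '' {x | (x : I ⧸ N) = q})

open Classical in
/-- The projection to the span of the group elements in a given coset. -/
noncomputable def gradeProj (q : I ⧸ N) : MonoidAlgebra k I →ₗ[k] MonoidAlgebra k I :=
  Finsupp.linearCombination k (fun x : I => if (x : I ⧸ N) = q then of k I x else 0) ∘ₗ
    (MonoidAlgebra.coeffLinearEquiv k).toLinearMap

variable {k N}

omit [N.Normal] in
open Classical in
lemma gradeProj_of (q : I ⧸ N) (x : I) :
    gradeProj k N q (of k I x) = if (x : I ⧸ N) = q then of k I x else 0 := by
  simp [gradeProj]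

omit [N.Normal] in
lemma gradeProj_mem (q : I ⧸ N) (a : MonoidAlgebra k I) : gradeProj k N q a ∈ grade k N q := by
  classical
  induction a using monoidAlgebra_induction with
  | hof x =>
    rw [gradeProj_of]
    split_ifs with h
    · exact Submodule.subset_span ⟨x, h, rfl⟩
    · exact Submodule.zero_mem _
  | hadd a b ha hb => rw [map_add]; exact Submodule.add_mem _ ha hb
  | hsmul c a ha => rw [← Algebra.smul_def, map_smul]; exact Submodule.smul_mem _ _ ha

omit [N.Normal] in
lemma sum_gradeProj [Fintype (I ⧸ N)] (a : MonoidAlgebra k I) : ∑ q, gradeProj k N q a = a := by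
  classical
  induction a using monoidAlgebra_induction with
  | hof x => simp only [gradeProj_of, Finset.sum_ite_eq, Finset.mem_univ, if_true]
  | hadd a b ha hb => simp only [map_add, Finset.sum_add_distrib, ha, hb]
  | hsmul c a ha => simp only [← Algebra.smul_def, map_smul, ← Finset.smul_sum, ha]

lemma mul_mem_grade {q q' : I ⧸ N} {h h' : MonoidAlgebra k I} (hh : h ∈ grade k N q)
    (hh' : h' ∈ grade k N q') : h * h' ∈ grade k N (q * q') := by
  have h1 := Submodule.mul_mem_mul hh hh'
  rw [grade, grade, Submodule.span_mul_span] at h1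
  refine Submodule.span_mono ?_ h1
  rintro _ ⟨_, ⟨x, hx, rfl⟩, _, ⟨y, hy, rfl⟩, rfl⟩
  have hx' : (x : I ⧸ N) = q := hx
  have hy' : (y : I ⧸ N) = q' := hy
  exact ⟨x * y, by simp [hx', hy'], by simp⟩

variable {G : Type} [Group G] {f : G →* I} (hN : ∀ x, x ∈ N ↔ ∃ g, f g = x)

include hN

lemma exists_mapAlong_eq {h : MonoidAlgebra k I} (hh : h ∈ grade k N 1) :
    ∃ a, MapAlong k f a = h := by
  induction hh using Submodule.span_induction with
  | mem x hx =>
    obtain ⟨y, hy, rfl⟩ := hx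
    obtain ⟨g, rfl⟩ := (hN y).1 ((QuotientGroup.eq_one_iff y).1 hy)
    exact ⟨of k G g, mapAlong_of _ _⟩
  | zero => exact ⟨0, map_zero _⟩
  | add x y _ _ hx hy =>
    obtain ⟨a, rfl⟩ := hx
    obtain ⟨a', rfl⟩ := hy
    exact ⟨a + a', map_add _ _ _⟩
  | smul c x _ hx =>
    obtain ⟨a, rfl⟩ := hx
    exact ⟨algebraMap k _ c * a, by rw [map_mul, mapAlong_algebraMap, Algebra.smul_def]⟩

lemma mk_map_eq_one (g : G) : (f g : I ⧸ N) = 1 :=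
  (QuotientGroup.eq_one_iff _).2 ((hN _).2 ⟨g, rfl⟩)

lemma gradeProj_map_mul (q : I ⧸ N) (a : MonoidAlgebra k G) (h : MonoidAlgebra k I) :
    gradeProj k N q (MapAlong k f a * h) = MapAlong k f a * gradeProj k N q h := by
  classical
  induction a using monoidAlgebra_induction with
  | hof g =>
    induction h using monoidAlgebra_induction with
    | hof x =>
      rw [mapAlong_of, ← map_mul, gradeProj_of, gradeProj_of, QuotientGroup.mk_mul,
        mk_map_eq_one hN, one_mul, mul_ite, mul_zero, map_mul]
    | hadd h h' ha hb => simp only [mul_add, map_add, ha, hb]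
    | hsmul c h ha => simp only [← Algebra.smul_def, map_smul, mul_smul_comm, ha]
  | hadd a b ha hb => simp only [map_add, add_mul, ha, hb]
  | hsmul c a ha =>
    have hm : MapAlong k f (algebraMap k _ c * a) = c • MapAlong k f a := by
      rw [map_mul, mapAlong_algebraMap, Algebra.smul_def]
    rw [hm]
    simp only [smul_mul_assoc, map_smul, ha]

lemma gradeProj_mul_map (q : I ⧸ N) (a : MonoidAlgebra k G) (h : MonoidAlgebra k I) :
    gradeProj k N q (h * MapAlong k f a) = gradeProj k N q h * MapAlong k f a := by
  classical
  induction a using monoidAlgebra_induction with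
  | hof g =>
    induction h using monoidAlgebra_induction with
    | hof x =>
      rw [mapAlong_of, ← map_mul, gradeProj_of, gradeProj_of, QuotientGroup.mk_mul,
        mk_map_eq_one hN, mul_one, ite_mul, zero_mul, map_mul]
    | hadd h h' ha hb => simp only [add_mul, map_add, ha, hb]
    | hsmul c h ha => simp only [← Algebra.smul_def, map_smul, smul_mul_assoc, ha]
  | hadd a b ha hb => simp only [map_add, mul_add, ha, hb]
  | hsmul c a ha =>
    have hm : MapAlong k f (algebraMap k _ c * a) = c • MapAlong k f a := by
      rw [map_mul, mapAlong_algebraMap, Algebra.smul_def]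
    rw [hm]
    simp only [mul_smul_comm, map_smul, ha]

end Grading

section Nilpotent

/-- A central element of a block is nilpotent if it annihilates some nonzero module. -/
lemma isNilpotent_of_smul_eq_zero (k : Type) [Field k] {R : Type} [Ring R] [Algebra k R]
    [Module.Finite k R] {b : R} (hb : IsBlockIdem R b) {M : Type} [AddCommGroup M] [Module R M]
    [Nontrivial M] (hM : LiesIn R b M) (z : Subalgebra.center k R) (hzb : (z : R) * b = z)
    (hz : ∀ u : M, (z : R) • u = 0) : IsNilpotent z := by
  have : IsArtinianRing (Subalgebra.center k R) := isArtinian_of_tower k inferInstance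
  obtain ⟨n, y, hy⟩ := IsArtinian.exists_pow_succ_smul_dvd z (1 : Subalgebra.center k R)
  rw [smul_eq_mul, smul_eq_mul, mul_one, Nat.succ_eq_add_one] at hy
  have h1 : ∀ m, z ^ (n + m) * y ^ m = z ^ n := by
    intro m
    induction m with
    | zero => simp
    | succ m ih =>
      calc z ^ (n + (m + 1)) * y ^ (m + 1) = (z ^ (n + 1) * y) * z ^ m * y ^ m := by ring
        _ = z ^ (n + m) * y ^ m := by rw [hy]; ring
        _ = z ^ n := ih
  set e : Subalgebra.center k R := z ^ (n + 1) * y ^ (n + 1) with he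
  have hze : z ^ (n + 1) * e = z ^ (n + 1) := by
    calc z ^ (n + 1) * e = z ^ (n + (n + 1)) * y ^ (n + 1) * z := by rw [he]; ring
      _ = z ^ (n + 1) := by rw [h1]; ring
  have hee : e * e = e := by
    calc e * e = (z ^ (n + 1) * e) * y ^ (n + 1) := by rw [he]; ring
      _ = e := by rw [hze]
  have hce : IsCentralIdem R (e : R) := by
    refine ⟨congrArg Subtype.val hee, fun a => ?_⟩
    exact (Subalgebra.mem_center_iff.1 e.2 a)
  have hpow : ((z : R)) ^ (n + 1) * b = (z : R) ^ (n + 1) := by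
    rw [pow_succ, mul_assoc, hzb]
  have hcoe : (e : R) = (z : R) ^ (n + 1) * (y : R) ^ (n + 1) := rfl
  rcases hb.mul_eq_zero_or hce with h | h
  · refine ⟨n + 1, Subtype.ext ?_⟩
    have h2 := congrArg Subtype.val hze
    change (z : R) ^ (n + 1) * (e : R) = (z : R) ^ (n + 1) at h2
    change (z : R) ^ (n + 1) = 0
    rw [← h2, ← hpow, mul_assoc, h, mul_zero]
  · exfalso
    obtain ⟨u, hu⟩ := exists_ne (0 : M)
    apply hu
    rw [← hM u, ← h, mul_smul, hcoe, pow_succ', mul_assoc, mul_smul (z : R), hz, smul_zero]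

end Nilpotent

section Covering

open MonoidAlgebra (of)

variable {k : Type} [Field k] {G I : Type} [Group G] [Group I] {f : G →* I}

/-- Elements of the group algebra centralizing the image of `kG`, lying in a single coset,
belonging to the block and annihilating a given module. -/
def IsHomKiller (k : Type) [Field k] {G I : Type} [Group G] [Group I] (f : G →* I)
    (N : Subgroup I) [N.Normal] (b : MonoidAlgebra k G) (E : Type) [AddCommGroup E]
    [Module (MonoidAlgebra k I) E] (h : MonoidAlgebra k I) : Prop :=
  (∃ q, h ∈ grade k N q) ∧ (∀ a, h * MapAlong k f a = MapAlong k f a * h) ∧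
    h * MapAlong k f b = h ∧ ∀ u : E, h • u = 0

variable {N : Subgroup I} [N.Normal] {b : MonoidAlgebra k G}
  {E : Type} [AddCommGroup E] [Module (MonoidAlgebra k I) E]

lemma commute_list_prod {l : List (MonoidAlgebra k I)} (hl : ∀ h ∈ l, IsHomKiller k f N b E h)
    (a : MonoidAlgebra k G) : l.prod * MapAlong k f a = MapAlong k f a * l.prod :=
  (Commute.list_prod_left _ _ fun h hh => (hl h hh).2.1 a)

lemma list_prod_mem_grade {d : MonoidAlgebra k I → I ⧸ N} {l : List (MonoidAlgebra k I)}
    (hl : ∀ h ∈ l, h ∈ grade k N (d h)) : l.prod ∈ grade k N (l.map d).prod := by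
  induction l with
  | nil => exact Submodule.subset_span ⟨1, rfl, map_one _⟩
  | cons h l ih =>
    rw [List.prod_cons, List.map_cons, List.prod_cons]
    exact mul_mem_grade (hl h List.mem_cons_self) (ih fun h' hh' => hl h' (List.mem_cons_of_mem _ hh'))

/-- A product of sufficiently many homogeneous elements has a factor in the radical of the center
of the block. -/
lemma exists_nilpotent_factor [Finite G] [Finite I] (hN : ∀ x, x ∈ N ↔ ∃ g, f g = x)
    (hf : Function.Injective f)
    (hb : IsBlockIdem (MonoidAlgebra k G) b) {S : Type} [AddCommGroup S]
    [Module (MonoidAlgebra k G) S] [Nontrivial S] (hS : LiesIn (MonoidAlgebra k G) b S)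
    (hE : ExtendsAlong k f S E) (l : List (MonoidAlgebra k I))
    (hl : ∀ h ∈ l, IsHomKiller k f N b E h) (hlen : Nat.card (I ⧸ N) ≤ l.length) :
    ∃ z ∈ nilradical (Subalgebra.center k (MonoidAlgebra k G)), ∃ y,
      l.prod = MapAlong k f (z : MonoidAlgebra k G) * y := by
  classical
  have : Fintype (I ⧸ N) := Fintype.ofFinite _
  let d : MonoidAlgebra k I → I ⧸ N := fun h => if hh : ∃ q, h ∈ grade k N q then hh.choose else 1
  have hd : ∀ h, IsHomKiller k f N b E h → h ∈ grade k N (d h) := by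
    intro h hh
    simp only [d, hh.1, dite_true]
    exact hh.1.choose_spec
  let p : Fin (l.length + 1) → I ⧸ N := fun i => ((l.take i).map d).prod
  obtain ⟨i, j, hij, hp⟩ : ∃ i j, i < j ∧ p i = p j := by
    obtain ⟨i, j, hne, hp⟩ := Fintype.exists_ne_map_eq_of_card_lt p (by
      rw [Fintype.card_fin, ← Nat.card_eq_fintype_card]
      omega)
    rcases lt_or_gt_of_ne hne with h | h
    · exact ⟨i, j, h, hp⟩
    · exact ⟨j, i, h, hp.symm⟩
  have hij' : (i : ℕ) < j := hij
  have hj : (j : ℕ) ≤ l.length := Nat.lt_succ_iff.1 j.2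
  obtain ⟨m, hm⟩ : ∃ m, (j : ℕ) = i + (m + 1) := ⟨j - i - 1, by omega⟩
  set t := (l.drop i).take (m + 1) with ht
  have htake : l.take j = l.take i ++ t := by rw [hm, List.take_add]
  have htl : ∀ h ∈ t, IsHomKiller k f N b E h := fun h hh =>
    hl h (List.mem_of_mem_drop (List.mem_of_mem_take hh))
  have htdeg : (t.map d).prod = 1 := by
    have h1 : p j = p i * (t.map d).prod := by
      change ((l.take j).map d).prod = ((l.take i).map d).prod * _
      rw [htake, List.map_append, List.prod_append]
    rw [hp] at h1
    exact (mul_eq_left.1 h1.symm)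
  have hmem : t.prod ∈ grade k N 1 := by
    rw [← htdeg]
    exact list_prod_mem_grade fun h hh => hd h (htl h hh)
  obtain ⟨z, hz⟩ := exists_mapAlong_eq hN hmem
  have htcomm := commute_list_prod htl
  obtain ⟨h₀, t', ht'⟩ : ∃ h₀ t', t = h₀ :: t' := by
    refine List.exists_cons_of_length_pos ?_
    rw [ht, List.length_take, List.length_drop]
    omega
  have hinj := mapAlong_injective (k := k) f hf
  have hh₀ : IsHomKiller k f N b E h₀ := htl h₀ (by rw [ht']; exact List.mem_cons_self)
  have ht'l : ∀ h ∈ t', IsHomKiller k f N b E h := fun h hh => htl h (by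
    rw [ht']; exact List.mem_cons_of_mem _ hh)
  have hzb : z * b = z := by
    apply hinj
    rw [map_mul, hz, ht', List.prod_cons, mul_assoc, commute_list_prod ht'l, ← mul_assoc, hh₀.2.2.1]
  have hzc : z ∈ Subalgebra.center k (MonoidAlgebra k G) := by
    rw [Subalgebra.mem_center_iff]
    intro a
    apply hinj
    rw [map_mul, map_mul, hz, htcomm]
  obtain ⟨θ, hθ⟩ := hE
  have hzS : ∀ u : S, z • u = 0 := by
    intro u
    apply θ.injective
    rw [hθ, map_zero, hz, ht', List.prod_cons, mul_smul, hh₀.2.2.2]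
  refine ⟨⟨z, hzc⟩, isNilpotent_of_smul_eq_zero k hb hS ⟨z, hzc⟩ hzb hzS,
    (l.take i).prod * (l.drop j).prod, ?_⟩
  change l.prod = MapAlong k f z * _
  rw [← mul_assoc, ← commute_list_prod fun h hh => hl h (List.mem_of_mem_take hh), hz,
    ← List.prod_append, ← htake, ← List.prod_append, List.take_append_drop]

/-- A central idempotent of the block whose homogeneous components annihilate a nonzero module of
the block is zero. -/
lemma eq_zero_of_gradeProj_smul [Finite G] [Finite I] (hN : ∀ x, x ∈ N ↔ ∃ g, f g = x)
    (hf : Function.Injective f)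
    (hb : IsBlockIdem (MonoidAlgebra k G) b) {S : Type} [AddCommGroup S]
    [Module (MonoidAlgebra k G) S] [Nontrivial S] (hS : LiesIn (MonoidAlgebra k G) b S)
    (hE : ExtendsAlong k f S E) {c : MonoidAlgebra k I} (hc : IsCentralIdem _ c)
    (hcb : c * MapAlong k f b = c) (h0 : ∀ (q : I ⧸ N) (u : E), gradeProj k N q c • u = 0) :
    c = 0 := by
  classical
  have : Fintype (I ⧸ N) := Fintype.ofFinite _
  let Z := Subalgebra.center k (MonoidAlgebra k G)
  let P : ℕ → Submodule k (MonoidAlgebra k I) := fun s => Submodule.span k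
    {x | ∃ z ∈ nilradical Z ^ s, ∃ y, x = MapAlong k f (z : MonoidAlgebra k G) * y}
  have hcpow : ∀ n, c ^ (n + 1) = c := fun n => IsIdempotentElem.pow_succ_eq n hc.1
  have hcard : Nat.card (I ⧸ N) - 1 + 1 = Nat.card (I ⧸ N) :=
    Nat.sub_add_cancel Nat.card_pos
  have hP1 : c ∈ P 1 := by
    have h1 : c ∈ Submodule.span k {h | IsHomKiller k f N b E h} := by
      rw [← sum_gradeProj (N := N) c]
      refine Submodule.sum_mem _ fun q _ => Submodule.subset_span
        ⟨⟨q, gradeProj_mem q c⟩, fun a => ?_, ?_, h0 q⟩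
      · rw [← gradeProj_map_mul hN, ← gradeProj_mul_map hN, hc.2]
      · rw [← gradeProj_mul_map hN, hcb]
    have h2 := Submodule.pow_mem_pow _ h1 (Nat.card (I ⧸ N) - 1 + 1)
    rw [hcpow, Submodule.span_pow, hcard] at h2
    refine Submodule.span_mono ?_ h2
    intro x hx
    obtain ⟨l, rfl⟩ := Set.mem_pow.1 hx
    obtain ⟨z, hz, y, hy⟩ := exists_nilpotent_factor hN hf hb hS hE
      (List.ofFn fun i => (l i : MonoidAlgebra k I)) (by
        intro h hh
        obtain ⟨i, rfl⟩ := (List.mem_ofFn' _ _).1 hh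
        exact (l i).2) (by rw [List.length_ofFn])
    exact ⟨z, by rwa [pow_one], y, hy⟩
  have hP : ∀ s, c ∈ P s := by
    intro s
    induction s with
    | zero => exact Submodule.subset_span ⟨1, by simp, c, by
        rw [OneMemClass.coe_one, map_one, one_mul]⟩
    | succ s ih =>
      rw [← hc.1]
      have h1 : ∀ x ∈ P s, x * c ∈ P (s + 1) := by
        intro x hx
        induction hx using Submodule.span_induction with
        | mem x hx =>
          obtain ⟨z, hz, y, rfl⟩ := hx
          rw [mul_assoc, hc.2]
          have h2 : ∀ x ∈ P 1, MapAlong k f (z : MonoidAlgebra k G) * (x * y) ∈ P (s + 1) := by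
            intro x hx
            induction hx using Submodule.span_induction with
            | mem x hx =>
              obtain ⟨z', hz', y', rfl⟩ := hx
              refine Submodule.subset_span ⟨z * z', ?_, y' * y, ?_⟩
              · rw [pow_succ]
                exact Ideal.mul_mem_mul hz (by rwa [pow_one] at hz')
              · rw [MulMemClass.coe_mul, map_mul]
                simp only [mul_assoc]
            | zero => rw [zero_mul, mul_zero]; exact Submodule.zero_mem _
            | add x x' _ _ hx hx' => rw [add_mul, mul_add]; exact Submodule.add_mem _ hx hx'
            | smul r x _ hx => rw [smul_mul_assoc, mul_smul_comm]; exact Submodule.smul_mem _ _ hx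
          exact h2 c hP1
        | zero => rw [zero_mul]; exact Submodule.zero_mem _
        | add x x' _ _ hx hx' => rw [add_mul]; exact Submodule.add_mem _ hx hx'
        | smul r x _ hx => rw [smul_mul_assoc]; exact Submodule.smul_mem _ _ hx
      exact h1 c ih
  have : IsArtinianRing Z := isArtinian_of_tower k inferInstance
  obtain ⟨r, hr⟩ := IsArtinianRing.isNilpotent_nilradical (R := Z)
  have h3 := hP r
  have h4 : P r ≤ ⊥ := by
    refine Submodule.span_le.2 ?_
    rintro x ⟨z, hz, y, rfl⟩
    rw [hr] at hz
    have hz0 : z = 0 := hz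
    rw [hz0, ZeroMemClass.coe_zero, map_zero, zero_mul]
    exact Submodule.zero_mem _
  exact (Submodule.mem_bot k).1 (h4 h3)

/-- A nonzero central idempotent of the block does not annihilate all extensions of a brick. -/
lemma exists_extension_smul_ne_zero [Finite G] [Finite I] (hN : ∀ x, x ∈ N ↔ ∃ g, f g = x)
    (hf : Function.Injective f) (hb : IsBlockIdem (MonoidAlgebra k G) b)
    (hbasic : BasicAlg k (MonoidAlgebra k (I ⧸ N))) {e : ℕ}
    (he : RepClasses k (MonoidAlgebra k (I ⧸ N))
      (fun V => IsSimpleModule (MonoidAlgebra k (I ⧸ N)) V) e)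
    {S : Type} [AddCommGroup S] [Module (MonoidAlgebra k G) S]
    (hS : IsBrickOver k (MonoidAlgebra k G) S) (hSb : LiesIn (MonoidAlgebra k G) b S)
    {E : Fin e → BModule k (MonoidAlgebra k I)} (hE : ∀ j, ExtendsAlong k f S (E j))
    (hdist : ∀ j j', j ≠ j' → IsEmpty (E j ≃ₗ[MonoidAlgebra k I] E j'))
    {c : MonoidAlgebra k I} (hc : IsCentralIdem _ c) (hcb : c * MapAlong k f b = c) (hc0 : c ≠ 0) :
    ∃ j, ∃ u : E j, c • u ≠ 0 := by
  classical
  by_contra! h0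
  obtain ⟨F, -⟩ := exists_injective_characters he
  let j₀ : Fin e := F 1
  have := hS.1
  obtain ⟨q, s, hqs⟩ : ∃ (q : I ⧸ N) (s : E j₀), gradeProj k N q c • s ≠ 0 := by
    by_contra! h1
    exact hc0 (eq_zero_of_gradeProj_smul hN hf hb hSb (hE j₀) hc hcb h1)
  let ρ : Representation k I (I ⧸ N → E j₀) :=
    { toFun := fun x =>
        { toFun := fun v q => of k I x • v ((x : I ⧸ N)⁻¹ * q)
          map_add' := fun v w => funext fun q => smul_add _ _ _
          map_smul' := fun r v => funext fun q => by
            simp only [Pi.smul_apply, RingHom.id_apply]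
            rw [← algebraMap_smul (MonoidAlgebra k I), ← mul_smul, ← Algebra.commutes, mul_smul,
              algebraMap_smul] }
      map_one' := LinearMap.ext fun v => funext fun q => by
        change of k I 1 • v _ = v q
        rw [map_one, one_smul, QuotientGroup.mk_one, inv_one, one_mul]
      map_mul' := fun x y => LinearMap.ext fun v => funext fun q => by
        change of k I (x * y) • v _ = of k I x • of k I y • v _
        rw [map_mul, mul_smul, QuotientGroup.mk_mul, mul_inv_rev, mul_assoc] }
  have hρ : ∀ x v q, ρ x v q = of k I x • v ((x : I ⧸ N)⁻¹ * q) := fun x v q => rfl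
  let δ : E j₀ →+ ρ.asModule := ρ.asModuleEquiv.symm.toLinearMap.toAddMonoidHom.comp
    (AddMonoidHom.single (fun _ : I ⧸ N => (E j₀).carrier) 1)
  have hδ0 : ∀ s, ρ.asModuleEquiv (δ s) = Pi.single 1 s := fun s => rfl
  have hδ : ∀ (a : MonoidAlgebra k I) s q, ρ.asModuleEquiv (a • δ s) q = gradeProj k N q a • s := by
    intro a s q
    induction a using monoidAlgebra_induction with
    | hof x =>
      rw [MonoidAlgebra.of_apply, Representation.single_smul, one_smul, ← MonoidAlgebra.of_apply]
      change ρ x (Pi.single 1 s) q = _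
      rw [gradeProj_of, hρ, Pi.single_apply]
      by_cases hq : (x : I ⧸ N) = q
      · rw [if_pos hq, if_pos (inv_mul_eq_one.2 hq)]
      · rw [if_neg hq, if_neg (mt inv_mul_eq_one.1 hq), smul_zero, zero_smul]
    | hadd a a' ha ha' => rw [add_smul, map_add, Pi.add_apply, ha, ha', map_add, add_smul]
    | hsmul r a ha =>
      rw [mul_smul, algebraMap_smul, map_smul, Pi.smul_apply, ha, ← Algebra.smul_def, map_smul,
        smul_assoc]
  let X := blockComp (MonoidAlgebra k I) c hc.2 ρ.asModule
  have hmem : ∀ w : ρ.asModule, c • w ∈ X := fun w => by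
    change c • c • w = _
    rw [← mul_smul, hc.1]
  obtain ⟨θ, hθ⟩ := hE j₀
  have hδG : ∀ (a : MonoidAlgebra k G) s, δ (θ (a • s)) = MapAlong k f a • δ (θ s) := by
    intro a s
    apply ρ.asModuleEquiv.injective
    ext q
    rw [hδ, hδ0, hθ, ← mul_one (MapAlong k f a), gradeProj_map_mul hN, mul_one, ← map_one (of k I),
      gradeProj_of, QuotientGroup.mk_one, Pi.single_apply]
    by_cases hq : q = 1
    · rw [if_pos hq, if_pos hq.symm, map_one, mul_one]
    · rw [if_neg hq, if_neg (Ne.symm hq), mul_zero, zero_smul]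
  let φ : S →+ X :=
    { toFun := fun s => ⟨c • δ (θ s), hmem _⟩
      map_zero' := Subtype.ext (by simp)
      map_add' := fun s t => Subtype.ext (by simp) }
  obtain ⟨j, g, hg⟩ := exists_extension_hom hN hbasic he hS hE hdist
    (BModule.ofModule k (MonoidAlgebra k I) X) φ (by
      intro a s
      apply Subtype.ext
      change c • δ (θ (a • s)) = MapAlong k f a • c • δ (θ s)
      rw [hδG, ← mul_smul, ← mul_smul, hc.2]) (by
      intro hφ
      apply hqs
      obtain ⟨s, rfl⟩ := θ.surjective s
      have h1 : c • δ (θ s) = 0 := congrArg Subtype.val (DFunLike.congr_fun hφ s)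
      rw [← hδ, h1]
      rfl)
  apply hg
  ext u
  have h1 : c • g u = g u := Subtype.ext (g u).2
  rw [← h1, ← map_smul, h0, map_zero, LinearMap.zero_apply]

end Covering

section Extensions

variable {k : Type} [Field k] {G I : Type} [Group G] [Group I] {f : G →* I}
  {S S' E E' : Type} [AddCommGroup S] [Module (MonoidAlgebra k G) S]
  [AddCommGroup S'] [Module (MonoidAlgebra k G) S'] [AddCommGroup E] [Module (MonoidAlgebra k I) E]
  [AddCommGroup E'] [Module (MonoidAlgebra k I) E']

lemma ExtendsAlong.nonempty_equiv_of_ne_zero (hS : IsBrickOver k (MonoidAlgebra k G) S)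
    (hE : ExtendsAlong k f S E) (hE' : ExtendsAlong k f S' E')
    (hSS : IsEmpty (S ≃ₗ[MonoidAlgebra k G] S') → ∀ g : S →ₗ[MonoidAlgebra k G] S', g = 0)
    {g : E →ₗ[MonoidAlgebra k I] E'} (hg : g ≠ 0) : Nonempty (E ≃ₗ[MonoidAlgebra k I] E') := by
  obtain ⟨θ, hθ⟩ := hE
  obtain ⟨θ', hθ'⟩ := hE'
  have hθs : ∀ (a : MonoidAlgebra k G) u, θ.symm (MapAlong k f a • u) = a • θ.symm u := fun a u =>
    θ.injective (by rw [hθ, θ.apply_symm_apply, θ.apply_symm_apply])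
  have hθs' : ∀ (a : MonoidAlgebra k G) u, θ'.symm (MapAlong k f a • u) = a • θ'.symm u :=
    fun a u => θ'.injective (by rw [hθ', θ'.apply_symm_apply, θ'.apply_symm_apply])
  let g₀ : S →ₗ[MonoidAlgebra k G] S' :=
    { toFun := fun s => θ'.symm (g (θ s))
      map_add' := fun s t => by rw [map_add, map_add, map_add]
      map_smul' := fun a s => by rw [hθ, map_smul, hθs', RingHom.id_apply] }
  have hg₀ : g₀ ≠ 0 := by
    intro h0
    apply hg
    ext u
    have h1 : θ'.symm (g (θ (θ.symm u))) = 0 := DFunLike.congr_fun h0 (θ.symm u)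
    rwa [θ.apply_symm_apply, EmbeddingLike.map_eq_zero_iff] at h1
  obtain ⟨α⟩ : Nonempty (S ≃ₗ[MonoidAlgebra k G] S') := by
    by_contra h0
    exact hg₀ (hSS (not_nonempty_iff.1 h0) g₀)
  obtain ⟨r, hr⟩ := hS.2 (α.symm.toLinearMap.comp g₀)
  have hr' : ∀ s, g₀ s = algebraMap k (MonoidAlgebra k G) r • α s := fun s => by
    rw [← map_smul, ← hr]
    exact (α.apply_symm_apply _).symm
  have hr0 : r ≠ 0 := by
    rintro rfl
    apply hg₀
    ext s
    rw [hr', map_zero, zero_smul, LinearMap.zero_apply]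
  have hg' : ∀ u, g u = θ' (algebraMap k (MonoidAlgebra k G) r • α (θ.symm u)) := fun u => by
    rw [← hr']
    change _ = θ' (θ'.symm (g (θ (θ.symm u))))
    rw [θ'.apply_symm_apply, θ.apply_symm_apply]
  refine ⟨LinearEquiv.ofBijective g ⟨?_, ?_⟩⟩
  · rw [injective_iff_map_eq_zero]
    intro u hu
    rw [hg', EmbeddingLike.map_eq_zero_iff] at hu
    have h1 := congrArg (algebraMap k (MonoidAlgebra k G) r⁻¹ • ·) hu
    simp only [← mul_smul, ← map_mul, inv_mul_cancel₀ hr0, map_one, one_smul, smul_zero] at h1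
    rwa [EmbeddingLike.map_eq_zero_iff, EmbeddingLike.map_eq_zero_iff] at h1
  · intro v
    refine ⟨θ (α.symm (algebraMap k (MonoidAlgebra k G) r⁻¹ • θ'.symm v)), ?_⟩
    rw [hg', θ.symm_apply_apply, α.apply_symm_apply, ← mul_smul, ← map_mul, mul_inv_cancel₀ hr0,
      map_one, one_smul, θ'.apply_symm_apply]

lemma ExtendsAlong.isBrickOver (hE : ExtendsAlong k f S E)
    (hS : IsBrickOver k (MonoidAlgebra k G) S) : IsBrickOver k (MonoidAlgebra k I) E := by
  refine ⟨?_, fun φ => hS.exists_scalar_of_extends hE φ.toAddMonoidHom fun a u => φ.map_smul _ _⟩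
  have := hS.1
  obtain ⟨θ, -⟩ := hE
  exact θ.symm.toEquiv.nontrivial

lemma ExtendsAlong.finite (hE : ExtendsAlong k f S E) [Module.Finite (MonoidAlgebra k G) S] :
    Module.Finite (MonoidAlgebra k I) E := by
  obtain ⟨θ, hθ⟩ := hE
  obtain ⟨n, s, hs⟩ := Module.Finite.exists_fin (R := MonoidAlgebra k G) (M := S)
  refine ⟨Submodule.fg_def.2 ⟨_, Set.finite_range (θ ∘ s), ?_⟩⟩
  rw [eq_top_iff]
  rintro v -
  obtain ⟨u, rfl⟩ := θ.surjective v
  have hu : u ∈ Submodule.span (MonoidAlgebra k G) (Set.range s) := by rw [hs]; trivial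
  induction hu using Submodule.span_induction with
  | mem x hx =>
    obtain ⟨i, rfl⟩ := hx
    exact Submodule.subset_span ⟨i, rfl⟩
  | zero => rw [map_zero]; exact Submodule.zero_mem _
  | add x y _ _ hx hy => rw [map_add]; exact Submodule.add_mem _ hx hy
  | smul c x _ hx => rw [hθ]; exact Submodule.smul_mem _ _ hx

lemma ExtendsAlong.mapAlong_smul {b : MonoidAlgebra k G} (hE : ExtendsAlong k f S E)
    (hS : LiesIn (MonoidAlgebra k G) b S) (u : E) : MapAlong k f b • u = u := by
  obtain ⟨θ, hθ⟩ := hE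
  obtain ⟨s, rfl⟩ := θ.surjective u
  rw [← hθ, hS]

lemma IsBrickOver.smul_eq_or {R U : Type} [Ring R] [Algebra k R] [AddCommGroup U] [Module R U]
    (hU : IsBrickOver k R U) {c : R} (hc : IsCentralIdem R c) :
    (∀ u : U, c • u = u) ∨ ∀ u : U, c • u = 0 := by
  obtain ⟨r, hr⟩ := hU.2
    { toFun := fun u => c • u
      map_add' := smul_add c
      map_smul' := fun a u => by rw [← mul_smul, ← hc.2, mul_smul, RingHom.id_apply] }
  replace hr : ∀ u : U, c • u = algebraMap k R r • u := hr
  by_cases h1 : r = 1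
  · exact Or.inl fun u => by rw [hr, h1, map_one, one_smul]
  · refine Or.inr fun u => ?_
    have h2 : c • c • u = c • u := by rw [← mul_smul, hc.1]
    rw [hr (c • u), ← sub_eq_zero] at h2
    nth_rewrite 2 [← one_smul R (c • u)] at h2
    rw [← sub_smul, ← map_one (algebraMap k R), ← map_sub] at h2
    have h3 := congrArg (algebraMap k R (r - 1)⁻¹ • ·) h2
    simpa only [← mul_smul, ← mul_assoc, ← map_mul, inv_mul_cancel₀ (sub_ne_zero.2 h1), map_one,
      one_mul, smul_zero] using h3

end Extensions

section Decomposition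

variable {k : Type} [Field k] {A B : Type} [Group A] [Group B] {f : A →* B}
  {W : Type} [AddCommGroup W] [Module (MonoidAlgebra k B) W]

/-- A module induced from a finite direct sum is the direct sum of induced modules. -/
lemma IsInducedUnit.exists_pi {Λ : Type} [Finite Λ] {E : Λ → Type} [∀ i, AddCommGroup (E i)]
    [∀ i, Module (MonoidAlgebra k A) (E i)] {η : (∀ i, E i) →+ W}
    (h : IsInducedUnit k f (∀ i, E i) W η) :
    ∃ T : Λ → BModule k (MonoidAlgebra k B), ∃ ξ : ∀ i, E i →+ T i,
      (∀ i, IsInducedUnit k f (E i) (T i) (ξ i)) ∧ Nonempty (W ≃ₗ[MonoidAlgebra k B] ∀ i, T i) := by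
  classical
  have := Fintype.ofFinite Λ
  have hηs : ∀ i (a : MonoidAlgebra k A) (s : E i),
      η (Pi.single i (a • s)) = MapAlong k f a • η (Pi.single i s) := fun i a s => by
    rw [← h.1]
    exact congrArg η (Pi.single_smul i a s)
  have h1 : ∀ i, ∃ p : W →ₗ[MonoidAlgebra k B] W, ∀ u, p (η u) = η (Pi.single i (u i)) := fun i =>
    h.exists_hom (η.comp ((AddMonoidHom.single E i).comp (Pi.evalAddMonoidHom E i))) fun a u =>
      hηs i a (u i)
  choose p hp using h1
  have hpp : ∀ i w, p i (p i w) = p i w := fun i => LinearMap.congr_fun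
    (f := (p i).comp (p i)) (h.hom_ext fun u => by
      rw [LinearMap.comp_apply, hp, hp, Pi.single_eq_same])
  have hpp' : ∀ i j, i ≠ j → ∀ w, p i (p j w) = 0 := fun i j hij => LinearMap.congr_fun
    (f := (p i).comp (p j)) (g := 0) (h.hom_ext fun u => by
      rw [LinearMap.comp_apply, hp, hp, Pi.single_eq_of_ne hij, Pi.single_zero, map_zero,
        LinearMap.zero_apply])
  have hsum : ∀ w, ∑ i, p i w = w := fun w => by
    have : (∑ i, p i) = LinearMap.id := h.hom_ext fun u => by
      rw [LinearMap.sum_apply, LinearMap.id_apply]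
      simp only [hp]
      rw [← map_sum, Finset.univ_sum_single]
    simpa only [LinearMap.sum_apply, LinearMap.id_apply] using LinearMap.congr_fun this w
  have hmem : ∀ i (t : LinearMap.range (p i)), p i t.1 = t.1 := by
    rintro i ⟨_, w, rfl⟩
    exact hpp i w
  have hηmem : ∀ i (s : E i), η (Pi.single i s) ∈ LinearMap.range (p i) := fun i s =>
    ⟨η (Pi.single i s), by rw [hp, Pi.single_eq_same]⟩
  let ξ : ∀ i, E i →+ LinearMap.range (p i) := fun i =>
    { toFun := fun s => ⟨η (Pi.single i s), hηmem i s⟩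
      map_zero' := Subtype.ext (by
        change η (Pi.single i 0) = 0
        rw [Pi.single_zero, map_zero])
      map_add' := fun s t => Subtype.ext (by
        change η (Pi.single i (s + t)) = η (Pi.single i s) + η (Pi.single i t)
        rw [Pi.single_add, map_add]) }
  let ε : W →ₗ[MonoidAlgebra k B] ∀ i, LinearMap.range (p i) :=
    LinearMap.pi fun i => (p i).rangeRestrict
  have hε : Function.Bijective ε := by
    refine ⟨fun w w' hw => ?_, fun t => ⟨∑ j, (t j).1, funext fun i => Subtype.ext ?_⟩⟩
    · rw [← hsum w, ← hsum w']
      exact Finset.sum_congr rfl fun i _ => congrArg Subtype.val (congrFun hw i)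
    · change p i (∑ j, (t j).1) = (t i).1
      rw [map_sum, Finset.sum_eq_single i]
      · exact hmem i (t i)
      · intro j _ hj
        rw [← hmem j (t j), hpp' i j (Ne.symm hj)]
      · exact fun hi => absurd (Finset.mem_univ i) hi
  refine ⟨fun i => BModule.ofModule k (MonoidAlgebra k B) (LinearMap.range (p i)), ξ,
    fun i => ⟨fun a s => Subtype.ext ?_, fun X g hg => ?_⟩, ⟨LinearEquiv.ofBijective ε hε⟩⟩
  · exact hηs i a s
  · obtain ⟨F, hF⟩ := h.exists_hom (g.comp (Pi.evalAddMonoidHom E i)) fun a u => hg a (u i)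
    refine ⟨F.comp (LinearMap.range (p i)).subtype, fun u => ?_, fun F' hF' => ?_⟩
    · refine (hF _).trans ?_
      change g (Pi.single i u i) = _
      rw [Pi.single_eq_same]
    · have h2 : F'.comp (p i).rangeRestrict =
          (F.comp (LinearMap.range (p i)).subtype).comp (p i).rangeRestrict := h.hom_ext fun u => by
        have h3 : (p i).rangeRestrict (η u) = ξ i (u i) := Subtype.ext (hp i u)
        change F' ((p i).rangeRestrict (η u)) = F ((p i).rangeRestrict (η u)).1
        rw [h3]
        refine (hF' (u i)).trans (Eq.symm ((hF (Pi.single i (u i))).trans ?_))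
        change g (Pi.single i (u i) i) = _
        rw [Pi.single_eq_same]
      ext t
      obtain ⟨w, rfl⟩ := (p i).surjective_rangeRestrict t
      exact LinearMap.congr_fun h2 w

end Decomposition

section InducedSemibrick

variable {k : Type} [Field k] {Gt : Type} [Group Gt] {G : Subgroup Gt} [G.Normal]
  {b : MonoidAlgebra k G} {hGI : G ≤ inertia k Gt G b}
  {W : Type} [AddCommGroup W] [Module (MonoidAlgebra k Gt) W]

/-- Induction from the inertia group sends semibricks in the block to semibricks. -/
lemma IsInducedUnit.isSemibrickModule (hb : IsBlockIdem (MonoidAlgebra k G) b)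
    {Λ : Type} [Finite Λ] {E : Λ → Type} [∀ i, AddCommGroup (E i)]
    [∀ i, Module (MonoidAlgebra k (inertia k Gt G b)) (E i)] {η : (∀ i, E i) →+ W}
    (h : IsInducedUnit k (inertia k Gt G b).subtype (∀ i, E i) W η)
    (hE : ∀ i (u : E i), MapAlong k (Subgroup.inclusion hGI) b • u = u)
    (hbrick : ∀ i, IsBrickOver k (MonoidAlgebra k (inertia k Gt G b)) (E i))
    (hhom : ∀ i j, IsEmpty (E i ≃ₗ[MonoidAlgebra k (inertia k Gt G b)] E j) →
      ∀ f : E i →ₗ[MonoidAlgebra k (inertia k Gt G b)] E j, f = 0) :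
    IsSemibrickModule k (MonoidAlgebra k Gt) W := by
  obtain ⟨T, ξ, hξ, ⟨ε⟩⟩ := h.exists_pi
  obtain ⟨m, ⟨σ⟩⟩ := Finite.exists_equiv_fin Λ
  refine ⟨m, fun i => T (σ.symm i), ⟨ε.trans
    (LinearEquiv.piCongrLeft (MonoidAlgebra k Gt) (fun i => (T i).carrier) σ.symm).symm⟩,
    fun i => ⟨?_, fun φ => ?_⟩, fun i j hij φ => ?_⟩
  · have := (hbrick (σ.symm i)).1
    exact (hξ (σ.symm i)).injective.nontrivial
  · obtain ⟨φ', hφ'⟩ := (hξ (σ.symm i)).exists_descend hb (hξ (σ.symm i)) (hE _) (hE _) φ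
    obtain ⟨r, hr⟩ := (hbrick (σ.symm i)).2 φ'
    let ρ : T (σ.symm i) →ₗ[MonoidAlgebra k Gt] T (σ.symm i) :=
      { toFun := fun t => algebraMap k (MonoidAlgebra k Gt) r • t
        map_add' := smul_add _
        map_smul' := fun a t => by rw [← mul_smul, Algebra.commutes, mul_smul, RingHom.id_apply] }
    have h1 : φ = ρ := (hξ (σ.symm i)).hom_ext fun u => by
      rw [hφ', hr, equivariant_smul (hξ (σ.symm i)).1]
      rfl
    exact ⟨r, fun t => LinearMap.congr_fun h1 t⟩
  · obtain ⟨φ', hφ'⟩ := (hξ (σ.symm i)).exists_descend hb (hξ (σ.symm j)) (hE _) (hE _) φ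
    refine (hξ (σ.symm i)).hom_ext fun u => ?_
    rw [hφ', hhom _ _ ⟨fun α => ?_⟩ φ', LinearMap.zero_apply, map_zero, LinearMap.zero_apply]
    obtain ⟨α'⟩ := (hξ (σ.symm i)).nonempty_equiv (hξ (σ.symm j)) α
    exact hij.false α'

omit [G.Normal] in
/-- The block component of an induced module is induced from the corresponding component. -/
lemma IsInducedUnit.blockComp {U U₁ : Type} [AddCommGroup U] [AddCommGroup U₁]
    [Module (MonoidAlgebra k (inertia k Gt G b)) U]
    [Module (MonoidAlgebra k (inertia k Gt G b)) U₁] {η : U →+ W}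
    (h : IsInducedUnit k (inertia k Gt G b).subtype U W η)
    (hU : ∀ u : U, MapAlong k (Subgroup.inclusion hGI) b • u = u)
    {bt : MonoidAlgebra k Gt} (hbt : IsCentralIdem (MonoidAlgebra k Gt) bt)
    {c : MonoidAlgebra k (inertia k Gt G b)}
    (hc : MapAlong k (inertia k Gt G b).subtype c = MapAlong k G.subtype b * bt)
    (s : U₁ →ₗ[MonoidAlgebra k (inertia k Gt G b)] U)
    (r : U →ₗ[MonoidAlgebra k (inertia k Gt G b)] U₁)
    (hrs : ∀ u, r (s u) = u) (hsr : ∀ u, s (r u) = c • u) :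
    ∃ ξ : U₁ →+ Paper.blockComp (MonoidAlgebra k Gt) bt hbt.2 W,
      IsInducedUnit k (inertia k Gt G b).subtype U₁
        (Paper.blockComp (MonoidAlgebra k Gt) bt hbt.2 W) ξ := by
  have hηc : ∀ u, η (c • u) = bt • η u := fun u => by
    rw [h.1, hc, hbt.2, mul_smul, ← mapAlong_inclusion hGI, ← h.1, hU]
  have hηs : ∀ u, bt • η (s u) = η (s u) := fun u => by rw [← hηc, ← hsr, hrs]
  let ξ : U₁ →+ Paper.blockComp (MonoidAlgebra k Gt) bt hbt.2 W :=
    { toFun := fun u => ⟨η (s u), hηs u⟩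
      map_zero' := Subtype.ext (by
        change η (s 0) = 0
        rw [map_zero, map_zero])
      map_add' := fun u v => Subtype.ext (by
        change η (s (u + v)) = η (s u) + η (s v)
        rw [map_add, map_add]) }
  let π : W →ₗ[MonoidAlgebra k Gt] Paper.blockComp (MonoidAlgebra k Gt) bt hbt.2 W :=
    { toFun := fun w => ⟨bt • w, by
        change bt • bt • w = _
        rw [← mul_smul, hbt.1]⟩
      map_add' := fun w w' => Subtype.ext (smul_add _ _ _)
      map_smul' := fun a w => Subtype.ext (by
        change bt • a • w = a • bt • w
        rw [← mul_smul, ← mul_smul, hbt.2]) }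
  have hπξ : ∀ u, π (η u) = ξ (r u) := fun u => Subtype.ext (by
    change bt • η u = η (s (r u))
    rw [hsr, hηc])
  have hπ : ∀ w : Paper.blockComp (MonoidAlgebra k Gt) bt hbt.2 W, π w.1 = w := fun w =>
    Subtype.ext w.2
  refine ⟨ξ, fun a u => Subtype.ext ?_, fun X g hg => ?_⟩
  · change η (s (a • u)) = _ • η (s u)
    rw [map_smul, h.1]
  · obtain ⟨F, hF⟩ := h.exists_hom (g.comp r.toAddMonoidHom) fun a u => by
      change g (r (a • u)) = _ • g (r u)
      rw [map_smul, hg]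
    refine ⟨F.comp (Submodule.subtype _), fun u => (hF (s u)).trans ?_, fun F' hF' => ?_⟩
    · change g (r (s u)) = g u
      rw [hrs]
    · have h1 : F'.comp π = F := h.hom_ext fun u => by
        rw [LinearMap.comp_apply, hπξ, hF', hF]
        rfl
      ext w
      rw [← h1]
      change F' w = F' (π w.1)
      rw [hπ]

/-- Induction from the inertia group reflects isomorphisms in the block. -/
lemma IsInducedUnit.nonempty_equiv_of_equiv {U U' W' : Type} [AddCommGroup U]
    [Module (MonoidAlgebra k (inertia k Gt G b)) U] [AddCommGroup U']
    [Module (MonoidAlgebra k (inertia k Gt G b)) U'] [AddCommGroup W']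
    [Module (MonoidAlgebra k Gt) W'] {η : U →+ W} {η' : U' →+ W'}
    (hb : IsBlockIdem (MonoidAlgebra k G) b)
    (h : IsInducedUnit k (inertia k Gt G b).subtype U W η)
    (h' : IsInducedUnit k (inertia k Gt G b).subtype U' W' η')
    (hU : ∀ u : U, MapAlong k (Subgroup.inclusion hGI) b • u = u)
    (hU' : ∀ u : U', MapAlong k (Subgroup.inclusion hGI) b • u = u)
    (F : W ≃ₗ[MonoidAlgebra k Gt] W') :
    Nonempty (U ≃ₗ[MonoidAlgebra k (inertia k Gt G b)] U') := by
  obtain ⟨g, hg⟩ := h.exists_descend hb h' hU hU' F.toLinearMap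
  obtain ⟨g', hg'⟩ := h'.exists_descend hb h hU' hU F.symm.toLinearMap
  refine ⟨LinearEquiv.ofLinearMap g g' ?_ ?_⟩
  · ext u
    apply h'.injective
    rw [LinearMap.comp_apply, ← hg, ← hg']
    exact F.apply_symm_apply _
  · ext u
    apply h.injective
    rw [LinearMap.comp_apply, ← hg', ← hg]
    exact F.symm_apply_apply _

end InducedSemibrick

section KrullSchmidt

variable {k R : Type} [Field k] [Ring R] [Algebra k R] {ι κ : Type}

lemma finrank_hom_pi [Finite ι] {E : BModule k R} {X : ι → BModule k R} (hE : IsBrickOver k R E)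
    (hX : ∀ i, IsEmpty (E ≃ₗ[R] X i) → ∀ f : E →ₗ[R] X i, f = 0) :
    Module.finrank k (E →ₗ[R] ∀ i, X i) = Nat.card {i // Nonempty (E ≃ₗ[R] X i)} := by
  classical
  have := Fintype.ofFinite ι
  have := hE.1
  let α : ∀ i : {i // Nonempty (E ≃ₗ[R] X i)}, E ≃ₗ[R] X i := fun i => i.2.some
  let Ψ : ({i // Nonempty (E ≃ₗ[R] X i)} → k) →ₗ[k] (E →ₗ[R] ∀ i, X i) :=
    { toFun := fun c => LinearMap.pi fun i =>
        if hi : Nonempty (E ≃ₗ[R] X i) then c ⟨i, hi⟩ • (α ⟨i, hi⟩).toLinearMap else 0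
      map_add' := fun c d => LinearMap.ext fun u => funext fun i => by
        by_cases hi : Nonempty (E ≃ₗ[R] X i) <;> simp [hi, add_smul]
      map_smul' := fun r c => LinearMap.ext fun u => funext fun i => by
        by_cases hi : Nonempty (E ≃ₗ[R] X i) <;> simp [hi, mul_smul] }
  have hΨ : ∀ c (i : {i // Nonempty (E ≃ₗ[R] X i)}) u, Ψ c u i.1 = c i • α i u := by
    intro c i u
    change (if hi : Nonempty (E ≃ₗ[R] X i) then c ⟨i, hi⟩ • (α ⟨i, hi⟩).toLinearMap
      else (0 : E →ₗ[R] X i)) u = _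
    rw [dif_pos i.2]
    rfl
  have hbij : Function.Bijective Ψ := by
    constructor
    · intro c d hcd
      ext i
      obtain ⟨u, hu⟩ := exists_ne (0 : E)
      have h1 := hΨ c i u
      rw [hcd, hΨ] at h1
      exact (smul_left_injective k ((α i).map_ne_zero_iff.2 hu) h1).symm
    · intro f
      have h1 : ∀ i : {i // Nonempty (E ≃ₗ[R] X i)}, ∃ c : k, ∀ u, f u i.1 = c • α i u := by
        intro i
        obtain ⟨c, hc⟩ := hE.2 ((α i).symm.toLinearMap.comp ((LinearMap.proj i.1).comp f))
        refine ⟨c, fun u => ?_⟩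
        have h2 : (α i).symm (f u i.1) = algebraMap k R c • u := hc u
        rw [← algebraMap_smul R, ← map_smul, ← h2, LinearEquiv.apply_symm_apply]
      choose c hc using h1
      refine ⟨c, LinearMap.ext fun u => funext fun i => ?_⟩
      by_cases hi : Nonempty (E ≃ₗ[R] X i)
      · exact (hΨ c ⟨i, hi⟩ u).trans (hc ⟨i, hi⟩ u).symm
      · have h2 : Ψ c u i = 0 := by
          change (if hi : Nonempty (E ≃ₗ[R] X i) then c ⟨i, hi⟩ • (α ⟨i, hi⟩).toLinearMap
            else (0 : E →ₗ[R] X i)) u = 0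
          rw [dif_neg hi, LinearMap.zero_apply]
        rw [h2]
        exact (LinearMap.congr_fun (hX i (not_nonempty_iff.1 hi)
          ((LinearMap.proj i).comp f)) u).symm
  rw [← (LinearEquiv.ofBijective Ψ hbij).finrank_eq, Module.finrank_fintype_fun_eq_card,
    Nat.card_eq_fintype_card]

lemma exists_nonempty_equiv_of_pi_equiv [Finite κ] {X : ι → BModule k R} {Y : κ → BModule k R}
    (hX : ∀ i, IsBrickOver k R (X i)) (hY : ∀ j, IsBrickOver k R (Y j))
    (ε : (∀ i, X i) ≃ₗ[R] ∀ j, Y j) (i : ι) : ∃ j, Nonempty (X i ≃ₗ[R] Y j) := by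
  classical
  have := Fintype.ofFinite κ
  have := (hX i).1
  let p : ∀ j, X i →ₗ[R] Y j := fun j =>
    (LinearMap.proj j).comp (ε.toLinearMap.comp (LinearMap.single R (fun i => (X i).carrier) i))
  let q : ∀ j, Y j →ₗ[R] X i := fun j =>
    (LinearMap.proj i).comp (ε.symm.toLinearMap.comp (LinearMap.single R (fun i => (Y i).carrier) j))
  have hsum : ∀ u, ∑ j, q j (p j u) = u := by
    intro u
    change ∑ j, ε.symm (Pi.single j (ε (Pi.single i u) j)) i = u
    rw [← Finset.sum_apply, ← map_sum, Finset.univ_sum_single, LinearEquiv.symm_apply_apply,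
      Pi.single_eq_same]
  obtain ⟨j, hj⟩ : ∃ j, (q j).comp (p j) ≠ 0 := by
    by_contra! h0
    obtain ⟨u, hu⟩ := exists_ne (0 : X i)
    apply hu
    rw [← hsum u]
    exact Finset.sum_eq_zero fun j _ => LinearMap.congr_fun (h0 j) u
  obtain ⟨r, hr⟩ := (hX i).2 ((q j).comp (p j))
  obtain ⟨s, hs⟩ := (hY j).2 ((p j).comp (q j))
  replace hr : ∀ u, q j (p j u) = algebraMap k R r • u := hr
  replace hs : ∀ u, p j (q j u) = algebraMap k R s • u := hs
  have hr0 : r ≠ 0 := by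
    rintro rfl
    apply hj
    ext u
    rw [LinearMap.comp_apply, hr, map_zero, zero_smul, LinearMap.zero_apply]
  have hs0 : s ≠ 0 := by
    rintro rfl
    obtain ⟨u, hu⟩ := exists_ne (0 : X i)
    have h1 := hs (p j u)
    rw [hr, map_smul, map_zero, zero_smul] at h1
    have h2 := congrArg (q j) h1
    rw [map_smul, hr, map_zero, algebraMap_smul, algebraMap_smul, smul_eq_zero_iff_right hr0,
      smul_eq_zero_iff_right hr0] at h2
    exact hu h2
  refine ⟨j, ⟨LinearEquiv.ofBijective (p j) ⟨?_, fun v => ⟨q j (algebraMap k R s⁻¹ • v), ?_⟩⟩⟩⟩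
  · rw [injective_iff_map_eq_zero]
    intro u hu
    have h1 := hr u
    rwa [hu, map_zero, algebraMap_smul, eq_comm, smul_eq_zero_iff_right hr0] at h1
  · rw [hs, ← mul_smul, ← map_mul, mul_inv_cancel₀ hs0, map_one, one_smul]

/-- Multiplicities of bricks in isomorphic semibricks agree. -/
lemma card_equiv_eq_of_pi_equiv [Finite ι] [Finite κ] {X : ι → BModule k R} {Y : κ → BModule k R}
    (hX : ∀ i, IsBrickOver k R (X i)) (hY : ∀ j, IsBrickOver k R (Y j))
    (hXX : ∀ i i', IsEmpty (X i ≃ₗ[R] X i') → ∀ f : X i →ₗ[R] X i', f = 0)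
    (hYY : ∀ j j', IsEmpty (Y j ≃ₗ[R] Y j') → ∀ f : Y j →ₗ[R] Y j', f = 0)
    (ε : (∀ i, X i) ≃ₗ[R] ∀ j, Y j) (i : ι) :
    Nat.card {i' // Nonempty (X i ≃ₗ[R] X i')} = Nat.card {j // Nonempty (X i ≃ₗ[R] Y j)} := by
  obtain ⟨j, ⟨α⟩⟩ := exists_nonempty_equiv_of_pi_equiv hX hY ε i
  rw [← finrank_hom_pi (hX i) (hXX i), ← finrank_hom_pi (hX i) (X := Y) fun j' hj' f => ?_]
  · have hk : ∀ (c : k) u, ε (c • u) = c • ε u := fun c u => by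
      rw [← algebraMap_smul R, map_smul, algebraMap_smul]
    exact LinearEquiv.finrank_eq
      { toFun := fun g => ε.toLinearMap.comp g
        invFun := fun g => ε.symm.toLinearMap.comp g
        left_inv := fun g => LinearMap.ext fun u => ε.symm_apply_apply _
        right_inv := fun g => LinearMap.ext fun u => ε.apply_symm_apply _
        map_add' := fun g g' => LinearMap.ext fun u => map_add ε _ _
        map_smul' := fun c g => LinearMap.ext fun u => hk _ _ }
  · have h1 := hYY j j' ⟨fun β => hj'.false (α.trans β)⟩ (f.comp α.symm.toLinearMap)
    ext u
    have h2 := LinearMap.congr_fun h1 (α u)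
    simpa using h2

lemma nonempty_pi_equiv_of_card_eq [Finite ι] [Finite κ] {X : ι → BModule k R}
    {Y : κ → BModule k R}
    (h₁ : ∀ i, Nat.card {i' // Nonempty (X i ≃ₗ[R] X i')} =
      Nat.card {j // Nonempty (X i ≃ₗ[R] Y j)})
    (h₂ : ∀ j, Nat.card {j' // Nonempty (Y j ≃ₗ[R] Y j')} =
      Nat.card {i // Nonempty (Y j ≃ₗ[R] X i)}) :
    Nonempty ((∀ i, X i) ≃ₗ[R] ∀ j, Y j) := by
  let Z : ι ⊕ κ → BModule k R := Sum.elim X Y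
  let s : Setoid (ι ⊕ κ) :=
    { r := fun a a' => Nonempty (Z a ≃ₗ[R] Z a')
      iseqv := ⟨fun _ => ⟨LinearEquiv.refl _ _⟩, fun ⟨g⟩ => ⟨g.symm⟩,
        fun ⟨g⟩ ⟨g'⟩ => ⟨g.trans g'⟩⟩ }
  let F : ι → Quotient s := fun i => Quotient.mk s (Sum.inl i)
  let F' : κ → Quotient s := fun j => Quotient.mk s (Sum.inr j)
  have hF : ∀ a i, F i = Quotient.mk s a ↔ Nonempty (Z a ≃ₗ[R] X i) := fun a i =>
    eq_comm.trans Quotient.eq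
  have hF' : ∀ a j, F' j = Quotient.mk s a ↔ Nonempty (Z a ≃ₗ[R] Y j) := fun a i =>
    eq_comm.trans Quotient.eq
  have hcard : ∀ z, Nat.card {i // F i = z} = Nat.card {j // F' j = z} := by
    intro z
    induction z using Quotient.inductionOn with
    | h a =>
      simp only [hF, hF']
      cases a with
      | inl i => exact h₁ i
      | inr j => exact (h₂ j).symm
  let σ : ι ≃ κ := (Equiv.sigmaFiberEquiv F).symm.trans
    ((Equiv.sigmaCongrRight fun z => (Finite.card_eq.1 (hcard z)).some).trans
      (Equiv.sigmaFiberEquiv F'))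
  have hσ : ∀ i, F' (σ i) = F i := fun i =>
    ((Finite.card_eq.1 (hcard (F i))).some ⟨i, rfl⟩).2
  have hXY : ∀ i, Nonempty (X i ≃ₗ[R] Y (σ i)) := fun i => (hF' (Sum.inl i) _).1 (hσ i)
  exact ⟨(LinearEquiv.piCongrRight fun i => (hXY i).some).trans
    (LinearEquiv.piCongrLeft R (fun j => (Y j).carrier) σ)⟩

end KrullSchmidt

section CountExtensions

variable {k : Type} [Field k] {G I : Type} [Group G] [Group I] {f : G →* I}

lemma ExtendsAlong.nonempty_equiv {S S' E E' : Type} [AddCommGroup S]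
    [Module (MonoidAlgebra k G) S] [AddCommGroup S'] [Module (MonoidAlgebra k G) S']
    [AddCommGroup E] [Module (MonoidAlgebra k I) E] [AddCommGroup E'] [Module (MonoidAlgebra k I) E']
    (hE : ExtendsAlong k f S E) (hE' : ExtendsAlong k f S' E')
    (g : E ≃ₗ[MonoidAlgebra k I] E') : Nonempty (S ≃ₗ[MonoidAlgebra k G] S') := by
  obtain ⟨θ, hθ⟩ := hE
  obtain ⟨θ', hθ'⟩ := hE'
  exact ⟨{ (θ.trans (g.toAddEquiv.trans θ'.symm)) with
    map_smul' := fun a s => θ'.injective (by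
      change θ' (θ'.symm (g (θ (a • s)))) = θ' (a • θ'.symm (g (θ s)))
      rw [hθ', θ'.apply_symm_apply, θ'.apply_symm_apply, hθ, map_smul]) }⟩

/-- Among the extensions of a family of bricks, those isomorphic to a given extension of `S₀`
correspond to the members of the family isomorphic to `S₀`. -/
lemma card_extensions_equiv [Finite I] {N : Subgroup I} [N.Normal]
    (hN : ∀ x, x ∈ N ↔ ∃ g, f g = x)
    (hbasic : BasicAlg k (MonoidAlgebra k (I ⧸ N))) {e : ℕ}
    (he : RepClasses k (MonoidAlgebra k (I ⧸ N))
      (fun V => IsSimpleModule (MonoidAlgebra k (I ⧸ N)) V) e)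
    {n : ℕ} {S : Fin n → BModule k (MonoidAlgebra k G)}
    {E : Fin n → Fin e → BModule k (MonoidAlgebra k I)}
    (hS : ∀ i, IsBrickOver k (MonoidAlgebra k G) (S i))
    (hE : ∀ i j, ExtendsAlong k f (S i) (E i j))
    (hdist : ∀ i j j', j ≠ j' → IsEmpty (E i j ≃ₗ[MonoidAlgebra k I] E i j'))
    {S₀ : BModule k (MonoidAlgebra k G)} {E₀ : BModule k (MonoidAlgebra k I)}
    (hE₀ : ExtendsAlong k f S₀ E₀) {c : MonoidAlgebra k I} (hc : ∀ u : E₀, c • u = u) :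
    Nat.card {l : {l : Fin n × Fin e // ∀ u : E l.1 l.2, c • u = u} //
      Nonempty (E₀ ≃ₗ[MonoidAlgebra k I] E l.1.1 l.1.2)} =
    Nat.card {i // Nonempty (S₀ ≃ₗ[MonoidAlgebra k G] S i)} := by
  refine Nat.card_congr (Equiv.ofBijective
    (fun l => ⟨l.1.1.1, l.2.elim fun g => hE₀.nonempty_equiv (hE _ _) g⟩) ⟨?_, ?_⟩)
  · rintro ⟨⟨⟨i, j⟩, hl⟩, ⟨g⟩⟩ ⟨⟨⟨i', j'⟩, hl'⟩, ⟨g'⟩⟩ h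
    obtain rfl : i = i' := congrArg Subtype.val h
    obtain rfl : j = j' := by
      by_contra hj
      exact (hdist i j j' hj).false (g.symm.trans g')
    rfl
  · rintro ⟨i, ⟨α⟩⟩
    have hE₀' := hE₀
    obtain ⟨θ, hθ⟩ := hE₀
    have := (hS i).1
    obtain ⟨j, g, hg⟩ := exists_extension_hom hN hbasic he (hS i) (hE i) (hdist i) E₀
      (θ.toAddMonoidHom.comp α.symm.toLinearMap.toAddMonoidHom)
      (fun a u => by
        change θ (α.symm (a • u)) = _ • θ (α.symm u)
        rw [map_smul, hθ])
      (by
        intro h0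
        obtain ⟨u, hu⟩ := exists_ne (0 : S i)
        have h1 : θ (α.symm u) = 0 := DFunLike.congr_fun h0 u
        rw [EmbeddingLike.map_eq_zero_iff, EmbeddingLike.map_eq_zero_iff] at h1
        exact hu h1)
    obtain ⟨γ⟩ := (hE i j).nonempty_equiv_of_ne_zero (hS i) hE₀'
      (fun h0 => (h0.false α.symm).elim) hg
    exact ⟨⟨⟨(i, j), fun u => γ.injective (by rw [map_smul, hc])⟩, ⟨γ.symm⟩⟩, rfl⟩

end CountExtensions

section InducedExtensions

variable {k : Type} [Field k] {Gt : Type} [Group Gt] [Finite Gt] {G : Subgroup Gt} [G.Normal]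
  {b : MonoidAlgebra k G} {hGI : G ≤ inertia k Gt G b}

/-- The indices of the extensions on which a central idempotent acts as the identity. -/
abbrev BlockIndex {R : Type} [Ring R] [Algebra k R] (c : R) {n e : ℕ}
    (E : Fin n → Fin e → BModule k R) : Type :=
  {l : Fin n × Fin e // ∀ u : E l.1 l.2, c • u = u}

omit [Finite Gt] [G.Normal] in
/-- The block component of the module induced from all extensions is induced from the
extensions lying in the corresponding block of the inertia group. -/
lemma exists_isInducedUnit_blockComp {bt : MonoidAlgebra k Gt}
    (hbt : IsCentralIdem (MonoidAlgebra k Gt) bt)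
    {n e : ℕ} {S : Fin n → BModule k (MonoidAlgebra k G)}
    (hblock : ∀ i, LiesIn (MonoidAlgebra k G) b (S i))
    (hbricks : ∀ i, IsBrickOver k (MonoidAlgebra k G) (S i))
    {St : Fin n → Fin e → BModule k (MonoidAlgebra k (inertia k Gt G b))}
    (hSt : ∀ i j, ExtendsAlong k (Subgroup.inclusion hGI) (S i) (St i j))
    {c : MonoidAlgebra k (inertia k Gt G b)}
    (hc : MapAlong k (inertia k Gt G b).subtype c = MapAlong k G.subtype b * bt)
    (hci : IsCentralIdem _ c)
    {W : Type} [AddCommGroup W] [Module (MonoidAlgebra k Gt) W]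
    (hW : IsInducedAlong k (inertia k Gt G b).subtype
      ((i : Fin n) → (j : Fin e) → St i j) W) :
    ∃ ξ : ((l : BlockIndex c St) → St l.1.1 l.1.2) →+
        blockComp (MonoidAlgebra k Gt) bt hbt.2 W,
      IsInducedUnit k (inertia k Gt G b).subtype _
        (blockComp (MonoidAlgebra k Gt) bt hbt.2 W) ξ := by
  classical
  obtain ⟨η, hη⟩ := hW
  let s : ((l : BlockIndex c St) → St l.1.1 l.1.2) →ₗ[MonoidAlgebra k (inertia k Gt G b)]
      ((i : Fin n) → (j : Fin e) → St i j) :=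
    { toFun := fun u i j => if h : ∀ v : St i j, c • v = v then u ⟨(i, j), h⟩ else 0
      map_add' := fun u v => funext fun i => funext fun j => by
        by_cases h : ∀ v : St i j, c • v = v <;> simp [h]
      map_smul' := fun a u => funext fun i => funext fun j => by
        by_cases h : ∀ v : St i j, c • v = v <;> simp [h] }
  let r : ((i : Fin n) → (j : Fin e) → St i j) →ₗ[MonoidAlgebra k (inertia k Gt G b)]
      ((l : BlockIndex c St) → St l.1.1 l.1.2) :=
    { toFun := fun u l => u l.1.1 l.1.2
      map_add' := fun u v => rfl
      map_smul' := fun a u => rfl }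
  refine hη.blockComp (fun u => funext fun i => funext fun j =>
    (hSt i j).mapAlong_smul (hblock i) (u i j)) hbt hc s r (fun u => funext fun l => dif_pos l.2)
    fun u => funext fun i => funext fun j => ?_
  change (if h : ∀ v : St i j, c • v = v then u i j else 0) = c • u i j
  by_cases h : ∀ v : St i j, c • v = v
  · rw [dif_pos h, h]
  · rw [dif_neg h, (((hSt i j).isBrickOver (hbricks i)).smul_eq_or hci).resolve_left h]

/-- Semibricks with isomorphic block components of their induced modules have the same
multiplicities. -/
lemma card_equiv_eq_of_extensions_equiv (hb : IsBlockIdem (MonoidAlgebra k G) b)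
    (hbasic : BasicAlg k
      (MonoidAlgebra k (inertia k Gt G b ⧸ G.subgroupOf (inertia k Gt G b)))) {e : ℕ}
    (he : RepClasses k
        (MonoidAlgebra k (inertia k Gt G b ⧸ G.subgroupOf (inertia k Gt G b)))
        (fun V => IsSimpleModule
          (MonoidAlgebra k (inertia k Gt G b ⧸ G.subgroupOf (inertia k Gt G b))) V) e)
    {c : MonoidAlgebra k (inertia k Gt G b)} (hci : IsCentralIdem _ c)
    (hcb : c * MapAlong k (Subgroup.inclusion hGI) b = c) (hc0 : c ≠ 0)
    {n n' : ℕ} {S : Fin n → BModule k (MonoidAlgebra k G)}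
    {S' : Fin n' → BModule k (MonoidAlgebra k G)}
    (hblock : ∀ i, LiesIn (MonoidAlgebra k G) b (S i))
    (hbricks : ∀ i, IsBrickOver k (MonoidAlgebra k G) (S i))
    (hbricks' : ∀ i, IsBrickOver k (MonoidAlgebra k G) (S' i))
    (hhom : ∀ i j, IsEmpty (S i ≃ₗ[MonoidAlgebra k G] S j) →
      ∀ f : S i →ₗ[MonoidAlgebra k G] S j, f = 0)
    (hhom' : ∀ i j, IsEmpty (S' i ≃ₗ[MonoidAlgebra k G] S' j) →
      ∀ f : S' i →ₗ[MonoidAlgebra k G] S' j, f = 0)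
    {St : Fin n → Fin e → BModule k (MonoidAlgebra k (inertia k Gt G b))}
    {St' : Fin n' → Fin e → BModule k (MonoidAlgebra k (inertia k Gt G b))}
    (hSt : ∀ i j, ExtendsAlong k (Subgroup.inclusion hGI) (S i) (St i j))
    (hSt' : ∀ i j, ExtendsAlong k (Subgroup.inclusion hGI) (S' i) (St' i j))
    (hStdist : ∀ i j j', j ≠ j' →
      IsEmpty (St i j ≃ₗ[MonoidAlgebra k (inertia k Gt G b)] St i j'))
    (hStdist' : ∀ i j j', j ≠ j' →
      IsEmpty (St' i j ≃ₗ[MonoidAlgebra k (inertia k Gt G b)] St' i j'))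
    (ε : ((l : BlockIndex c St) → St l.1.1 l.1.2) ≃ₗ[MonoidAlgebra k (inertia k Gt G b)]
      ((l : BlockIndex c St') → St' l.1.1 l.1.2)) (i : Fin n) :
    Nat.card {i' // Nonempty (S i ≃ₗ[MonoidAlgebra k G] S i')} =
      Nat.card {i' // Nonempty (S i ≃ₗ[MonoidAlgebra k G] S' i')} := by
  have hN : ∀ x, x ∈ G.subgroupOf (inertia k Gt G b) ↔ ∃ g, Subgroup.inclusion hGI g = x :=
    fun x => ⟨fun hx => ⟨⟨x, hx⟩, rfl⟩, fun ⟨g, hg⟩ => by rw [← hg]; exact g.2⟩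
  obtain ⟨j, u, hu⟩ := exists_extension_smul_ne_zero hN (Subgroup.inclusion_injective hGI) hb
    hbasic he (hbricks i) (hblock i) (hSt i) (hStdist i) hci hcb hc0
  have hj : ∀ u : St i j, c • u = u :=
    (((hSt i j).isBrickOver (hbricks i)).smul_eq_or hci).resolve_right fun h => hu (h u)
  rw [← card_extensions_equiv hN hbasic he hbricks hSt hStdist (hSt i j) hj,
    ← card_extensions_equiv hN hbasic he hbricks' hSt' hStdist' (hSt i j) hj]
  exact card_equiv_eq_of_pi_equiv (X := fun l : BlockIndex c St => St l.1.1 l.1.2)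
    (Y := fun l : BlockIndex c St' => St' l.1.1 l.1.2)
    (fun l => (hSt _ _).isBrickOver (hbricks _)) (fun l => (hSt' _ _).isBrickOver (hbricks' _))
    (fun l l' hl f => by
      by_contra hf
      obtain ⟨g⟩ := (hSt _ _).nonempty_equiv_of_ne_zero (hbricks _) (hSt _ _) (hhom _ _) hf
      exact hl.false g)
    (fun l l' hl f => by
      by_contra hf
      obtain ⟨g⟩ := (hSt' _ _).nonempty_equiv_of_ne_zero (hbricks' _) (hSt' _ _) (hhom' _ _) hf
      exact hl.false g) ε ⟨(i, j), hj⟩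

end InducedExtensions

/-- Under conditions (i)–(iii), the `b̃`-part of the module induced
from the direct sum of all extending `kI`-modules of the bricks of a left finite
semibrick in `B`-mod is a left finite semibrick in `B̃`-mod, and non-isomorphic
semibricks yield non-isomorphic semibricks. -/
theorem statement_15 (k : Type) [Field k] [IsAlgClosed k]
    (p : ℕ) [Fact p.Prime] [CharP k p]
    (Gt : Type) [Group Gt] [Finite Gt] (G : Subgroup Gt) [G.Normal]
    (b : MonoidAlgebra k ↥G) (hb : IsBlockIdem (MonoidAlgebra k ↥G) b)
    (bt : MonoidAlgebra k Gt) (hbt : IsBlockIdem (MonoidAlgebra k Gt) bt)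
    (hcover : MapAlong k G.subtype b * bt ≠ 0)
    (hGI : G ≤ inertia k Gt G b)
    (hstable : ∀ S : BModule k (MonoidAlgebra k ↥G),
        Module.Finite (MonoidAlgebra k ↥G) ↥S → LiesIn (MonoidAlgebra k ↥G) b ↥S →
        IsBrickOver k (MonoidAlgebra k ↥G) ↥S →
        IsLeftFiniteIn (MonoidAlgebra k ↥G) (BlockFG (MonoidAlgebra k ↥G) b) ↥S →
        ∀ x ∈ inertia k Gt G b, IsStableAt k Gt G x ↥S)
    (hH2 : H2Trivial k (↥(inertia k Gt G b) ⧸ G.subgroupOf (inertia k Gt G b)))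
    (hbasic : BasicAlg k
      (MonoidAlgebra k (↥(inertia k Gt G b) ⧸ G.subgroupOf (inertia k Gt G b))))
    (e : ℕ)
    (he : RepClasses k
        (MonoidAlgebra k (↥(inertia k Gt G b) ⧸ G.subgroupOf (inertia k Gt G b)))
        (fun V => IsSimpleModule
          (MonoidAlgebra k (↥(inertia k Gt G b) ⧸ G.subgroupOf (inertia k Gt G b)))
          ↥V) e)
    (n : ℕ) (S : Fin n → BModule k (MonoidAlgebra k ↥G))
    (hfg : ∀ i, Module.Finite (MonoidAlgebra k ↥G) ↥(S i))
    (hblock : ∀ i, LiesIn (MonoidAlgebra k ↥G) b ↥(S i))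
    (hbricks : ∀ i, IsBrickOver k (MonoidAlgebra k ↥G) ↥(S i))
    (hhom : ∀ i j, IsEmpty (↥(S i) ≃ₗ[MonoidAlgebra k ↥G] ↥(S j)) →
        ∀ f : ↥(S i) →ₗ[MonoidAlgebra k ↥G] ↥(S j), f = 0)
    (hLF : IsLeftFiniteIn (MonoidAlgebra k ↥G) (BlockFG (MonoidAlgebra k ↥G) b)
        ((i : Fin n) → ↥(S i)))
    (St : Fin n → Fin e → BModule k (MonoidAlgebra k ↥(inertia k Gt G b)))
    (hSt : ∀ i j, ExtendsAlong k (Subgroup.inclusion hGI) ↥(S i) ↥(St i j))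
    (hStdist : ∀ i j j', j ≠ j' →
        IsEmpty (↥(St i j) ≃ₗ[MonoidAlgebra k ↥(inertia k Gt G b)] ↥(St i j')))
    (W : BModule k (MonoidAlgebra k Gt))
    (hW : IsInducedAlong k (inertia k Gt G b).subtype
        ((i : Fin n) → (j : Fin e) → ↥(St i j)) ↥W) :
    (Module.Finite (MonoidAlgebra k Gt)
        ↥(blockComp (MonoidAlgebra k Gt) bt hbt.2.1.2 ↥W) ∧
      LiesIn (MonoidAlgebra k Gt) bt
        ↥(blockComp (MonoidAlgebra k Gt) bt hbt.2.1.2 ↥W) ∧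
      IsSemibrickModule k (MonoidAlgebra k Gt)
        ↥(blockComp (MonoidAlgebra k Gt) bt hbt.2.1.2 ↥W) ∧
      IsLeftFiniteIn (MonoidAlgebra k Gt) (BlockFG (MonoidAlgebra k Gt) bt)
        ↥(blockComp (MonoidAlgebra k Gt) bt hbt.2.1.2 ↥W)) ∧
    ∀ (n' : ℕ) (S' : Fin n' → BModule k (MonoidAlgebra k ↥G)),
      (∀ i, Module.Finite (MonoidAlgebra k ↥G) ↥(S' i)) →
      (∀ i, LiesIn (MonoidAlgebra k ↥G) b ↥(S' i)) →
      (∀ i, IsBrickOver k (MonoidAlgebra k ↥G) ↥(S' i)) →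
      (∀ i j, IsEmpty (↥(S' i) ≃ₗ[MonoidAlgebra k ↥G] ↥(S' j)) →
          ∀ f : ↥(S' i) →ₗ[MonoidAlgebra k ↥G] ↥(S' j), f = 0) →
      IsLeftFiniteIn (MonoidAlgebra k ↥G) (BlockFG (MonoidAlgebra k ↥G) b)
        ((i : Fin n') → ↥(S' i)) →
      ∀ St' : Fin n' → Fin e → BModule k (MonoidAlgebra k ↥(inertia k Gt G b)),
        (∀ i j, ExtendsAlong k (Subgroup.inclusion hGI) ↥(S' i) ↥(St' i j)) →
        (∀ i j j', j ≠ j' →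
            IsEmpty (↥(St' i j) ≃ₗ[MonoidAlgebra k ↥(inertia k Gt G b)] ↥(St' i j'))) →
        ∀ W' : BModule k (MonoidAlgebra k Gt),
          IsInducedAlong k (inertia k Gt G b).subtype
            ((i : Fin n') → (j : Fin e) → ↥(St' i j)) ↥W' →
          Nonempty (↥(blockComp (MonoidAlgebra k Gt) bt hbt.2.1.2 ↥W)
              ≃ₗ[MonoidAlgebra k Gt] ↥(blockComp (MonoidAlgebra k Gt) bt hbt.2.1.2 ↥W')) →
          Nonempty (((i : Fin n) → ↥(S i)) ≃ₗ[MonoidAlgebra k ↥G]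
              ((i : Fin n') → ↥(S' i))) := by
  classical
  obtain ⟨c, hc, hc0, hcc, hcomm, hcb⟩ := exists_inertia_idem hb hbt hcover hGI
  have hci : IsCentralIdem _ c := ⟨hcc, hcomm⟩
  obtain ⟨ξ, hξ⟩ := exists_isInducedUnit_blockComp hbt.2.1 hblock hbricks hSt hc hci hW
  have hfgSt : ∀ i j, Module.Finite (MonoidAlgebra k (inertia k Gt G b)) (St i j) := fun i j => by
    have := hfg i
    exact (hSt i j).finite
  have hWfg : Module.Finite (MonoidAlgebra k Gt)
      (blockComp (MonoidAlgebra k Gt) bt hbt.2.1.2 W) := hξ.finite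
  have hWb : LiesIn (MonoidAlgebra k Gt) bt (blockComp (MonoidAlgebra k Gt) bt hbt.2.1.2 W) :=
    fun u => Subtype.ext u.2
  obtain ⟨η, hη⟩ := id hW
  refine ⟨⟨hWfg, hWb, ?_, ?_, ?_⟩, ?_⟩
  · refine hξ.isSemibrickModule hb (fun l => (hSt _ _).mapAlong_smul (hblock _))
      (fun l => (hSt _ _).isBrickOver (hbricks _)) fun l l' hl f => ?_
    by_contra hf
    obtain ⟨g⟩ := (hSt _ _).nonempty_equiv_of_ne_zero (hbricks _) (hSt _ _) (hhom _ _) hf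
    exact hl.false g
  · exact contravariantlyFinite_torsClIn (S := blockComp (MonoidAlgebra k Gt) bt hbt.2.1.2 W)
      ⟨hWfg, hWb⟩
  · exact covariantlyFinite_blockComp hb hbt hcover hSt hη hbasic he hfg hblock hbricks hStdist
      hWfg hLF.2
  · rintro n' S' - hblock' hbricks' hhom' - St' hSt' hStdist' W' hW' ⟨F⟩
    obtain ⟨ξ', hξ'⟩ := exists_isInducedUnit_blockComp hbt.2.1 hblock' hbricks' hSt' hc hci hW'
    obtain ⟨ε⟩ := hξ.nonempty_equiv_of_equiv hb hξ'
      (fun u => funext fun l => (hSt _ _).mapAlong_smul (hblock _) (u l))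
      (fun u => funext fun l => (hSt' _ _).mapAlong_smul (hblock' _) (u l)) F
    exact nonempty_pi_equiv_of_card_eq
      (card_equiv_eq_of_extensions_equiv hb hbasic he hci hcb hc0 hblock hbricks hbricks' hhom hhom'
        hSt hSt' hStdist hStdist' ε)
      (card_equiv_eq_of_extensions_equiv hb hbasic he hci hcb hc0 hblock' hbricks' hbricks hhom'
        hhom hSt' hSt hStdist' hStdist ε.symm)

end Paper
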